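/- arXiv:1807.04785 — 7 statements merged into one kernel-verified Lean document; each statement's English description precedes it below -/
import Mathlib

section
/- Let n ≥ 2 and m be integers, and let G be a group isomorphic to the metacyclic group H_{n,m}. Then the exponent of G equals n if both n and m are even, and equals 2n otherwise. -/
/-- The exponent of the metacyclic group `H_{n,m}` is `n` when both `n` and `m` are even,
and `2n` otherwise. -/
theorem exponent_of_metacyclic (n : ℕ) (m : ℤ) (hn : 2 ≤ n) {G : Type*} [Group G] [Fintype G]
    (hG : Fintype.card G = 2 * n) (x y : G)
    (hx : orderOf x = n) (hy : y ^ 2 = x ^ m) (hyx : y * x = x⁻¹ * y)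
    (hgen : Subgroup.closure {x, y} = ⊤) :
    (Even n ∧ Even m → Monoid.exponent G = n) ∧
    (¬(Even n ∧ Even m) → Monoid.exponent G = 2 * n) := by
  have hdvd : n ∣ Monoid.exponent G := hx ▸ Monoid.order_dvd_exponent x
  have hxn : x ^ n = 1 := hx ▸ pow_orderOf_eq_one x
  constructor
  · rintro ⟨⟨t, ht⟩, ⟨s, hs⟩⟩
    refine Nat.dvd_antisymm (Monoid.exponent_dvd_of_forall_pow_eq_one ?_) hdvd
    have hconj : y * x * y⁻¹ = x⁻¹ := by rw [hyx]; group
    have hyk : ∀ k : ℤ, y * x ^ k = x ^ (-k) * y := by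
      intro k
      have h : (y * x * y⁻¹) ^ k = y * x ^ k * y⁻¹ := conj_zpow
      rw [hconj, inv_zpow, ← zpow_neg] at h
      rw [h]; group
    have hyy : y * y = x ^ m := by rw [← hy, pow_two]
    have hyinv : y⁻¹ = x ^ (-m) * y := by
      apply inv_eq_of_mul_eq_one_left
      rw [mul_assoc, hyy, ← zpow_add]; simp
    have hall : ∀ g : G, ∃ k : ℤ, g = x ^ k ∨ g = x ^ k * y := by
      intro g
      have hg : g ∈ Subgroup.closure {x, y} := hgen ▸ Subgroup.mem_top g
      induction hg using Subgroup.closure_induction with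
      | mem z hz =>
        rcases hz with rfl | hz
        · exact ⟨1, by simp⟩
        · rw [Set.mem_singleton_iff] at hz
          exact ⟨0, by simp [hz]⟩
      | one => exact ⟨0, by simp⟩
      | mul a b _ _ ha hb =>
        obtain ⟨j, rfl | rfl⟩ := ha <;> obtain ⟨k, rfl | rfl⟩ := hb
        · exact ⟨j + k, Or.inl (zpow_add _ _ _).symm⟩
        · exact ⟨j + k, Or.inr (by rw [zpow_add, mul_assoc])⟩
        · exact ⟨j + -k, Or.inr (by rw [mul_assoc, hyk, zpow_add, mul_assoc])⟩
        · refine ⟨j + -k + m, Or.inl ?_⟩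
          rw [mul_assoc, ← mul_assoc y, hyk, zpow_add, zpow_add, ← hyy]
          simp only [mul_assoc]
      | inv a _ ha =>
        obtain ⟨j, rfl | rfl⟩ := ha
        · exact ⟨-j, Or.inl (zpow_neg _ _).symm⟩
        · refine ⟨-m + j, Or.inr ?_⟩
          rw [mul_inv_rev, hyinv, ← zpow_neg, mul_assoc, hyk, neg_neg, zpow_add, mul_assoc]
    intro g
    obtain ⟨k, rfl | rfl⟩ := hall g
    · rw [← zpow_natCast, ← zpow_mul, mul_comm, zpow_mul, zpow_natCast, hxn, one_zpow]
    · have h2 : (x ^ k * y) ^ 2 = x ^ m := by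
        rw [pow_two, mul_assoc, ← mul_assoc y, hyk, mul_assoc, hyy, ← mul_assoc, ← zpow_add]
        simp
      have e : (m * (t : ℤ)) = (n : ℤ) * s := by rw [ht, hs]; push_cast; ring
      have e2 : n = 2 * t := by omega
      calc (x ^ k * y) ^ n = ((x ^ k * y) ^ 2) ^ t := by rw [← pow_mul, ← e2]
        _ = 1 := by
          rw [h2, ← zpow_natCast, ← zpow_mul, e, zpow_mul, zpow_natCast, hxn, one_zpow]
  · intro hne
    have hcard : Monoid.exponent G ∣ 2 * n := hG ▸ Group.exponent_dvd_card
    obtain ⟨k, hk⟩ := hdvd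
    have hk2 : k ∣ 2 := by
      rw [hk, mul_comm] at hcard
      exact Nat.dvd_of_mul_dvd_mul_right (by omega) hcard
    rcases (Nat.dvd_prime Nat.prime_two).1 hk2 with rfl | rfl
    · exfalso
      have hyn : y ^ n = 1 := by
        have := Monoid.pow_exponent_eq_one y
        rwa [hk, mul_one] at this
      rcases Nat.even_or_odd n with ⟨t, ht⟩ | ⟨t, ht⟩
      · apply hne
        refine ⟨⟨t, ht⟩, ?_⟩
        have e2 : n = 2 * t := by omega
        rw [e2, pow_mul, hy, ← zpow_natCast, ← zpow_mul, ← orderOf_dvd_iff_zpow_eq_one, hx, e2] at hyn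
        push_cast at hyn
        rw [even_iff_two_dvd]
        exact Int.dvd_of_mul_dvd_mul_right (by omega) hyn
      · have hymem : y ∈ Subgroup.zpowers x := by
          have : y = (x ^ m) ^ (t + 1) := by
            rw [← hy, ← pow_mul, show 2 * (t + 1) = n + 1 by omega, pow_succ, hyn, one_mul]
          rw [this]
          exact Subgroup.pow_mem _ (Subgroup.zpow_mem _ (Subgroup.mem_zpowers x) _) _
        have htop : Subgroup.zpowers x = ⊤ := by
          rw [eq_top_iff, ← hgen, Subgroup.closure_le]
          rintro z (rfl | hz)
          · exact Subgroup.mem_zpowers _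
          · rw [Set.mem_singleton_iff] at hz
            rw [hz]; exact hymem
        have hc := Nat.card_zpowers x
        rw [htop, Subgroup.card_top, Nat.card_eq_fintype_card, hG, hx] at hc
        omega
    · rw [hk, mul_comm]
end

section
/- Let n ≥ 2 be odd, m an integer, and G ≅ H_{n,m} with generators x, y as above. Let 0 ≤ α₁ < α₂ < ... < α_t < n be integers and S = {x^{α₁}y, ..., x^{α_t}y}. Then |∏_t(S)| ≥ t. -/
/-- `prodTuples t S` is the set of all `t`-fold products of distinct elements of `S`. -/
def prodTuples {G : Type*} [Group G] (t : ℕ) (S : Set G) : Set G :=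
  {g : G | ∃ l : List G, l.Nodup ∧ l.length = t ∧ (∀ a ∈ l, a ∈ S) ∧ l.prod = g}

open Classical in
/-- Set of sums of `k`-subsets of `A`. -/
noncomputable def subSums {M : Type*} [AddCommGroup M] (k : ℕ) (A : Finset M) : Finset M :=
  (A.powersetCard k).image (fun P => ∑ i ∈ P, i)

theorem mem_subSums {M : Type*} [AddCommGroup M] {k : ℕ} {A : Finset M} {s : M} :
    s ∈ subSums k A ↔ ∃ P, P ⊆ A ∧ P.card = k ∧ ∑ i ∈ P, i = s := by
  simp [subSums, Finset.mem_powersetCard, and_assoc]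

theorem subSums_mono {M : Type*} [AddCommGroup M] {k : ℕ} {A B : Finset M} (h : A ⊆ B) :
    subSums k A ⊆ subSums k B := by
  intro s hs
  obtain ⟨P, h1, h2, h3⟩ := mem_subSums.1 hs
  exact mem_subSums.2 ⟨P, h1.trans h, h2, h3⟩

theorem exists_symm_subset {M : Type*} [AddCommGroup M]
    (h2 : ∀ z : M, z + z = 0 → z = 0) (A : Finset M) (h0 : (0 : M) ∈ A)
    (hneg : ∀ z ∈ A, -z ∈ A) (j : ℕ) (hj : 2 * j + 1 ≤ A.card) :
    ∃ P ⊆ A, P.card = 2 * j ∧ (0 : M) ∉ P ∧ (∀ z ∈ P, -z ∈ P) ∧ ∑ i ∈ P, i = 0 := by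
  classical
  induction j with
  | zero => exact ⟨∅, by simp⟩
  | succ j ih =>
    obtain ⟨P, hPA, hc, hP0, hPn, hs⟩ := ih (by omega)
    have : ∃ h ∈ A, h ∉ insert 0 P := by
      apply Finset.exists_mem_notMem_of_card_lt_card
      rw [Finset.card_insert_of_notMem hP0]; omega
    obtain ⟨h, hA, hP⟩ := this
    simp only [Finset.mem_insert, not_or] at hP
    have hne : h ≠ -h := fun e => hP.1 (h2 h (by nth_rewrite 2 [e]; simp))
    have hnP : -h ∉ P := fun e => hP.2 (by simpa using hPn _ e)
    have hi : h ∉ insert (-h) P := by simp [hne, hP.2]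
    refine ⟨insert h (insert (-h) P), ?_, ?_, ?_, ?_, ?_⟩
    · intro z hz
      simp only [Finset.mem_insert] at hz
      rcases hz with rfl | rfl | hz
      · exact hA
      · exact hneg _ hA
      · exact hPA hz
    · rw [Finset.card_insert_of_notMem hi, Finset.card_insert_of_notMem hnP, hc]; ring
    · simp only [Finset.mem_insert, not_or]
      exact ⟨fun e => hP.1 e.symm, fun e => hP.1 (by simpa using e.symm), hP0⟩
    · intro z hz
      simp only [Finset.mem_insert] at hz ⊢
      rcases hz with rfl | rfl | hz
      · simp
      · simp
      · exact Or.inr (Or.inr (hPn z hz))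
    · rw [Finset.sum_insert hi, Finset.sum_insert hnP, hs]; simp

theorem zero_mem_subSums {M : Type*} [AddCommGroup M]
    (h2 : ∀ z : M, z + z = 0 → z = 0) (A : Finset M) (h0 : (0 : M) ∈ A)
    (hneg : ∀ z ∈ A, -z ∈ A) (k : ℕ) (hk : k < A.card) : (0 : M) ∈ subSums k A := by
  classical
  rcases Nat.even_or_odd' k with ⟨j, rfl | rfl⟩
  · obtain ⟨P, a, b, c, d, e⟩ := exists_symm_subset h2 A h0 hneg j (by omega)
    exact mem_subSums.2 ⟨P, a, b, e⟩
  · obtain ⟨P, a, b, c, d, e⟩ := exists_symm_subset h2 A h0 hneg j (by omega)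
    refine mem_subSums.2 ⟨insert 0 P, Finset.insert_subset h0 a, ?_, ?_⟩
    · rw [Finset.card_insert_of_notMem c, b]
    · rw [Finset.sum_insert c, e]; simp

theorem subSums_step {M : Type*} [AddCommGroup M]
    (h2 : ∀ z : M, z + z = 0 → z = 0) (A : Finset M) (h0 : (0 : M) ∈ A) (k : ℕ)
    (hk : 2 ≤ k) (hkA : k + 2 ≤ A.card)
    (hT : (subSums k A).card + 1 = A.card)
    (hU : ∀ a ∈ A, ∀ b ∈ A, a ≠ b →
      ∃ U : Finset M, A.card ≤ U.card + 2 ∧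
        (∀ u ∈ U, u + a ∈ subSums k A) ∧ (∀ u ∈ U, u + b ∈ subSums k A)) : False := by
  classical
  set T := subSums k A with hTdef
  -- differences of elements of A are differences of T
  have hAT : ∀ a ∈ A, ∀ b ∈ A, a ≠ b → ∃ u ∈ T, ∃ v ∈ T, u ≠ v ∧ u - v = a - b := by
    intro a ha b hb hab
    obtain ⟨U, hc, h3, h4⟩ := hU a ha b hb hab
    have : U.Nonempty := by rw [← Finset.card_pos]; omega
    obtain ⟨u, hu⟩ := this
    exact ⟨u + a, h3 u hu, u + b, h4 u hu, by simpa using hab, by abel⟩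
  have hfib : ∀ b ∈ A.erase 0, A.card - 2 ≤
      (T.offDiag.filter (fun p => p.1 - p.2 = b)).card := by
    intro b hb
    rw [Finset.mem_erase] at hb
    obtain ⟨U, hc, h3, h4⟩ := hU b hb.2 0 h0 hb.1
    calc A.card - 2 ≤ U.card := by omega
      _ = (U.image (fun u => (u + b, u + 0))).card := by
        rw [Finset.card_image_of_injective]
        intro u v h
        simpa using h
      _ ≤ _ := by
        apply Finset.card_le_card
        intro p hp
        obtain ⟨u, hu, rfl⟩ := Finset.mem_image.1 hp
        simp only [Finset.mem_filter, Finset.mem_offDiag]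
        exact ⟨⟨h3 u hu, h4 u hu, by simpa using hb.1⟩, by abel⟩
  have hTA : ∀ u ∈ T, ∀ v ∈ T, u ≠ v → u - v ∈ A := by
    have hsum : ∑ b ∈ A.erase 0, (T.offDiag.filter (fun p => p.1 - p.2 = b)).card
        = (T.offDiag.filter (fun p => p.1 - p.2 ∈ A.erase 0)).card := by
      rw [Finset.card_eq_sum_card_fiberwise (f := fun p : M × M => p.1 - p.2) (t := A.erase 0)]
      · apply Finset.sum_congr rfl
        intro b hb
        congr 1
        ext p
        simp only [Finset.mem_filter]
        constructor
        · rintro ⟨h, e⟩; exact ⟨⟨h, e ▸ hb⟩, e⟩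
        · rintro ⟨⟨h, _⟩, e⟩; exact ⟨h, e⟩
      · intro p hp
        exact (Finset.mem_filter.1 hp).2
    have hle : (A.erase 0).card * (A.card - 2) ≤
        ∑ b ∈ A.erase 0, (T.offDiag.filter (fun p => p.1 - p.2 = b)).card := by
      rw [← smul_eq_mul]
      exact Finset.card_nsmul_le_sum _ _ _ hfib
    rw [hsum, Finset.card_erase_of_mem h0] at hle
    have hoff : T.offDiag.card = (A.card - 1) * (A.card - 2) := by
      rw [Finset.offDiag_card]
      obtain ⟨c, hc⟩ : ∃ c, A.card = c + 2 := ⟨A.card - 2, by omega⟩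
      have : T.card = c + 1 := by omega
      rw [hc, this]
      simp only [Nat.add_sub_cancel, show c + 2 - 1 = c + 1 by omega]
      rw [← Nat.mul_sub_one]; simp
    have heq : T.offDiag.filter (fun p => p.1 - p.2 ∈ A.erase 0) = T.offDiag := by
      apply Finset.eq_of_subset_of_card_le (Finset.filter_subset _ _)
      rw [hoff]; exact hle
    intro u hu v hv huv
    have : (u, v) ∈ T.offDiag.filter (fun p => p.1 - p.2 ∈ A.erase 0) := by
      rw [heq]; simp [hu, hv, huv]
    exact Finset.mem_of_mem_erase (Finset.mem_filter.1 this).2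
  have hneg : ∀ z ∈ A, -z ∈ A := by
    intro z hz
    by_cases hz0 : z = 0
    · simpa [hz0] using h0
    obtain ⟨u, hu, v, hv, huv, e⟩ := hAT 0 h0 z hz (Ne.symm hz0)
    have := hTA u hu v hv huv
    rw [e] at this
    simpa using this
  have h0T : (0 : M) ∈ T := zero_mem_subSums h2 A h0 hneg k (by omega)
  have hTsub : T ⊆ A := by
    intro u hu
    by_cases hz0 : u = 0
    · simpa [hz0] using h0
    · simpa using hTA u hu 0 h0T hz0
  have hTneg : ∀ z ∈ T, -z ∈ T := by
    intro z hz
    obtain ⟨P, a, b, c⟩ := mem_subSums.1 hz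
    refine mem_subSums.2 ⟨P.image (fun z => -z), ?_, ?_, ?_⟩
    · intro w hw
      obtain ⟨u, hu, rfl⟩ := Finset.mem_image.1 hw
      exact hneg _ (a hu)
    · rw [Finset.card_image_of_injective _ neg_injective, b]
    · rw [Finset.sum_image (fun _ _ _ _ h => neg_injective h), Finset.sum_neg_distrib, c]
  have hc1 : (A \ T).card = 1 := by
    rw [Finset.card_sdiff_of_subset hTsub]; omega
  obtain ⟨p, hp⟩ := Finset.card_eq_one.1 hc1
  have hpm : p ∈ A \ T := by rw [hp]; simp
  rw [Finset.mem_sdiff] at hpm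
  have hpn : -p ∈ A \ T := by
    rw [Finset.mem_sdiff]
    exact ⟨hneg _ hpm.1, fun h => hpm.2 (by simpa using hTneg _ h)⟩
  rw [hp, Finset.mem_singleton] at hpn
  have : p = 0 := h2 p (by nth_rewrite 1 [← hpn]; simp)
  exact hpm.2 (this ▸ h0T)

theorem card_subSums_translate {M : Type*} [AddCommGroup M] [DecidableEq M]
    (A : Finset M) (k : ℕ) (c : M) :
    (subSums k (A.image (fun z => z + c))).card ≤ (subSums k A).card := by
  classical
  have : subSums k (A.image (fun z => z + c)) ⊆ (subSums k A).image (fun z => z + k • c) := by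
    intro s hs
    obtain ⟨P, h1, h2, h3⟩ := mem_subSums.1 hs
    have hinj : Function.Injective (fun z : M => z - c) := fun a b h => by simpa using h
    refine Finset.mem_image.2 ⟨s - k • c, mem_subSums.2 ⟨P.image (fun z => z - c), ?_, ?_, ?_⟩,
      by simp⟩
    · intro w hw
      obtain ⟨u, hu, rfl⟩ := Finset.mem_image.1 hw
      obtain ⟨v, hv, rfl⟩ := Finset.mem_image.1 (h1 hu)
      simpa using hv
    · rw [Finset.card_image_of_injective _ hinj, h2]
    · rw [Finset.sum_image (fun _ _ _ _ h => hinj h), Finset.sum_sub_distrib, h3]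
      simp [h2]
  exact (Finset.card_le_card this).trans Finset.card_image_le

theorem card_le_subSums {M : Type*} [AddCommGroup M]
    (h2 : ∀ z : M, z + z = 0 → z = 0) (t : ℕ) : ∀ (A : Finset M), A.card = t → ∀ k, 1 ≤ k →
    k < t → t ≤ (subSums k A).card := by
  classical
  induction t using Nat.strong_induction_on with
  | _ t ih =>
  -- first the case 0 ∈ A
  have key : ∀ (A : Finset M), (0 : M) ∈ A → A.card = t → ∀ k, 1 ≤ k →
      k < t → t ≤ (subSums k A).card := by
    intro A h0 hA k hk hkt
    by_cases hk1 : k = 1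
    · subst hk1
      rw [← hA]
      apply Finset.card_le_card
      intro a ha
      exact mem_subSums.2 ⟨{a}, by simpa using ha, by simp, by simp⟩
    by_cases hk2 : k + 1 = t
    · have : A.image (fun a => (∑ i ∈ A, i) - a) ⊆ subSums k A := by
        intro s hs
        obtain ⟨a, ha, rfl⟩ := Finset.mem_image.1 hs
        refine mem_subSums.2 ⟨A.erase a, Finset.erase_subset _ _, ?_, ?_⟩
        · rw [Finset.card_erase_of_mem ha]; omega
        · rw [← Finset.add_sum_erase A (fun i => i) ha]; simp
      have h := Finset.card_le_card this
      rw [Finset.card_image_of_injective _ (fun a b h => by simpa using h), hA] at h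
      exact h
    by_contra hlt
    push Not at hlt
    have h1 : t - 1 ≤ (subSums k A).card := by
      refine (ih (t - 1) (by omega) (A.erase 0) ?_ k hk (by omega)).trans
        (Finset.card_le_card (subSums_mono (Finset.erase_subset _ _)))
      rw [Finset.card_erase_of_mem h0, hA]
    refine subSums_step h2 A h0 k (by omega) (by omega) (by omega) ?_
    intro a ha b hb hab
    have hb' : b ∈ A.erase a := by simp [hb, hab.symm]
    refine ⟨subSums (k - 1) ((A.erase a).erase b), ?_, ?_, ?_⟩
    · have := ih (t - 2) (by omega) ((A.erase a).erase b) (by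
        rw [Finset.card_erase_of_mem hb', Finset.card_erase_of_mem ha]; omega) (k - 1)
        (by omega) (by omega)
      omega
    · intro u hu
      obtain ⟨P, p1, p2, p3⟩ := mem_subSums.1 hu
      have hn : a ∉ P := fun h => by simpa using p1 h
      refine mem_subSums.2 ⟨insert a P, ?_, ?_, ?_⟩
      · exact Finset.insert_subset ha
          (p1.trans ((Finset.erase_subset _ _).trans (Finset.erase_subset _ _)))
      · rw [Finset.card_insert_of_notMem hn]; omega
      · rw [Finset.sum_insert hn, p3, add_comm]
    · intro u hu
      obtain ⟨P, p1, p2, p3⟩ := mem_subSums.1 hu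
      have hn : b ∉ P := fun h => by simpa using p1 h
      refine mem_subSums.2 ⟨insert b P, ?_, ?_, ?_⟩
      · exact Finset.insert_subset hb
          (p1.trans ((Finset.erase_subset _ _).trans (Finset.erase_subset _ _)))
      · rw [Finset.card_insert_of_notMem hn]; omega
      · rw [Finset.sum_insert hn, p3, add_comm]
  intro A hA k hk hkt
  have hne : A.Nonempty := by rw [← Finset.card_pos]; omega
  obtain ⟨a, ha⟩ := hne
  refine (key (A.image (fun z => z + -a)) ?_ ?_ k hk hkt).trans (card_subSums_translate A k (-a))
  · exact Finset.mem_image.2 ⟨a, ha, by simp⟩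
  · rw [Finset.card_image_of_injective _ (fun a b h => by simpa using h), hA]

theorem exists_interleave {M G : Type*} [AddCommGroup M] [DecidableEq M] [Group G] (f : M → G) (y : G)
    (f0 : f 0 = 1) (fadd : ∀ a b, f (a + b) = f a * f b)
    (hy : ∀ a, y * f a = f (-a) * y) (N : ℕ) : ∀ P Q : Finset M, P.card + Q.card = N →
    Disjoint P Q → (P.card = Q.card ∨ P.card = Q.card + 1) →
    ∃ l : List M, l.Nodup ∧ l.length = N ∧ (∀ a, a ∈ l ↔ a ∈ P ∪ Q) ∧
      (l.map (fun z => f z * y)).prod = f (∑ i ∈ P, i - ∑ i ∈ Q, i) * y ^ N := by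
  induction N with
  | zero =>
    intro P Q h _ _
    have hP : P = ∅ := by rw [← Finset.card_eq_zero]; omega
    have hQ : Q = ∅ := by rw [← Finset.card_eq_zero]; omega
    subst hP hQ
    exact ⟨[], by simp [f0]⟩
  | succ N ih =>
    intro P Q h hd hc
    have hne : P.Nonempty := by rw [← Finset.card_pos]; omega
    obtain ⟨p, hp⟩ := hne
    have hce := Finset.card_erase_of_mem hp
    have hpQ : p ∉ Q := Finset.disjoint_left.1 hd hp
    obtain ⟨l, l1, l2, l3, l4⟩ := ih Q (P.erase p) (by omega)
      (hd.symm.mono_right (Finset.erase_subset _ _)) (by omega)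
    refine ⟨p :: l, ?_, by simp [l2], ?_, ?_⟩
    · rw [List.nodup_cons]
      exact ⟨fun h => by simpa [hpQ] using (l3 p).1 h, l1⟩
    · intro a
      rw [List.mem_cons, l3]
      simp only [Finset.mem_union, Finset.mem_erase]
      by_cases e : a = p
      · simp [e, hp]
      · simp [e, or_comm]
    · rw [List.map_cons, List.prod_cons, l4, pow_succ', ← Finset.add_sum_erase P (fun i => i) hp]
      rw [mul_assoc (f p) y, ← mul_assoc y, hy, ← mul_assoc, ← mul_assoc, ← fadd, mul_assoc]
      congr 2
      abel

/-- For `n` odd, a set `S` of `t` elements of the form `x^{α_i} y` in `H_{n,m}`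
has at least `t` distinct `t`-fold products. -/
theorem card_prodTuples_ge_of_odd (n : ℕ) (m : ℤ) (hn : 2 ≤ n) (hodd : Odd n)
    {G : Type*} [Group G] [Fintype G]
    (hG : Fintype.card G = 2 * n) (x y : G)
    (hx : orderOf x = n) (hy : y ^ 2 = x ^ m) (hyx : y * x = x⁻¹ * y)
    (hgen : Subgroup.closure {x, y} = ⊤)
    (t : ℕ) (α : Fin t → ℕ) (hmono : StrictMono α) (hα : ∀ i, α i < n) :
    t ≤ (prodTuples t (Set.range fun i => x ^ α i * y)).ncard := by
  classical
  haveI : NeZero n := ⟨by omega⟩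
  have h2 : ∀ z : ZMod n, z + z = 0 → z = 0 := by
    intro z hz
    have hu : IsUnit ((2 : ℕ) : ZMod n) := by
      rw [ZMod.isUnit_iff_coprime]
      exact hodd.coprime_two_left
    apply hu.mul_left_cancel
    rw [mul_zero, ← hz]; push_cast; ring
  let f : ZMod n → G := fun z => x ^ z.val
  have f0 : f 0 = 1 := by simp [f]
  have fadd : ∀ a b, f (a + b) = f a * f b := by
    intro a b
    simp only [f]
    have h := pow_mod_orderOf x (a.val + b.val)
    rw [hx] at h
    rw [ZMod.val_add, ← pow_add, h]
  have finj : Function.Injective f := by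
    intro a b h
    have := pow_injOn_Iio_orderOf (x := x) (by simpa [hx] using ZMod.val_lt a)
      (by simpa [hx] using ZMod.val_lt b) h
    exact ZMod.val_injective n this
  have fneg : ∀ a, f (-a) = (f a)⁻¹ := by
    intro a
    rw [eq_inv_iff_mul_eq_one, ← fadd]; simp [f0]
  have hyf : ∀ a, y * f a = f (-a) * y := by
    intro a
    have h : SemiconjBy y x x⁻¹ := hyx
    have := (h.pow_right a.val).eq
    rw [fneg]
    simp only [f]
    rw [this, inv_pow]
  have fα : ∀ i, f (α i : ZMod n) = x ^ α i := by
    intro i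
    simp only [f]
    rw [ZMod.val_natCast, Nat.mod_eq_of_lt (hα i)]
  let A : Finset (ZMod n) := Finset.univ.image (fun i => (α i : ZMod n))
  have hA : A.card = t := by
    rw [Finset.card_image_of_injective, Finset.card_univ, Fintype.card_fin]
    intro i j h
    apply hmono.injective
    have := congrArg ZMod.val h
    simpa [ZMod.val_natCast, Nat.mod_eq_of_lt (hα _)] using this
  -- every k-subset sum gives a product
  have hmem : ∀ s ∈ subSums ((t + 1) / 2) A,
      f (s + s - ∑ i ∈ A, i) * y ^ t ∈ prodTuples t (Set.range fun i => x ^ α i * y) := by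
    intro s hs
    obtain ⟨P, p1, p2, p3⟩ := mem_subSums.1 hs
    have hc := Finset.card_sdiff_of_subset p1
    obtain ⟨l, l1, l2, l3, l4⟩ := exists_interleave f y f0 fadd hyf t P (A \ P) (by omega)
      Finset.disjoint_sdiff (by omega)
    refine ⟨l.map (fun z => f z * y), ?_, by simp [l2], ?_, ?_⟩
    · exact l1.map (fun a b h => finj (mul_right_cancel h))
    · intro g hg
      obtain ⟨z, hz, rfl⟩ := List.mem_map.1 hg
      rw [l3, Finset.union_sdiff_of_subset p1] at hz
      obtain ⟨i, -, rfl⟩ := Finset.mem_image.1 hz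
      exact ⟨i, by simp [fα]⟩
    · rw [l4, ← Finset.sum_sdiff p1, p3]
      congr 2
      abel
  have hcard : t ≤ (subSums ((t + 1) / 2) A).card := by
    rcases Nat.lt_or_ge t 2 with h | h
    · have : (subSums ((t + 1) / 2) A).Nonempty := by
        obtain ⟨P, hP, hPc⟩ := Finset.exists_subset_card_eq (s := A) (n := (t + 1) / 2) (by omega)
        exact ⟨_, mem_subSums.2 ⟨P, hP, hPc, rfl⟩⟩
      have := Finset.card_pos.2 this
      omega
    · exact card_le_subSums h2 t A hA _ (by omega) (by omega)
  refine hcard.trans ?_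
  rw [← Set.ncard_coe_finset]
  refine Set.ncard_le_ncard_of_injOn (fun s => f (s + s - ∑ i ∈ A, i) * y ^ t) hmem ?_
    (Set.toFinite _)
  intro a _ b _ h
  have := finj (mul_right_cancel h)
  have h3 : a + a = b + b := by simpa using this
  have := h2 (a - b) (by rw [show a - b + (a - b) = (a + a) - (b + b) by abel, h3, sub_self])
  exact sub_eq_zero.1 this
end

section
/- Let n ≥ 2 be odd, m an integer, and G ≅ H_{n,m} with generators x, y as above. Let t ≥ 4, let 0 ≤ α₁ < ... < α_t < n be integers, and S = {x^{α₁}y, ..., x^{α_t}y}. Then |∏_t(S)| = t if and only if t divides n and there exists an integer b with 0 ≤ b ≤ n/t − 1 such that {α₁, ..., α_t} = {b + k·(n/t) : 0 ≤ k ≤ t−1}. -/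
section aux
variable {Z : Type*} [AddCommGroup Z] [DecidableEq Z]

def kS (k : ℕ) (A : Finset Z) : Finset Z := (A.powersetCard k).image (fun C => ∑ x ∈ C, x)

lemma mem_kS {k : ℕ} {A : Finset Z} {s : Z} :
    s ∈ kS k A ↔ ∃ C, C ⊆ A ∧ C.card = k ∧ ∑ x ∈ C, x = s := by
  simp [kS, Finset.mem_powersetCard, and_assoc]

def Cl (A : Finset Z) : Prop := ∀ x ∈ A, ∀ y ∈ A, ∀ z ∈ A, x + y - z ∈ A

lemma cl_sum {E : Finset Z} (hE : Cl E) {c : Z} (hc : c ∈ E) (C : Finset Z) :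
    C ⊆ E → ∀ h ∈ E, h + C.card • c - ∑ x ∈ C, x ∈ E := by
  induction C using Finset.induction_on with
  | empty => intro _ h hh; simpa using hh
  | insert a s ha ih =>
    intro hs h hh
    have h1 := ih (fun x hx => hs (Finset.mem_insert_of_mem hx)) h hh
    have h2 := hE _ h1 c hc a (hs (Finset.mem_insert_self _ _))
    rw [Finset.card_insert_of_notMem ha, Finset.sum_insert ha, succ_nsmul]
    convert h2 using 1
    abel

/-- swapping an element -/
lemma swap_fact {C : Finset Z} {c y : Z} (hc : c ∈ C) (hy : y ∉ C) :
    (insert y (C.erase c)).card = C.card ∧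
      ∑ x ∈ insert y (C.erase c), x = y + (∑ x ∈ C, x - c) := by
  have hy' : y ∉ C.erase c := fun h => hy (Finset.mem_of_mem_erase h)
  constructor
  · rw [Finset.card_insert_of_notMem hy', Finset.card_erase_of_mem hc]
    have : 0 < C.card := Finset.card_pos.2 ⟨c, hc⟩
    omega
  · rw [Finset.sum_insert hy', ← Finset.sum_erase_add _ _ hc]
    abel

lemma full (h2 : ∀ z : Z, z + z = 0 → z = 0) {E A : Finset Z} (hE : Cl E) {c p : Z}
    (hc : c ∈ E) (hAE : A ⊆ E)
    (hEA : E ⊆ insert p A) (k : ℕ) (hk : 1 ≤ k) (hkA : 2 * k ≤ A.card + 1)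
    (hp : 2 ≤ k ∨ p ∈ A) : ∀ h ∈ E, h + (k - 1) • c ∈ kS k A := by
  intro h hh
  by_contra hT
  have key : ∀ C, C ⊆ A → C.card = k - 1 → h + (k - 1) • c - ∑ x ∈ C, x ∈ E ∧
      h + (k - 1) • c - ∑ x ∈ C, x ∉ A \ C := by
    intro C hC hCk
    refine ⟨?_, ?_⟩
    · rw [← hCk]; exact cl_sum hE hc C (hC.trans hAE) h hh
    · intro hm
      rw [Finset.mem_sdiff] at hm
      apply hT
      rw [mem_kS]
      refine ⟨insert (h + (k - 1) • c - ∑ x ∈ C, x) C, ?_, ?_, ?_⟩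
      · intro z hz
        rcases Finset.mem_insert.1 hz with rfl | hz
        · exact hm.1
        · exact hC hz
      · rw [Finset.card_insert_of_notMem hm.2]; omega
      · rw [Finset.sum_insert hm.2]; abel
  by_cases hex : ∃ C, C ⊆ A ∧ C.card = k - 1 ∧ h + (k - 1) • c - ∑ x ∈ C, x ∈ C
  · obtain ⟨C, hC, hCk, hm⟩ := hex
    set d := h + (k - 1) • c - ∑ x ∈ C, x with hd
    have hmap : ∀ y ∈ A \ C, d + d - y ∈ insert p (C.erase d) := by
      intro y hy
      rw [Finset.mem_sdiff] at hy
      obtain ⟨s1, s2⟩ := swap_fact hm hy.2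
      have := key (insert y (C.erase d)) (by
        intro z hz
        rcases Finset.mem_insert.1 hz with rfl | hz
        · exact hy.1
        · exact hC (Finset.mem_of_mem_erase hz)) (by rw [s1, hCk])
      rw [s2] at this
      have e : h + (k - 1) • c - (y + (∑ x ∈ C, x - d)) = d + d - y := by
        rw [show h + (k-1) • c = d + ∑ x ∈ C, x by rw [hd]; abel]; abel
      rw [e] at this
      obtain ⟨t1, t2⟩ := this
      have t3 := hEA t1
      rw [Finset.mem_insert] at t3 ⊢
      rcases t3 with t3 | t3
      · exact Or.inl t3
      · right
        by_contra hcon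
        apply t2
        rw [Finset.mem_sdiff]
        refine ⟨t3, ?_⟩
        intro h5
        rcases Finset.mem_insert.1 h5 with h5 | h5
        · have : (d - y) + (d - y) = 0 := by
            rw [show (d - y) + (d - y) = (d + d - y) - y by abel, h5]; abel
          have := h2 _ this
          rw [sub_eq_zero] at this
          exact hy.2 (this ▸ hm)
        · exact hcon h5
    have hcard : (A \ C).card ≤ (insert p (C.erase d)).card := by
      apply Finset.card_le_card_of_injOn (fun y => d + d - y) hmap
      intro a _ b _ hab
      simpa using hab
    have h6 := Finset.card_insert_le p (C.erase d)
    rw [Finset.card_erase_of_mem hm] at h6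
    rw [Finset.card_sdiff_of_subset hC] at hcard
    have : 0 < C.card := Finset.card_pos.2 ⟨d, hm⟩
    omega
  · push Not at hex
    have hall : ∀ C, C ⊆ A → C.card = k - 1 → h + (k - 1) • c - ∑ x ∈ C, x = p ∧ p ∉ A := by
      intro C hC hCk
      obtain ⟨t1, t2⟩ := key C hC hCk
      have t3 := hex C hC hCk
      have t4 : h + (k - 1) • c - ∑ x ∈ C, x ∉ A := by
        intro h; exact t2 (Finset.mem_sdiff.2 ⟨h, t3⟩)
      have t5 := hEA t1
      rcases Finset.mem_insert.1 t5 with t5 | t5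
      · exact ⟨t5, t5 ▸ t4⟩
      · exact absurd t5 t4
    obtain ⟨C, hC, hCk⟩ := Finset.exists_subset_card_eq (show k - 1 ≤ A.card by omega)
    obtain ⟨u1, u2⟩ := hall C hC hCk
    have hk2 : 2 ≤ k := hp.resolve_right u2
    obtain ⟨d, hd⟩ := Finset.card_pos.1 (show 0 < C.card by omega)
    obtain ⟨y, hy⟩ := Finset.card_pos.1 (show 0 < (A \ C).card by
      rw [Finset.card_sdiff_of_subset hC]; omega)
    rw [Finset.mem_sdiff] at hy
    obtain ⟨s1, s2⟩ := swap_fact hd hy.2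
    obtain ⟨v1, -⟩ := hall (insert y (C.erase d)) (by
        intro z hz
        rcases Finset.mem_insert.1 hz with rfl | hz
        · exact hy.1
        · exact hC (Finset.mem_of_mem_erase hz)) (by rw [s1, hCk])
    rw [s2, ← u1] at v1
    have : y + (∑ x ∈ C, x - d) = ∑ x ∈ C, x := by simpa using v1
    have : y = d := by
      have h7 : y - d = 0 := by
        rw [show y - d = y + (∑ x ∈ C, x - d) - ∑ x ∈ C, x by abel, this]; abel
      exact sub_eq_zero.1 h7
    exact hy.2 (this ▸ hd)

lemma full_card (h2 : ∀ z : Z, z + z = 0 → z = 0) {E A : Finset Z} (hE : Cl E) {p : Z}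
    (hAE : A ⊆ E)
    (hEA : E ⊆ insert p A) (k : ℕ) (hk : 1 ≤ k) (hkA : 2 * k ≤ A.card + 1)
    (hp : 2 ≤ k ∨ p ∈ A) : E.card ≤ (kS k A).card := by
  obtain ⟨c, hc⟩ := Finset.card_pos.1 (show 0 < A.card by omega)
  apply Finset.card_le_card_of_injOn (fun h => h + (k - 1) • c)
    (full h2 hE (hAE hc) hAE hEA k hk hkA hp)
  intro a _ b _ hab
  simpa using hab

lemma kS_cl_card (h2 : ∀ z : Z, z + z = 0 → z = 0) {A : Finset Z} (hE : Cl A)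
    (k : ℕ) (hk : 1 ≤ k) (hkA : 2 * k ≤ A.card + 1) : (kS k A).card = A.card := by
  obtain ⟨c, hc⟩ := Finset.card_pos.1 (show 0 < A.card by omega)
  apply le_antisymm
  · apply Finset.card_le_card_of_injOn (fun s => c + k • c - s)
    · intro s hs
      obtain ⟨C, hC, hCk, rfl⟩ := mem_kS.1 hs
      have := cl_sum hE hc C hC c hc
      rw [hCk] at this
      exact this
    · intro a _ b _ hab
      simpa using hab
  · exact full_card h2 hE (p := c) subset_rfl (by simp) k hk hkA (Or.inr hc)

/-- representation count -/
def rr (T : Finset Z) (g : Z) : ℕ := (T.filter (fun s => s + g ∈ T)).card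

lemma rr_le (T : Finset Z) (g : Z) : rr T g ≤ T.card := Finset.card_filter_le _ _

lemma rr_zero (T : Finset Z) : rr T 0 = T.card := by simp [rr]

lemma rr_add (T : Finset Z) (g h : Z) : rr T g + rr T h ≤ rr T (g + h) + T.card := by
  set X := (T.filter (fun s => s + g ∈ T)).image (fun s => s + g)
  set Y := T.filter (fun s => s + h ∈ T)
  have hX : X.card = rr T g := by
    apply Finset.card_image_of_injective
    intro a b hab; simpa using hab
  have hXT : X ∪ Y ⊆ T := by
    intro z hz
    rcases Finset.mem_union.1 hz with hz | hz
    · obtain ⟨s, hs, rfl⟩ := Finset.mem_image.1 hz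
      exact (Finset.mem_filter.1 hs).2
    · exact (Finset.mem_filter.1 hz).1
  have h1 := Finset.card_union_add_card_inter X Y
  have h2 := Finset.card_le_card hXT
  have h3 : (X ∩ Y).card ≤ rr T (g + h) := by
    apply Finset.card_le_card_of_injOn (fun z => z - g)
    · intro z hz
      obtain ⟨hz1, hz2⟩ := Finset.mem_inter.1 hz
      obtain ⟨s, hs, rfl⟩ := Finset.mem_image.1 hz1
      have := (Finset.mem_filter.1 hz2).2
      simp only [add_sub_cancel_right]
      refine Finset.mem_coe.2 (Finset.mem_filter.2 ⟨(Finset.mem_filter.1 hs).1, ?_⟩)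
      rwa [← add_assoc]
    · intro a _ b _ hab
      simpa using hab
  have : Y.card = rr T h := rfl
  omega

lemma rr_sum (T F : Finset Z) : ∑ g ∈ F, rr T g ≤ T.card * T.card := by
  rw [← Finset.card_product]
  have := (Finset.sum_card_fiberwise_eq_card_filter (T ×ˢ T) F (fun q => q.2 - q.1)).le.trans
    (Finset.card_filter_le _ _)
  refine le_trans (Finset.sum_le_sum ?_) this
  intro g _
  apply Finset.card_le_card_of_injOn (fun s => (s, s + g))
  · intro s hs
    have := Finset.mem_filter.1 hs
    simp [this.1, this.2]
  · intro a _ b _ hab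
    exact (Prod.mk.inj hab).1

lemma kS_insert {k : ℕ} {A B : Finset Z} {a : Z} (ha : a ∉ B) (hB : insert a B ⊆ A) {s : Z}
    (hs : s ∈ kS k B) : a + s ∈ kS (k + 1) A := by
  obtain ⟨C, hC, hCk, rfl⟩ := mem_kS.1 hs
  have haC : a ∉ C := fun h => ha (hC h)
  exact mem_kS.2 ⟨insert a C, (Finset.insert_subset_insert a hC).trans hB,
    by rw [Finset.card_insert_of_notMem haC, hCk], by rw [Finset.sum_insert haC]⟩

lemma kS_cl_diff {k : ℕ} {A : Finset Z} (hA : Cl A) {c : Z} (hc : c ∈ A) {s : Z}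
    (hs : s ∈ kS k A) : c + k • c - s ∈ A := by
  obtain ⟨C, hC, hCk, rfl⟩ := mem_kS.1 hs
  have := cl_sum hA hc C hC c hc
  rwa [hCk] at this

lemma case1 (h2 : ∀ z : Z, z + z = 0 → z = 0) {A B : Finset Z} {a b : Z} (ha : a ∉ B) (hb : b ∉ B)
    (hab : a ≠ b) (hA : insert a (insert b B) ⊆ A) (hB : Cl B) (k : ℕ) (hk : 1 ≤ k)
    (hkB : 2 * (k + 1) ≤ B.card + 1) : 2 * B.card ≤ (kS (k + 2) A).card := by
  have c1 := kS_cl_card h2 hB k hk (by omega)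
  have c2 := kS_cl_card h2 hB (k + 1) (by omega) (by omega)
  set X := (kS (k + 1) B).image (fun s => a + s)
  set Y := (kS k B).image (fun s => a + (b + s))
  have hX : X.card = B.card := by
    rw [← c2]; apply Finset.card_image_of_injective
    intro u v huv; simpa using huv
  have hY : Y.card = B.card := by
    rw [← c1]; apply Finset.card_image_of_injective
    intro u v huv; simpa using huv
  have hdis : Disjoint X Y := by
    rw [Finset.disjoint_left]
    intro z hz1 hz2
    obtain ⟨s, hs, rfl⟩ := Finset.mem_image.1 hz1
    obtain ⟨s', hs', he⟩ := Finset.mem_image.1 hz2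
    have he : b + s' = s := by simpa using he
    obtain ⟨c, hc⟩ := Finset.card_pos.1 (show 0 < B.card by omega)
    have d1 := kS_cl_diff hB hc hs
    have d2 := kS_cl_diff hB hc hs'
    apply hb
    have := hB c hc _ d2 _ d1
    convert this using 1
    rw [← he, succ_nsmul]; abel
  rw [two_mul]
  nth_rewrite 1 [← hX]
  rw [← hY, ← Finset.card_union_of_disjoint hdis]
  apply Finset.card_le_card
  intro z hz
  rcases Finset.mem_union.1 hz with hz | hz
  · obtain ⟨s, hs, rfl⟩ := Finset.mem_image.1 hz
    refine kS_insert ha (subset_trans ?_ hA) hs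
    exact Finset.insert_subset_insert a (Finset.subset_insert _ _)
  · obtain ⟨s, hs, rfl⟩ := Finset.mem_image.1 hz
    refine kS_insert (B := insert b B) ?_ hA (kS_insert hb subset_rfl hs)
    simp [hab, ha]

lemma case2 (h2 : ∀ z : Z, z + z = 0 → z = 0) {A : Finset Z} (k : ℕ) (hk : 2 ≤ k)
    (hkA : 2 * k ≤ A.card) (hA6 : 6 ≤ A.card) (hT : (kS k A).card ≤ A.card)
    (hr : ∀ a ∈ A, ∀ b ∈ A, A.card ≤ rr (kS k A) (a - b) + 1) : Cl A := by
  classical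
  set T := kS k A with hTdef
  set t := A.card with ht
  obtain ⟨a, ha⟩ := Finset.card_pos.1 (show 0 < A.card by omega)
  set D := A.image (fun z => z - a) with hD
  have hDc : D.card = t := by
    apply Finset.card_image_of_injective
    intro u v huv; simpa using huv
  have h0D : (0 : Z) ∈ D := Finset.mem_image.2 ⟨a, ha, by simp⟩
  have hrD : ∀ d ∈ D, t ≤ rr T d + 1 := by
    intro d hd
    obtain ⟨z, hz, rfl⟩ := Finset.mem_image.1 hd
    exact hr z hz a ha
  have hTt : T.card = t := by
    by_contra hne
    have h1 : t ≤ T.card + 1 := (hrD 0 h0D).trans (by simpa using rr_le T 0)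
    have h3 := rr_sum T D
    have h4 : D.card • T.card ≤ ∑ g ∈ D, rr T g :=
      Finset.card_nsmul_le_sum _ _ _ (fun d hd => by have := hrD d hd; omega)
    rw [hDc, smul_eq_mul] at h4
    have : t * T.card ≤ T.card * T.card := h4.trans h3
    have := Nat.le_of_mul_le_mul_right this (by omega)
    omega
  set E := (D ×ˢ D).image (fun q => q.1 + q.2) with hE
  set F := (D ×ˢ E).image (fun q => q.1 + q.2) with hF
  have memE : ∀ u ∈ D, ∀ v ∈ D, u + v ∈ E := fun u hu v hv =>
    Finset.mem_image.2 ⟨(u, v), Finset.mem_product.2 ⟨hu, hv⟩, rfl⟩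
  have memF : ∀ u ∈ D, ∀ v ∈ E, u + v ∈ F := fun u hu v hv =>
    Finset.mem_image.2 ⟨(u, v), Finset.mem_product.2 ⟨hu, hv⟩, rfl⟩
  have hDE : D ⊆ E := fun d hd => by simpa using memE 0 h0D d hd
  have hEF : E ⊆ F := fun d hd => by simpa using memF 0 h0D d hd
  have hrF : ∀ f ∈ F, t ≤ rr T f + 3 := by
    intro f hf
    obtain ⟨⟨u, e⟩, hq, rfl⟩ := Finset.mem_image.1 hf
    obtain ⟨hu, he⟩ := Finset.mem_product.1 hq
    obtain ⟨⟨v, w⟩, hq', rfl⟩ := Finset.mem_image.1 he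
    obtain ⟨hv, hw⟩ := Finset.mem_product.1 hq'
    have := hrD u hu
    have := hrD v hv
    have := hrD w hw
    have := rr_add T v w
    have := rr_add T u (v + w)
    simp only at *
    omega
  have hFD : (F \ D).card ≤ 1 := by
    by_contra hcon
    have h3 := rr_sum T F
    have hs : ∑ g ∈ F, rr T g = ∑ g ∈ F \ D, rr T g + (∑ g ∈ D.erase 0, rr T g + rr T 0) := by
      rw [Finset.sum_erase_add _ _ h0D, Finset.sum_sdiff (hDE.trans hEF)]
    have h4 : (F \ D).card • (t - 3) ≤ ∑ g ∈ F \ D, rr T g :=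
      Finset.card_nsmul_le_sum _ _ _ (fun d hd => by
        have := hrF d (Finset.mem_sdiff.1 hd).1; omega)
    have h5 : (D.erase 0).card • (t - 1) ≤ ∑ g ∈ D.erase 0, rr T g :=
      Finset.card_nsmul_le_sum _ _ _ (fun d hd => by
        have := hrD d (Finset.mem_of_mem_erase hd); omega)
    rw [Finset.card_erase_of_mem h0D, hDc, smul_eq_mul] at h5
    rw [smul_eq_mul] at h4
    rw [rr_zero, hTt] at hs
    rw [hTt] at h3
    have h6 : 2 * (t - 3) ≤ (F \ D).card * (t - 3) := Nat.mul_le_mul_right _ (by omega)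
    obtain ⟨s, hs'⟩ : ∃ s, t = s + 6 := ⟨t - 6, by omega⟩
    rw [hs'] at h3 h4 h5 h6 hs
    simp only [show s + 6 - 3 = s + 3 by omega, show s + 6 - 1 = s + 5 by omega] at h3 h4 h5 h6 hs
    nlinarith
  have hDE_E : ∀ u ∈ D, ∀ v ∈ E, u + v ∈ E := by
    by_cases hED : E = D
    · intro u hu v hv
      rw [hED] at hv
      exact memE u hu v hv
    · have : ∃ e ∈ E, e ∉ D := by
        by_contra hcon
        push Not at hcon
        exact hED (Finset.Subset.antisymm hcon hDE)
      obtain ⟨e, he, heD⟩ := this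
      intro u hu v hv
      have hf := memF u hu v hv
      by_cases hfD : u + v ∈ D
      · exact hDE hfD
      · have := Finset.card_le_one.1 hFD _ (Finset.mem_sdiff.2 ⟨hf, hfD⟩) e
          (Finset.mem_sdiff.2 ⟨hEF he, heD⟩)
        rw [this]; exact he
  have hEE : ∀ u ∈ E, ∀ v ∈ E, u + v ∈ E := by
    intro u hu v hv
    obtain ⟨⟨u1, u2⟩, hq, rfl⟩ := Finset.mem_image.1 hu
    obtain ⟨hu1, hu2⟩ := Finset.mem_product.1 hq
    simp only at *
    rw [add_assoc]
    exact hDE_E _ hu1 _ (hDE_E _ hu2 _ hv)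
  have hEneg : ∀ z ∈ E, ∀ w ∈ E, w - z ∈ E := by
    intro z hz w hw
    have himg : E.image (fun v => v + z) = E := by
      apply Finset.eq_of_subset_of_card_le
      · intro v hv
        obtain ⟨v', hv', rfl⟩ := Finset.mem_image.1 hv
        exact hEE _ hv' _ hz
      · refine le_of_eq (Finset.card_image_of_injective _ ?_).symm
        intro u v huv; simpa using huv
    rw [← himg] at hw
    obtain ⟨v, hv, rfl⟩ := Finset.mem_image.1 hw
    simpa using hv
  set E' := E.image (fun z => z + a) with hE'
  have memE' : ∀ z, z ∈ E' ↔ z - a ∈ E := by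
    intro z
    constructor
    · intro hz
      obtain ⟨v, hv, rfl⟩ := Finset.mem_image.1 hz
      simpa using hv
    · intro hz
      exact Finset.mem_image.2 ⟨z - a, hz, by simp⟩
  have hclE' : Cl E' := by
    intro x hx y hy z hz
    rw [memE'] at *
    have := hEneg _ hz _ (hEE _ hx _ hy)
    convert this using 1
    abel
  have hAE' : A ⊆ E' := by
    intro z hz
    rw [memE']
    exact hDE (Finset.mem_image_of_mem _ hz)
  by_cases hED : E ⊆ D
  · have : A = E' := by
      apply Finset.Subset.antisymm hAE'
      intro z hz
      rw [memE'] at hz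
      obtain ⟨v, hv, hv'⟩ := Finset.mem_image.1 (hED hz)
      have : v = z := by simpa using hv'
      exact this ▸ hv
    rw [this]; exact hclE'
  · exfalso
    obtain ⟨e, he, heD⟩ := Finset.not_subset.1 hED
    have hsub : E' ⊆ insert (e + a) A := by
      intro z hz
      rw [memE'] at hz
      rw [Finset.mem_insert]
      by_cases hzD : z - a ∈ D
      · right
        obtain ⟨v, hv, hv'⟩ := Finset.mem_image.1 hzD
        have : v = z := by simpa using hv'
        exact this ▸ hv
      · left
        have := Finset.card_le_one.1 hFD _ (Finset.mem_sdiff.2 ⟨hEF hz, hzD⟩) e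
          (Finset.mem_sdiff.2 ⟨hEF he, heD⟩)
        rw [← this]; abel
    have h7 := full_card h2 hclE' hAE' hsub k (by omega) (by omega) (Or.inl hk)
    have h8 : A ⊂ E' := by
      refine Finset.ssubset_iff_subset_ne.2 ⟨hAE', ?_⟩
      intro h9
      have : e + a ∈ A := by rw [h9, memE']; simpa using he
      exact heD (Finset.mem_image.2 ⟨e + a, this, by simp⟩)
    have := Finset.card_lt_card h8
    have : (kS k A).card = t := hTt
    omega

end aux
section aux
variable {Z : Type*} [CommRing Z] [DecidableEq Z]
lemma five_le {T : Finset Z} {p q r s u : Z} (h : [p, q, r, s, u].Nodup)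
    (hT : ∀ z ∈ [p, q, r, s, u], z ∈ T) : 5 ≤ T.card := by
  rw [← show [p, q, r, s, u].toFinset.card = 5 by rw [List.toFinset_card_of_nodup h]; rfl]
  exact Finset.card_le_card (fun z hz => hT z (by simpa using hz))

lemma five_sum {T : Finset Z} {p q r s u : Z} (h : [p, q, r, s, u].Nodup)
    (hT : ∀ z ∈ [p, q, r, s, u], z ∈ T) (hc : T.card ≤ 5) : ∑ z ∈ T, z = p + q + r + s + u := by
  have hh : [p, q, r, s, u].toFinset = T := by
    apply Finset.eq_of_subset_of_card_le
    · exact (fun z hz => hT z (by simpa using hz))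
    · rw [List.toFinset_card_of_nodup h]; exact hc
  rw [← hh, List.sum_toFinset _ h]
  simp [add_assoc]

lemma q4 (h2 : ∀ z : Z, z + z = 0 → z = 0) {T : Finset Z} {a b c d : Z}
    (hn : [a, b, c, d].Nodup)
    (h1 : a + b ∈ T) (h3 : a + c ∈ T) (h4 : a + d ∈ T) (h5 : b + c ∈ T) (h6 : b + d ∈ T)
    (h7 : c + d ∈ T) : 5 ≤ T.card := by
  have k1 := h2 (b - c)
  have k2 := h2 (b - d)
  have k3 := h2 (c - d)
  simp at hn
  by_cases e1 : a + b = c + d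
  · refine five_le (p := a + b) (q := a + c) (r := a + d) (s := b + c) (u := b + d) ?_ (by simp [*])
    simp
    grind
  by_cases e2 : a + c = b + d
  · refine five_le (p := a + b) (q := a + c) (r := a + d) (s := b + c) (u := c + d) ?_ (by simp [*])
    simp
    grind
  · refine five_le (p := a + b) (q := a + c) (r := a + d) (s := b + d) (u := c + d) ?_ (by simp [*])
    simp
    grind

lemma q5' (h2 : ∀ z : Z, z + z = 0 → z = 0) {T : Finset Z} {a b c d e : Z}
    (hn : [a, b, c, d, e].Nodup)
    (hT : ∀ u ∈ [a, b, c, d, e], ∀ v ∈ [a, b, c, d, e], u ≠ v → u + v ∈ T)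
    (hc : T.card ≤ 5) (hab : a + b = c + d) : e + e ∈ T := by
  have k1 := h2 (b - c)
  have k2 := h2 (b - d)
  have k3 := h2 (c - d)
  have k4 := h2 (e + e - (a + b))
  simp at hn
  have m1 : a + b ∈ T := hT a (by simp) b (by simp) (by grind)
  have m2 : a + c ∈ T := hT a (by simp) c (by simp) (by grind)
  have m3 : a + d ∈ T := hT a (by simp) d (by simp) (by grind)
  have m4 : b + c ∈ T := hT b (by simp) c (by simp) (by grind)
  have m5 : b + d ∈ T := hT b (by simp) d (by simp) (by grind)
  have m6 : e + a ∈ T := hT e (by simp) a (by simp) (by grind)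
  have m7 : e + b ∈ T := hT e (by simp) b (by simp) (by grind)
  have m8 : e + c ∈ T := hT e (by simp) c (by simp) (by grind)
  have m9 : e + d ∈ T := hT e (by simp) d (by simp) (by grind)
  have s1 := five_sum (T := T) (p := a + b) (q := a + c) (r := a + d) (s := b + c) (u := b + d)
    (by simp; grind) (by simp [*]) hc
  have s2 := five_sum (T := T) (p := a + b) (q := e + a) (r := e + b) (s := e + c) (u := e + d)
    (by simp; grind) (by simp [*]) hc
  have : e + e = a + b := by grind
  rw [this]; exact m1

lemma q5 (h2 : ∀ z : Z, z + z = 0 → z = 0) {T : Finset Z} {a b c d e : Z}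
    (hn : [a, b, c, d, e].Nodup)
    (hT : ∀ u ∈ [a, b, c, d, e], ∀ v ∈ [a, b, c, d, e], u ≠ v → u + v ∈ T)
    (hc : T.card ≤ 5) : e + e ∈ T := by
  by_cases e1 : a + b = c + d
  · exact q5' h2 hn hT hc e1
  by_cases e2 : a + c = b + d
  · exact q5' h2 (a := a) (b := c) (c := b) (d := d) (e := e) (by simp at hn ⊢; grind)
      (by intro u hu v hv; apply hT <;> (simp at *; grind)) hc e2
  by_cases e3 : a + d = b + c
  · exact q5' h2 (a := a) (b := d) (c := b) (d := c) (e := e) (by simp at hn ⊢; grind)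
      (by intro u hu v hv; apply hT <;> (simp at *; grind)) hc e3
  exfalso
  simp at hn
  have m1 : a + b ∈ T := hT a (by simp) b (by simp) (by grind)
  have m2 : a + c ∈ T := hT a (by simp) c (by simp) (by grind)
  have m3 : a + d ∈ T := hT a (by simp) d (by simp) (by grind)
  have m4 : b + c ∈ T := hT b (by simp) c (by simp) (by grind)
  have m5 : b + d ∈ T := hT b (by simp) d (by simp) (by grind)
  have m6 : c + d ∈ T := hT c (by simp) d (by simp) (by grind)
  have h6 : [a + b, a + c, a + d, b + c, b + d, c + d].Nodup := by simp; grind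
  have : [a + b, a + c, a + d, b + c, b + d, c + d].toFinset ⊆ T := by
    intro z hz
    simp at hz
    grind
  have := Finset.card_le_card this
  rw [List.toFinset_card_of_nodup h6] at this
  simp at this
  omega
end aux

section aux2
variable {Z : Type*} [CommRing Z] [DecidableEq Z]

lemma kS_two {A : Finset Z} {u v : Z} (hu : u ∈ A) (hv : v ∈ A) (huv : u ≠ v) :
    u + v ∈ kS 2 A :=
  mem_kS.2 ⟨{u, v}, by intro z hz; simp at hz; rcases hz with rfl | rfl <;> assumption,
    Finset.card_pair huv, Finset.sum_pair huv⟩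

lemma base4 (h2 : ∀ z : Z, z + z = 0 → z = 0) {A : Finset Z} (hA : A.card = 4) :
    5 ≤ (kS 2 A).card := by
  have hl := A.length_toList
  have hn := A.nodup_toList
  have hm : ∀ z ∈ A.toList, z ∈ A := fun z hz => Finset.mem_toList.1 hz
  rw [hA] at hl
  obtain ⟨a, b, c, d, hl⟩ := List.length_eq_four.1 hl
  rw [hl] at hn hm
  have hn' := hn
  simp at hn'
  simp at hm
  apply q4 h2 hn <;> apply kS_two <;> tauto

lemma base5 (h2 : ∀ z : Z, z + z = 0 → z = 0) {A : Finset Z} (hA : A.card = 5)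
    (hT : (kS 2 A).card ≤ 5) : Cl A := by
  have key : ∀ e ∈ A, e + e ∈ kS 2 A := by
    intro e he
    have hc : (A.erase e).card = 4 := by rw [Finset.card_erase_of_mem he, hA]
    have hl := (A.erase e).length_toList
    have hn := (A.erase e).nodup_toList
    have hm : ∀ z ∈ (A.erase e).toList, z ∈ A ∧ z ≠ e := fun z hz => by
      have := Finset.mem_erase.1 (Finset.mem_toList.1 hz)
      exact ⟨this.2, this.1⟩
    rw [hc] at hl
    obtain ⟨a, b, c, d, hl⟩ := List.length_eq_four.1 hl
    rw [hl] at hn hm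
    simp at hn hm
    refine q5 h2 (a := a) (b := b) (c := c) (d := d) (e := e) (by simp; tauto) ?_ hT
    have hmA : ∀ u ∈ [a, b, c, d, e], u ∈ A := by
      intro u hu
      simp at hu
      rcases hu with rfl | rfl | rfl | rfl | rfl <;> tauto
    intro u hu v hv huv
    exact kS_two (hmA u hu) (hmA v hv) huv
  have tr : ∀ x ∈ A, A.image (fun y => x + y) = kS 2 A := by
    intro x hx
    apply Finset.eq_of_subset_of_card_le
    · intro z hz
      obtain ⟨y, hy, rfl⟩ := Finset.mem_image.1 hz
      by_cases hxy : x = y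
      · subst hxy; exact key x hx
      · exact kS_two hx hy hxy
    · rw [Finset.card_image_of_injective _ (add_right_injective x), hA]; exact hT
  intro x hx y hy z hz
  have h1 : x + y ∈ kS 2 A := by
    rw [← tr x hx]; exact Finset.mem_image_of_mem _ hy
  rw [← tr z hz] at h1
  obtain ⟨w, hw, hw'⟩ := Finset.mem_image.1 h1
  rw [← hw']
  simpa using hw

lemma main_cl (h2 : ∀ z : Z, z + z = 0 → z = 0) (t : ℕ) : 4 ≤ t → ∀ A : Finset Z, A.card = t →
    (kS (t / 2) A).card ≤ t → Cl A := by
  induction t using Nat.strong_induction_on with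
  | _ t ih =>
  intro ht A hA hT
  rcases (show t = 4 ∨ t = 5 ∨ 6 ≤ t by omega) with rfl | rfl | h6
  · have := base4 h2 hA
    simp at hT
    omega
  · exact base5 h2 hA hT
  obtain ⟨k, hk⟩ : ∃ k, t / 2 = k + 2 := ⟨t / 2 - 2, by omega⟩
  have hBc : ∀ a ∈ A, ∀ b ∈ A, a ≠ b → ((A.erase a).erase b).card = t - 2 := by
    intro a ha b hb hab
    rw [Finset.card_erase_of_mem (Finset.mem_erase.2 ⟨hab.symm, hb⟩),
      Finset.card_erase_of_mem ha, hA]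
    omega
  rw [hk] at hT
  have hbig : ∀ a ∈ A, ∀ b ∈ A, a ≠ b → t ≤ (kS (k + 1) ((A.erase a).erase b)).card + 1 := by
    intro a ha b hb hab
    by_contra hcon
    have hB := hBc a ha b hb hab
    have hcl := ih (t - 2) (by omega) (by omega) _ hB (by
      rw [show (t - 2) / 2 = k + 1 by omega]; omega)
    have := case1 h2 (A := A) (B := (A.erase a).erase b) (a := a) (b := b) (by simp) (by simp) hab (by
      intro z hz
      simp at hz
      rcases hz with rfl | rfl | hz
      · exact ha
      · exact hb
      · exact hz.2.2) hcl k (by omega) (by omega)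
    omega
  have hins : ∀ a ∈ A, ∀ b ∈ A, a ≠ b → ∀ s ∈ kS (k + 1) ((A.erase a).erase b),
      a + s ∈ kS (k + 2) A ∧ b + s ∈ kS (k + 2) A := by
    intro a ha b hb hab s hs
    constructor
    · refine kS_insert (by simp) ?_ hs
      intro z hz
      simp at hz
      rcases hz with rfl | hz
      · exact ha
      · exact hz.2.2
    · refine kS_insert (by simp) ?_ hs
      intro z hz
      simp at hz
      rcases hz with rfl | hz
      · exact hb
      · exact hz.2.2
  have hne : ∀ a ∈ A, ∀ b ∈ A, a ≠ b → t ≤ rr (kS (k + 2) A) (a - b) + 1 := by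
    intro a ha b hb hab
    refine (hbig a ha b hb hab).trans (Nat.add_le_add_right ?_ 1)
    apply Finset.card_le_card_of_injOn (fun s => b + s)
    · intro s hs
      have := hins a ha b hb hab s hs
      refine Finset.mem_coe.2 (Finset.mem_filter.2 ⟨this.2, ?_⟩)
      rw [show b + s + (a - b) = a + s by ring]
      exact this.1
    · intro u _ v _ huv
      simpa using huv
  refine case2 h2 (k + 2) (by omega) (by omega) (by omega) (by omega) ?_
  rw [hA]
  intro a ha b hb
  by_cases hab : a = b
  · subst hab
    obtain ⟨c, hc, hca⟩ := Finset.exists_mem_ne (show 1 < A.card by omega) a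
    have := hne c hc a ha hca
    have := rr_le (kS (k + 2) A) (c - a)
    rw [sub_self, rr_zero]
    omega
  · exact hne a ha b hb hab

def altS : List Z → Z
  | [] => 0
  | a :: l => a - altS l

lemma alt_fwd (l : List Z) : l.Nodup → ∃ C, C ⊆ l.toFinset ∧ C.card = l.length / 2 ∧
    altS l = ∑ z ∈ l.toFinset, z - 2 * ∑ z ∈ C, z := by
  induction l with
  | nil => intro _; exact ⟨∅, by simp [altS]⟩
  | cons a l ih =>
    intro hn
    rw [List.nodup_cons] at hn
    obtain ⟨C, hC, hc, he⟩ := ih hn.2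
    have hal : a ∉ l.toFinset := by simpa using hn.1
    refine ⟨l.toFinset \ C, ?_, ?_, ?_⟩
    · rw [List.toFinset_cons]
      exact Finset.sdiff_subset.trans (Finset.subset_insert _ _)
    · rw [Finset.card_sdiff_of_subset hC, hc, List.toFinset_card_of_nodup hn.2, List.length_cons]
      omega
    · rw [altS, he, List.toFinset_cons, Finset.sum_insert hal, ← Finset.sum_sdiff hC]
      ring

lemma alt_bwd (t : ℕ) : ∀ A C : Finset Z, A.card = t → C ⊆ A → C.card = t / 2 →
    ∃ l : List Z, l.Nodup ∧ l.toFinset = A ∧ altS l = ∑ z ∈ A, z - 2 * ∑ z ∈ C, z := by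
  induction t with
  | zero =>
    intro A C hA hC _
    rw [Finset.card_eq_zero] at hA
    subst hA
    rw [Finset.subset_empty] at hC
    subst hC
    exact ⟨[], by simp [altS]⟩
  | succ t ih =>
    intro A C hA hC hc
    obtain ⟨a, ha⟩ := Finset.card_pos.1 (show 0 < (A \ C).card by
      rw [Finset.card_sdiff_of_subset hC]; omega)
    rw [Finset.mem_sdiff] at ha
    have hCe : C ⊆ A.erase a := fun z hz => Finset.mem_erase.2 ⟨fun h => ha.2 (h ▸ hz), hC hz⟩
    have hAe : (A.erase a).card = t := by rw [Finset.card_erase_of_mem ha.1, hA]; rfl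
    obtain ⟨l, hn, hl, he⟩ := ih (A.erase a) (A.erase a \ C) hAe Finset.sdiff_subset (by
      rw [Finset.card_sdiff_of_subset hCe]; omega)
    have hal : a ∉ l.toFinset := by rw [hl]; simp
    refine ⟨a :: l, ?_, ?_, ?_⟩
    · rw [List.nodup_cons]; exact ⟨by simpa using hal, hn⟩
    · rw [List.toFinset_cons, hl, Finset.insert_erase ha.1]
    · rw [altS, he, ← Finset.add_sum_erase _ _ ha.1, ← Finset.sum_sdiff hCe]
      ring

lemma lift_list {G : Type*} (ψ : Z → G) (A : Finset Z) (l : List G) :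
    (∀ a ∈ l, a ∈ ψ '' (A : Set Z)) → ∃ l' : List Z, (∀ b ∈ l', b ∈ A) ∧ l'.map ψ = l := by
  induction l with
  | nil => intro _; exact ⟨[], by simp⟩
  | cons a l ih =>
    intro h
    obtain ⟨l', h1, h3⟩ := ih (fun z hz => h z (List.mem_cons_of_mem _ hz))
    obtain ⟨b, hb, hb'⟩ := h a (by simp)
    refine ⟨b :: l', ?_, by simp [h3, hb']⟩
    intro z hz
    rcases List.mem_cons.1 hz with rfl | hz
    · exact hb
    · exact h1 z hz

lemma prod_alt {G : Type*} [Group G] (φ : Z → G) (y : G) (h0 : φ 0 = 1)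
    (hadd : ∀ a b, φ (a + b) = φ a * φ b) (hy : ∀ a, y * φ a = φ (-a) * y) (l : List Z) :
    (l.map (fun a => φ a * y)).prod = φ (altS l) * y ^ l.length := by
  induction l with
  | nil => simp [altS, h0]
  | cons a l ih =>
    rw [List.map_cons, List.prod_cons, ih, altS, sub_eq_add_neg, hadd, List.length_cons, pow_succ']
    rw [mul_assoc (φ a), ← mul_assoc y, hy]
    simp [mul_assoc]

lemma ncard_prod (h2 : ∀ z : Z, z + z = 0 → z = 0) {G : Type*} [Group G] (φ : Z → G) (y : G)
    (hinj : Function.Injective φ) (h0 : φ 0 = 1)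
    (hadd : ∀ a b, φ (a + b) = φ a * φ b) (hy : ∀ a, y * φ a = φ (-a) * y) (A : Finset Z)
    (t : ℕ) (hA : A.card = t) :
    (prodTuples t ((fun a => φ a * y) '' (A : Set Z))).ncard = (kS (t / 2) A).card := by
  have hψ : Function.Injective (fun a => φ a * y) := fun a b hab => hinj (mul_right_cancel hab)
  have hset : prodTuples t ((fun a => φ a * y) '' (A : Set Z)) =
      (fun s => φ (∑ z ∈ A, z - 2 * s) * y ^ t) '' (kS (t / 2) A : Set Z) := by
    ext g
    constructor
    · rintro ⟨l, hn, hl, hm, rfl⟩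
      obtain ⟨l', h1, rfl⟩ := lift_list _ A l hm
      have hn' : l'.Nodup := hn.of_map
      rw [List.length_map] at hl
      have hl' : l'.toFinset = A := by
        apply Finset.eq_of_subset_of_card_le
        · intro z hz; exact h1 z (by simpa using hz)
        · rw [List.toFinset_card_of_nodup hn', hl, hA]
      obtain ⟨C, hC, hc, he⟩ := alt_fwd l' hn'
      refine ⟨∑ z ∈ C, z, Finset.mem_coe.2 (mem_kS.2 ⟨C, hl' ▸ hC, by rw [hc, hl], rfl⟩), ?_⟩
      rw [prod_alt φ y h0 hadd hy, he, hl', hl]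
    · rintro ⟨s, hs, rfl⟩
      obtain ⟨C, hC, hc, rfl⟩ := mem_kS.1 (Finset.mem_coe.1 hs)
      obtain ⟨l, hn, hl, he⟩ := alt_bwd t A C hA hC hc
      have hlen : l.length = t := by rw [← List.toFinset_card_of_nodup hn, hl, hA]
      refine ⟨l.map (fun a => φ a * y), hn.map hψ, by simpa using hlen, ?_, ?_⟩
      · intro g hg
        obtain ⟨a, ha, rfl⟩ := List.mem_map.1 hg
        exact ⟨a, by rw [← hl]; simpa using ha, rfl⟩
      · rw [prod_alt φ y h0 hadd hy, he, hlen]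
  rw [hset, Set.ncard_image_of_injective, Set.ncard_coe_finset]
  intro a b hab
  have h3 := hinj (mul_right_cancel hab)
  have h4 : (a - b) + (a - b) = 0 := by linear_combination -h3
  exact sub_eq_zero.1 (h2 _ h4)

end aux2

lemma arith (n : ℕ) (hn : 2 ≤ n) (t : ℕ) (ht : 4 ≤ t) (α : Fin t → ℕ) (hmono : StrictMono α)
    (hα : ∀ i, α i < n) (A : Finset (ZMod n)) (hcard : A.card = t)
    (hA : ∀ z, z ∈ A ↔ ∃ i, (α i : ZMod n) = z) :
    Cl A ↔ t ∣ n ∧ ∃ b, b ≤ n / t - 1 ∧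
        Set.range α = {a : ℕ | ∃ k, k ≤ t - 1 ∧ a = b + k * (n / t)} := by
  haveI : NeZero n := ⟨by omega⟩
  constructor
  · intro hcl
    let i0 : Fin t := ⟨0, by omega⟩
    set a : ZMod n := (α i0 : ZMod n) with ha
    have haA : a ∈ A := (hA a).2 ⟨i0, rfl⟩
    let H : AddSubgroup (ZMod n) :=
      { carrier := {z | z + a ∈ A}
        zero_mem' := by simpa using haA
        add_mem' := by
          intro u v hu hv
          have := hcl _ hu _ hv _ haA
          simp only [Set.mem_setOf_eq]
          convert this using 1
          ring
        neg_mem' := by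
          intro u hu
          have := hcl _ haA _ haA _ hu
          simp only [Set.mem_setOf_eq]
          convert this using 1
          ring }
    have hH : Nat.card H = t := by
      have e : H ≃ A := (Equiv.addRight a).subtypeEquiv (fun z => Iff.rfl)
      rw [Nat.card_congr e, Nat.card_eq_fintype_card, Fintype.card_coe, hcard]
    have hdvd : t ∣ n := by
      have := H.card_addSubgroup_dvd_card
      rwa [hH, Nat.card_zmod] at this
    refine ⟨hdvd, ?_⟩
    obtain ⟨q, hq⟩ := hdvd
    have hq0 : 0 < q := by
      rcases Nat.eq_zero_or_pos q with rfl | h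
      · omega
      · exact h
    have hnt : n / t = q := by rw [hq]; exact Nat.mul_div_cancel_left _ (by omega)
    rw [hnt]
    have hmod : ∀ i, α i % q = α i0 % q := by
      intro i
      have hmem : (α i : ZMod n) - a ∈ H := by
        change (α i : ZMod n) - a + a ∈ A
        rw [sub_add_cancel]
        exact (hA _).2 ⟨i, rfl⟩
      have h1 : t • ((α i : ZMod n) - a) = 0 := by
        have := card_nsmul_eq_zero' (G := H) (x := ⟨_, hmem⟩)
        rw [hH] at this
        simpa using congrArg Subtype.val this
      have h3 : ((t * ((α i : ℤ) - α i0) : ℤ) : ZMod n) = 0 := by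
        push_cast
        rw [nsmul_eq_mul] at h1
        exact h1
      rw [ZMod.intCast_zmod_eq_zero_iff_dvd, hq] at h3
      push_cast at h3
      have h4 := Int.dvd_of_mul_dvd_mul_left (by omega) h3
      have h5 : (α i0 : ℤ) ≡ α i [ZMOD q] := Int.modEq_iff_dvd.2 h4
      exact ((Int.natCast_modEq_iff.1 h5)).symm
    refine ⟨α i0 % q, by have := Nat.mod_lt (α i0) hq0; omega, ?_⟩
    have hsub : Set.range α ⊆ (((Finset.range t).image (fun k => α i0 % q + k * q) : Finset ℕ) : Set ℕ) := by
      rintro _ ⟨i, rfl⟩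
      rw [Finset.mem_coe, Finset.mem_image]
      refine ⟨α i / q, ?_, ?_⟩
      · rw [Finset.mem_range, Nat.div_lt_iff_lt_mul hq0, ← hq]; exact hα i
      · rw [← hmod i, mul_comm]; exact Nat.mod_add_div _ _
    have heq : Finset.univ.image α = (Finset.range t).image (fun k => α i0 % q + k * q) := by
      apply Finset.eq_of_subset_of_card_le
      · intro z hz
        exact hsub (by simpa using hz)
      · refine Finset.card_image_le.trans ?_
        rw [Finset.card_image_of_injective _ hmono.injective]; simp
    ext z
    have := congrArg (fun s : Finset ℕ => z ∈ s) heq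
    simp only [Finset.mem_image, Finset.mem_univ, true_and, Finset.mem_range, eq_iff_iff] at this
    rw [Set.mem_range, this]
    constructor
    · rintro ⟨k, hk, rfl⟩; exact ⟨k, by omega, rfl⟩
    · rintro ⟨k, hk, rfl⟩; exact ⟨k, by omega, rfl⟩
  · rintro ⟨⟨q, hq⟩, b, hb, hr⟩
    have hnt : n / t = q := by rw [hq]; exact Nat.mul_div_cancel_left _ (by omega)
    rw [hnt] at hr
    have hmem : ∀ z, z ∈ A ↔ ∃ k : ℤ, z = (b : ZMod n) + k * (q : ZMod n) := by
      intro z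
      rw [hA]
      constructor
      · rintro ⟨i, rfl⟩
        have : α i ∈ Set.range α := ⟨i, rfl⟩
        rw [hr] at this
        obtain ⟨k, -, hk⟩ := this
        exact ⟨k, by rw [hk]; push_cast; ring⟩
      · rintro ⟨k, rfl⟩
        have htq : (t : ZMod n) * (q : ZMod n) = 0 := by
          rw [← Nat.cast_mul, ← hq, ZMod.natCast_self]
        have hk0 := Int.emod_nonneg k (show (t : ℤ) ≠ 0 by omega)
        have hk1 := Int.emod_lt_of_pos k (show (0 : ℤ) < t by omega)
        have : b + (k % t).toNat * q ∈ Set.range α := by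
          rw [hr]; exact ⟨(k % t).toNat, by omega, rfl⟩
        obtain ⟨i, hi⟩ := this
        refine ⟨i, ?_⟩
        rw [hi]
        have h7 : ((k % t).toNat : ZMod n) = ((k % t : ℤ) : ZMod n) := by
          rw [← Int.cast_natCast, Int.toNat_of_nonneg hk0]
        have h8 : ((k : ℤ) : ZMod n) = ((k % t : ℤ) : ZMod n) + t * ((k / t : ℤ) : ZMod n) := by
          conv_lhs => rw [← Int.emod_add_mul_ediv k t]
          push_cast; ring
        push_cast
        rw [h7, h8]
        linear_combination -((k / t : ℤ) : ZMod n) * htq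
    intro u hu v hv w hw
    rw [hmem] at *
    obtain ⟨k1, rfl⟩ := hu
    obtain ⟨k2, rfl⟩ := hv
    obtain ⟨k3, rfl⟩ := hw
    exact ⟨k1 + k2 - k3, by push_cast; ring⟩

/-- For `n` odd and `t ≥ 4`, the set `S = {x^{α_1} y, …, x^{α_t} y}` has exactly `t`
distinct `t`-fold products if and only if `t ∣ n` and the `α_i` form an arithmetic
progression `{b + k(n/t) : 0 ≤ k ≤ t-1}` with `0 ≤ b ≤ n/t - 1`. -/
theorem card_prodTuples_eq_iff_of_odd (n : ℕ) (m : ℤ) (hn : 2 ≤ n) (hodd : Odd n)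
    {G : Type*} [Group G] [Fintype G]
    (hG : Fintype.card G = 2 * n) (x y : G)
    (hx : orderOf x = n) (hy : y ^ 2 = x ^ m) (hyx : y * x = x⁻¹ * y)
    (hgen : Subgroup.closure {x, y} = ⊤)
    (t : ℕ) (ht : 4 ≤ t) (α : Fin t → ℕ) (hmono : StrictMono α) (hα : ∀ i, α i < n) :
    (prodTuples t (Set.range fun i => x ^ α i * y)).ncard = t ↔
      t ∣ n ∧ ∃ b, b ≤ n / t - 1 ∧
        Set.range α = {a : ℕ | ∃ k, k ≤ t - 1 ∧ a = b + k * (n / t)} := by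
  haveI : NeZero n := ⟨by omega⟩
  have h2 : ∀ z : ZMod n, z + z = 0 → z = 0 := by
    intro z hz
    obtain ⟨r, hr⟩ := hodd
    have h1 : ((2 * r + 1 : ℕ) : ZMod n) = 0 := by rw [← hr, ZMod.natCast_self]
    push_cast at h1
    linear_combination z * h1 - (r : ZMod n) * hz
  set φ : ZMod n → G := fun z => x ^ z.val with hφ
  have h0 : φ 0 = 1 := by simp [hφ]
  have hadd : ∀ a b, φ (a + b) = φ a * φ b := by
    intro a b
    simp only [hφ]
    rw [ZMod.val_add, ← pow_add]
    have := pow_mod_orderOf x (a.val + b.val)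
    rwa [hx] at this
  have hinj : Function.Injective φ := by
    intro a b hab
    apply ZMod.val_injective n
    exact pow_injOn_Iio_orderOf (by simpa [hx] using a.val_lt) (by simpa [hx] using b.val_lt) hab
  have hyφ : ∀ a, y * φ a = φ (-a) * y := by
    intro a
    have h3 : φ (-a) = (φ a)⁻¹ := by
      apply eq_inv_of_mul_eq_one_left
      rw [← hadd, neg_add_cancel, h0]
    have h4 : SemiconjBy y x x⁻¹ := hyx
    have h5 := (h4.pow_right a.val).eq
    rw [h3]
    simp only [hφ]
    rw [h5, inv_pow]
  set A : Finset (ZMod n) := Finset.univ.image (fun i => (α i : ZMod n)) with hA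
  have hval : ∀ i, ((α i : ZMod n)).val = α i := fun i => ZMod.val_cast_of_lt (hα i)
  have hcard : A.card = t := by
    rw [hA, Finset.card_image_of_injective, Finset.card_fin]
    intro i j hij
    apply hmono.injective
    rw [← hval i, ← hval j]
    exact congrArg ZMod.val hij
  have hS : (Set.range fun i => x ^ α i * y) = (fun a => φ a * y) '' (A : Set (ZMod n)) := by
    rw [hA, Finset.coe_image, Finset.coe_univ, Set.image_univ, ← Set.range_comp]
    congr 1
    funext i
    simp [hφ, hval]
  rw [hS, ncard_prod h2 φ y hinj h0 hadd hyφ A t hcard,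
    ← arith n hn t ht α hmono hα A hcard (by intro z; simp [hA])]
  constructor
  · intro h; exact main_cl h2 t ht A hcard h.le
  · intro h
    rw [kS_cl_card h2 h (t / 2) (by omega) (by omega), hcard]
end

section
/- Let n ≥ 2 be even, m an integer, and G ≅ H_{n,m} with generators x, y as above. Let t be even, let 0 ≤ α₁ < ... < α_t < n be integers, and S = {x^{α₁}y, ..., x^{α_t}y}. Then |∏_t(S)| ≥ t/2. -/
theorem aux_subsetSums {C ι : Type*} [AddCommGroup C] [DecidableEq C] [DecidableEq ι] (f : ι → C) :
    ∀ (k : ℕ) (A : Finset ι), A.card = 2 * k → (∀ c, (A.filter (fun i => f i = c)).card ≤ 2) →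
    k ≤ ((A.powersetCard k).image (fun P => ∑ i ∈ P, f i)).card := by
  intro k
  induction k with
  | zero => intros; exact Nat.zero_le _
  | succ k ih =>
    intro A hA hf
    by_contra hcon
    have hT : ((A.powersetCard (k+1)).image (fun P => ∑ i ∈ P, f i)).card ≤ k := by omega
    set T := (A.powersetCard (k+1)).image (fun P => ∑ i ∈ P, f i) with hTdef
    have key : ∀ a ∈ A, ∀ b ∈ A, ∀ s ∈ T, s + (f a - f b) ∈ T := by
      intro a ha b hb s hs
      by_cases hab : a = b
      · subst hab; simpa using hs
      set B := (A.erase a).erase b with hB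
      have hBc : B.card = 2 * k := by
        rw [hB, Finset.card_erase_of_mem (Finset.mem_erase.2 ⟨Ne.symm hab, hb⟩),
          Finset.card_erase_of_mem ha]
        omega
      have hBA : B ⊆ A := (Finset.erase_subset _ _).trans (Finset.erase_subset _ _)
      have h1 := ih B hBc (fun c => (Finset.card_le_card
        (Finset.filter_subset_filter _ hBA)).trans (hf c))
      set T' := (B.powersetCard k).image (fun P => ∑ i ∈ P, f i) with hT'
      have sub : ∀ e ∈ A, e ∉ B → ∀ u ∈ T', f e + u ∈ T := by
        intro e he heB u hu
        rw [hT', Finset.mem_image] at hu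
        obtain ⟨P, hP, rfl⟩ := hu
        rw [Finset.mem_powersetCard] at hP
        have heP : e ∉ P := fun h => heB (hP.1 h)
        rw [hTdef, Finset.mem_image]
        refine ⟨insert e P, ?_, Finset.sum_insert heP⟩
        rw [Finset.mem_powersetCard, Finset.card_insert_of_notMem heP, hP.2]
        exact ⟨Finset.insert_subset he (hP.1.trans hBA), rfl⟩
      have hbT : T'.image (fun u => f b + u) = T := by
        apply Finset.eq_of_subset_of_card_le
        · intro v hv
          obtain ⟨u, hu, rfl⟩ := Finset.mem_image.1 hv
          exact sub b hb (by simp [hB]) u hu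
        · rw [Finset.card_image_of_injective _ (add_right_injective (f b))]
          omega
      rw [← hbT] at hs
      obtain ⟨u, hu, rfl⟩ := Finset.mem_image.1 hs
      have := sub a ha (by simp [hB]) u hu
      convert this using 1
      abel
    have hAne : A.Nonempty := by
      rw [← Finset.card_pos]; omega
    obtain ⟨a0, ha0⟩ := hAne
    obtain ⟨P, hP⟩ : (A.powersetCard (k+1)).Nonempty :=
      Finset.powersetCard_nonempty.2 (by omega)
    have hs0 : (∑ i ∈ P, f i) ∈ T := Finset.mem_image_of_mem _ hP
    have h2 : (A.image f).card ≤ T.card := by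
      apply Finset.card_le_card_of_injOn (fun c => (∑ i ∈ P, f i) + (c - f a0))
      · intro c hc
        obtain ⟨a, ha, rfl⟩ := Finset.mem_image.1 (Finset.mem_coe.1 hc)
        exact key a ha a0 ha0 _ hs0
      · intro c _ d _ h
        simpa using h
    have h3 : A.card ≤ 2 * (A.image f).card :=
      Finset.card_le_mul_card_image A 2 (fun c _ => hf c)
    omega

theorem aux_list {G ι : Type*} [Group G] (x y : G) (m : ℤ) (hy : y ^ 2 = x ^ m)
    (hyx : y * x = x⁻¹ * y) (α : ι → ℕ) : ∀ (p q : List ι), p.length = q.length →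
    ∃ l : List ι, l.Perm (p ++ q) ∧ (l.map (fun i => x ^ α i * y)).prod =
      x ^ ((p.map (fun i => (α i : ℤ))).sum - (q.map (fun i => (α i : ℤ))).sum
        + p.length * m) := by
  intro p
  induction p with
  | nil =>
    intro q hq
    have : q = [] := List.length_eq_zero_iff.1 hq.symm
    subst this
    exact ⟨[], by simp, by simp⟩
  | cons a p ih =>
    intro q hq
    cases q with
    | nil => simp at hq
    | cons b q =>
      obtain ⟨l, hl, hp⟩ := ih q (by simpa using hq)
      refine ⟨a :: b :: l, ?_, ?_⟩
      · refine List.Perm.cons a ?_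
        exact (List.Perm.cons b hl).trans List.perm_middle.symm
      · have hs : SemiconjBy y x x⁻¹ := hyx
        have h1 : y * x ^ α b = (x⁻¹) ^ α b * y := hs.pow_right (α b)
        have h2 : x ^ α a * y * (x ^ α b * y) = x ^ ((α a : ℤ) - α b + m) := by
          calc x ^ α a * y * (x ^ α b * y) = x ^ α a * (y * x ^ α b) * y := by group
            _ = x ^ α a * (x⁻¹) ^ α b * y ^ 2 := by rw [h1, pow_two]; group
            _ = _ := by rw [hy, zpow_add, zpow_sub, zpow_natCast, zpow_natCast, inv_pow]
        rw [List.map_cons, List.map_cons, List.prod_cons, List.prod_cons, ← mul_assoc, h2, hp,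
          ← zpow_add]
        congr 1
        simp only [List.map_cons, List.sum_cons, List.length_cons]
        push_cast
        ring

/-- For `n` even and `t` even, a set `S` of `t` elements of the form `x^{α_i} y` in `H_{n,m}`
has at least `t/2` distinct `t`-fold products. -/
theorem card_prodTuples_ge_of_even_even (n : ℕ) (m : ℤ) (hn : 2 ≤ n) (hne : Even n)
    {G : Type*} [Group G] [Fintype G]
    (hG : Fintype.card G = 2 * n) (x y : G)
    (hx : orderOf x = n) (hy : y ^ 2 = x ^ m) (hyx : y * x = x⁻¹ * y)
    (hgen : Subgroup.closure {x, y} = ⊤)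
    (t : ℕ) (hte : Even t) (α : Fin t → ℕ) (hmono : StrictMono α) (hα : ∀ i, α i < n) :
    t / 2 ≤ (prodTuples t (Set.range fun i => x ^ α i * y)).ncard := by
  classical
  obtain ⟨k, rfl⟩ := hte
  obtain ⟨h, rfl⟩ := hne
  have : NeZero (h + h) := ⟨by omega⟩
  have hlem := aux_subsetSums (fun i : Fin (k + k) => ((2 * α i : ℕ) : ZMod (h + h))) k
    Finset.univ (by simp; omega) (by
      intro c
      by_contra hc
      rw [not_le, Finset.two_lt_card] at hc
      obtain ⟨i, hi, j, hj, l, hl, hij, hil, hjl⟩ := hc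
      simp only [Finset.mem_filter, Finset.mem_univ, true_and] at hi hj hl
      have e1 := (ZMod.natCast_eq_natCast_iff' _ _ _).1 (hi.trans hj.symm)
      have e2 := (ZMod.natCast_eq_natCast_iff' _ _ _).1 (hi.trans hl.symm)
      have n1 : α i ≠ α j := fun e => hij (hmono.injective e)
      have n2 : α i ≠ α l := fun e => hil (hmono.injective e)
      have n3 : α j ≠ α l := fun e => hjl (hmono.injective e)
      have b1 := hα i
      have b2 := hα j
      have b3 := hα l
      rw [← two_mul, Nat.mul_mod_mul_left, Nat.mul_mod_mul_left] at e1 e2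
      have r : ∀ a, a < h + h → a % h = a ∨ a % h + h = a := by
        intro a ha
        rcases lt_or_ge a h with h' | h'
        · left; exact Nat.mod_eq_of_lt h'
        · right
          rw [Nat.mod_eq_sub_mod h', Nat.mod_eq_of_lt (by omega)]
          omega
      have r1 := r _ b1
      have r2 := r _ b2
      have r3 := r _ b3
      replace e1 := Nat.eq_of_mul_eq_mul_left two_pos e1
      replace e2 := Nat.eq_of_mul_eq_mul_left two_pos e2
      rw [← e1] at r2
      rw [← e2] at r3
      generalize α i % h = u at r1 r2 r3
      clear e1 e2 hi hj hl
      omega)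
  have hk : (k + k) / 2 = k := by omega
  rw [hk]
  refine hlem.trans ?_
  have hginj : Function.Injective (fun i => x ^ α i * y) := by
    intro i j hij
    have h1 : x ^ α i = x ^ α j := mul_right_cancel hij
    apply hmono.injective
    exact pow_injOn_Iio_orderOf (by simpa [hx] using hα i) (by simpa [hx] using hα j) h1
  set N : ℤ := k * m - ∑ i, (α i : ℤ) with hN
  have hφ : ∀ z w : ℤ, x ^ z = x ^ w ↔ (z : ZMod (h + h)) = w := by
    intro z w
    rw [ZMod.intCast_eq_intCast_iff, ← hx, zpow_eq_zpow_iff_modEq]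
  rw [← Set.ncard_coe_finset]
  apply Set.ncard_le_ncard_of_injOn (fun c => x ^ (((c.val : ℕ) : ℤ) + N))
  · intro c hc
    obtain ⟨P, hP, rfl⟩ := Finset.mem_image.1 (Finset.mem_coe.1 hc)
    have hPc := (Finset.mem_powersetCard.1 hP).2
    obtain ⟨l, hl, hprod⟩ := aux_list x y m hy hyx α P.toList Pᶜ.toList (by
      simp [Finset.card_compl, hPc])
    have hnd : l.Nodup := by
      rw [hl.nodup_iff, List.nodup_append]
      refine ⟨Finset.nodup_toList _, Finset.nodup_toList _, ?_⟩
      intro a ha b hb hab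
      subst hab
      simp at ha hb
      exact hb ha
    refine ⟨l.map (fun i => x ^ α i * y), hnd.map hginj, ?_, ?_, ?_⟩
    · rw [List.length_map, hl.length_eq]
      simp [Finset.card_compl, hPc]
    · intro a ha
      obtain ⟨i, _, rfl⟩ := List.mem_map.1 ha
      exact ⟨i, rfl⟩
    · rw [hprod, hφ, Finset.sum_map_toList, Finset.sum_map_toList, Finset.length_toList, hPc, hN,
        ← Finset.sum_add_sum_compl P]
      push_cast
      rw [ZMod.natCast_zmod_val, ← Finset.mul_sum]
      ring
  · intro c _ d _ hcd
    have := (hφ _ _).1 hcd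
    push_cast at this
    simpa using this
end

section
/- Let n ≥ 2 be even, m an integer, and G ≅ H_{n,m} with generators x, y as above. Let t ≥ 2 be even, let 0 ≤ α₁ < ... < α_t < n be integers, and S = {x^{α₁}y, ..., x^{α_t}y}. Then |∏_t(S)| = t/2 if and only if t divides n and there exists an integer b with 0 ≤ b ≤ n/t − 1 such that {α₁, ..., α_t} = {b + k·(n/t) : 0 ≤ k ≤ t−1}. -/
section comb
variable {R : Type*} [CommRing R] [DecidableEq R]

/-- Doubled sums of `k`-subsets. -/
def XX (k : ℕ) (A : Finset R) : Finset R :=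
  (A.powersetCard k).image (fun T => 2 * ∑ i ∈ T, i)

lemma mem_XX {k : ℕ} {A : Finset R} {w : R} :
    w ∈ XX k A ↔ ∃ T, T ⊆ A ∧ T.card = k ∧ 2 * ∑ i ∈ T, i = w := by
  simp [XX, Finset.mem_powersetCard, and_assoc]

lemma XX_shift {k : ℕ} {A : Finset R} {a b w : R} (ha : a ∈ A)
    (hw : w ∈ XX k (A \ {a, b})) : w + 2 * a ∈ XX (k + 1) A := by
  obtain ⟨T, hT, hc, rfl⟩ := mem_XX.1 hw
  have haT : a ∉ T := fun h => by
    have := hT h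
    simp at this
  refine mem_XX.2 ⟨insert a T, ?_, ?_, ?_⟩
  · intro z hz
    rcases Finset.mem_insert.1 hz with rfl | hz
    · exact ha
    · exact (Finset.mem_sdiff.1 (hT hz)).1
  · rw [Finset.card_insert_of_notMem haT, hc]
  · rw [Finset.sum_insert haT]; ring

lemma XX_eq {k : ℕ} {A : Finset R} {a b : R} (ha : a ∈ A)
    (h : k + 1 ≤ (XX k (A \ {a, b})).card) (h2 : (XX (k + 1) A).card ≤ k + 1) :
    (XX k (A \ {a, b})).image (fun w => w + 2 * a) = XX (k + 1) A := by
  apply Finset.eq_of_subset_of_card_le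
  · intro z hz
    obtain ⟨w, hw, rfl⟩ := Finset.mem_image.1 hz
    exact XX_shift ha hw
  · rw [Finset.card_image_of_injective _ (add_left_injective _)]
    omega

lemma pair_good {k : ℕ} {A : Finset R} {a b : R} (ha : a ∈ A) (hb : b ∈ A)
    (h : k + 1 ≤ (XX k (A \ {a, b})).card) (h2 : (XX (k + 1) A).card ≤ k + 1) :
    ∀ w ∈ XX (k + 1) A, w + 2 * (a - b) ∈ XX (k + 1) A := by
  intro w hw
  have h' : k + 1 ≤ (XX k (A \ {b, a})).card := by rwa [Finset.pair_comm]
  rw [← XX_eq hb h' h2] at hw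
  obtain ⟨z, hz, rfl⟩ := Finset.mem_image.1 hw
  rw [Finset.pair_comm] at hz
  have := XX_shift ha hz
  convert this using 1
  ring

lemma structure_of_periodic [Fintype R] (N : R) (hN : 2 * N = 0)
    (h2 : ∀ z : R, 2 * z = 0 → z = 0 ∨ z = N)
    {k : ℕ} {A : Finset R} (hA : A.card = 2 * k) (hX : (XX k A).card ≤ k)
    (hper : ∀ a ∈ A, ∀ b ∈ A, ∀ w ∈ XX k A, w + 2 * (a - b) ∈ XX k A) :
    (XX k A).card = k ∧ (∀ a ∈ A, a + N ∈ A) ∧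
      ∀ a ∈ A, ∀ b ∈ A, ∀ c ∈ A, a + (b - c) ∈ A := by
  have hne : (XX k A).Nonempty := by
    rw [XX, Finset.image_nonempty, Finset.powersetCard_nonempty]; omega
  obtain ⟨x0, hx0⟩ := hne
  have hk : 0 < k := lt_of_lt_of_le (Finset.card_pos.2 ⟨x0, hx0⟩) hX
  obtain ⟨a0, ha0⟩ : A.Nonempty := Finset.card_pos.1 (by omega)
  set B : Finset R := Finset.univ.filter (fun z => x0 + 2 * (z - a0) ∈ XX k A) with hB
  have hBc : B.card ≤ 2 * (XX k A).card := by
    apply Finset.card_le_mul_card_image_of_maps_to (f := fun z => x0 + 2 * (z - a0))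
    · intro z hz; exact (Finset.mem_filter.1 hz).2
    · intro w hw
      by_cases hem : (B.filter (fun z => x0 + 2 * (z - a0) = w)).Nonempty
      · obtain ⟨z0, hz0⟩ := hem
        have hz0' := (Finset.mem_filter.1 hz0).2
        refine (Finset.card_le_card (t := {z0, z0 + N}) ?_).trans Finset.card_le_two
        intro z hz
        have hz' := (Finset.mem_filter.1 hz).2
        have : 2 * (z - z0) = 0 := by linear_combination hz' - hz0'
        rcases h2 _ this with h | h
        · simp [sub_eq_zero.1 h]
        · rw [← h]; simp
      · rw [Finset.not_nonempty_iff_eq_empty.1 hem]; simp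
  have hAB : A ⊆ B := by
    intro a ha
    exact Finset.mem_filter.2 ⟨Finset.mem_univ _, hper a ha a0 ha0 x0 hx0⟩
  have hEq : A = B := Finset.eq_of_subset_of_card_le hAB (by omega)
  have hmem : ∀ z, z ∈ A ↔ x0 + 2 * (z - a0) ∈ XX k A := by
    intro z
    constructor
    · intro hz
      exact (Finset.mem_filter.1 (hAB hz)).2
    · intro hz
      rw [hEq]
      exact Finset.mem_filter.2 ⟨Finset.mem_univ _, hz⟩
  refine ⟨?_, ?_, ?_⟩
  · rw [← hEq] at hBc; omega
  · intro a ha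
    rw [hmem] at ha ⊢
    convert ha using 1
    linear_combination hN
  · intro a ha b hb c hc
    have := hper b hb c hc _ ((hmem a).1 ha)
    rw [hmem]
    convert this using 1
    ring

lemma periodic [Fintype R] (N : R) (hN : 2 * N = 0) (hN0 : N ≠ 0)
    (h2 : ∀ z : R, 2 * z = 0 → z = 0 ∨ z = N) (k : ℕ) :
    ∀ A : Finset R, A.card = 2 * k → (XX k A).card ≤ k →
      ∀ a ∈ A, ∀ b ∈ A, ∀ w ∈ XX k A, w + 2 * (a - b) ∈ XX k A := by
  induction k with
  | zero =>
    intro A hA _ a ha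
    have := Finset.card_pos.2 ⟨a, ha⟩
    omega
  | succ k ih =>
    intro A hA hX a ha b hb w hw
    by_cases hab : a = b
    · subst hab; simpa using hw
    have hcard : ∀ c ∈ A, ∀ d ∈ A, c ≠ d → (A \ {c, d}).card = 2 * k := by
      intro c hc d hd hcd
      rw [Finset.card_sdiff_of_subset (by
        intro z hz
        simp only [Finset.mem_insert, Finset.mem_singleton] at hz
        rcases hz with rfl | rfl <;> assumption), Finset.card_pair hcd]
      omega
    have hcl : ∀ c ∈ A, ∀ d ∈ A, c ≠ d → (XX k (A \ {c, d})).card ≤ k →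
        ∀ z ∈ A \ {c, d}, z + N ∈ A \ {c, d} := by
      intro c hc d hd hcd hle
      exact (structure_of_periodic N hN h2 (hcard c hc d hd hcd) hle
        (ih _ (hcard c hc d hd hcd) hle)).2.1
    by_cases hg : k + 1 ≤ (XX k (A \ {a, b})).card
    · exact pair_good ha hb hg hX w hw
    have hle : (XX k (A \ {a, b})).card ≤ k := by omega
    have hc1 := hcl a ha b hb hab hle
    have hk : 0 < k := by
      refine lt_of_lt_of_le (Finset.card_pos.2 ?_) hle
      rw [XX, Finset.image_nonempty, Finset.powersetCard_nonempty, hcard a ha b hb hab]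
      omega
    obtain ⟨e, he⟩ : (A \ {a, b}).Nonempty :=
      Finset.card_pos.1 (by rw [hcard a ha b hb hab]; omega)
    have heA : e ∈ A := (Finset.mem_sdiff.1 he).1
    have heN := hc1 e he
    simp only [Finset.mem_sdiff, Finset.mem_insert, Finset.mem_singleton, not_or] at he heN
    have hgood : ∀ c ∈ A, c ≠ e → e + N ≠ c → k + 1 ≤ (XX k (A \ {c, e})).card := by
      intro c hc hce hNc
      by_contra hlt
      have h := hcl c hc e heA hce (by omega) (e + N) (by
        simp only [Finset.mem_sdiff, Finset.mem_insert, Finset.mem_singleton, not_or]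
        exact ⟨heN.1, hNc, by simpa using hN0⟩)
      rw [show e + N + N = e by linear_combination hN] at h
      simp at h
    have g1 := pair_good ha heA (hgood a ha (Ne.symm he.2.1) heN.2.1) hX w hw
    have hb' := hgood b hb (Ne.symm he.2.2) heN.2.2
    rw [Finset.pair_comm] at hb'
    have g2 := pair_good heA hb hb' hX _ g1
    convert g2 using 1
    ring

end comb

section grp

/-- Flatten a list of pairs. -/
def flatP {R : Type*} : List (R × R) → List R
  | [] => []
  | q :: p => q.1 :: q.2 :: flatP p

lemma flatP_perm {R : Type*} (p : List (R × R)) :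
    (flatP p).Perm (p.map Prod.fst ++ p.map Prod.snd) := by
  induction p with
  | nil => simp [flatP]
  | cons q p ih =>
    simp only [flatP, List.map_cons, List.cons_append]
    refine List.Perm.cons _ ?_
    exact (List.Perm.cons _ ih).trans List.perm_middle.symm

lemma exists_flatP {R : Type*} (k : ℕ) : ∀ l : List R, l.length = 2 * k →
    ∃ p, flatP p = l ∧ p.length = k := by
  induction k with
  | zero => intro l hl; exact ⟨[], by simp [flatP]; simpa using hl, rfl⟩
  | succ k ih =>
    intro l hl
    match l, hl with
    | a :: b :: l, hl =>
      obtain ⟨p, hp, hk⟩ := ih l (by simp at hl; omega)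
      exact ⟨(a, b) :: p, by simp [flatP, hp], by simp [hk]⟩

lemma prod_flatP {R G : Type*} [CommRing R] [Group G] (e g : R → G) (m : R)
    (he0 : e 0 = 1) (he : ∀ a b, e (a + b) = e a * e b)
    (hg : ∀ a b, g a * g b = e (a - b + m)) (p : List (R × R)) :
    ((flatP p).map g).prod =
      e ((p.map Prod.fst).sum - (p.map Prod.snd).sum + p.length * m) := by
  induction p with
  | nil => simp [flatP, he0]
  | cons q p ih =>
    simp only [flatP, List.map_cons, List.prod_cons, ih, ← mul_assoc, hg, ← he]
    congr 1
    simp only [List.sum_cons, List.length_cons]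
    push_cast
    ring

lemma prodTuples_eq {R G : Type*} [CommRing R] [DecidableEq R] [Group G] (e g : R → G) (m : R)
    (he0 : e 0 = 1) (he : ∀ a b, e (a + b) = e a * e b)
    (hg : ∀ a b, g a * g b = e (a - b + m)) (hinj : Function.Injective g)
    (k : ℕ) (A : Finset R) (hA : A.card = 2 * k) :
    prodTuples (2 * k) (g '' A) = (fun w => e (w + (k * m - ∑ i ∈ A, i))) '' (XX k A : Set R) := by
  ext z
  constructor
  · rintro ⟨l, hnd, hlen, hmem, rfl⟩
    obtain ⟨l, rfl⟩ : l ∈ Set.range (List.map g) := by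
      rw [Set.range_list_map]
      intro a ha
      obtain ⟨r, -, h⟩ := hmem a ha
      exact ⟨r, h⟩
    rw [List.length_map] at hlen
    have hnd' : l.Nodup := hnd.of_map
    have hlA : ∀ a ∈ l, a ∈ A := by
      intro a ha
      obtain ⟨r, hr, h⟩ := hmem (g a) (List.mem_map_of_mem ha)
      rw [← hinj h]; exact hr
    obtain ⟨p, rfl, hpk⟩ := exists_flatP k l hlen
    have hperm := flatP_perm p
    have hsum := hperm.sum_eq
    have hfA : (flatP p).toFinset = A := by
      apply Finset.eq_of_subset_of_card_le
      · intro a ha; exact hlA a (List.mem_toFinset.1 ha)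
      · rw [List.toFinset_card_of_nodup hnd', hlen, hA]
    have hsA : ∑ i ∈ A, i = (flatP p).sum := by
      rw [← hfA, List.sum_toFinset _ hnd']; simp
    have hu : (p.map Prod.fst).Nodup := (List.nodup_append.1 (hperm.nodup_iff.1 hnd')).1
    rw [prod_flatP e g m he0 he hg]
    refine ⟨2 * (p.map Prod.fst).sum, ?_, ?_⟩
    · refine mem_XX.2 ⟨(p.map Prod.fst).toFinset, ?_, ?_, ?_⟩
      · intro a ha
        apply hlA
        rw [hperm.mem_iff]
        exact List.mem_append_left _ (List.mem_toFinset.1 ha)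
      · rw [List.toFinset_card_of_nodup hu]; simp [hpk]
      · rw [List.sum_toFinset _ hu, List.map_id']
    · simp only
      congr 1
      rw [hsA, hsum, List.sum_append, hpk]
      ring
  · rintro ⟨w, hw, rfl⟩
    obtain ⟨T, hT, hc, rfl⟩ := mem_XX.1 hw
    set u := T.toList with hu
    set v := (A \ T).toList with hv
    have hul : u.length = k := by simp [hu, hc]
    have hvl : v.length = k := by
      rw [hv, Finset.length_toList, Finset.card_sdiff_of_subset hT]; omega
    have h1 : (u.zip v).map Prod.fst = u := List.map_fst_zip (by omega)
    have h2 : (u.zip v).map Prod.snd = v := List.map_snd_zip (by omega)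
    have hperm := flatP_perm (u.zip v)
    rw [h1, h2] at hperm
    refine ⟨(flatP (u.zip v)).map g, ?_, ?_, ?_, ?_⟩
    · refine List.Nodup.map hinj ?_
      rw [hperm.nodup_iff, List.nodup_append']
      refine ⟨T.nodup_toList, Finset.nodup_toList _, ?_⟩
      intro a ha hb
      rw [hu, Finset.mem_toList] at ha
      rw [hv, Finset.mem_toList, Finset.mem_sdiff] at hb
      exact hb.2 ha
    · rw [List.length_map, hperm.length_eq, List.length_append]; omega
    · intro a ha
      obtain ⟨r, hr, rfl⟩ := List.mem_map.1 ha
      refine ⟨r, ?_, rfl⟩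
      rw [hperm.mem_iff, List.mem_append, hu, hv, Finset.mem_toList, Finset.mem_toList] at hr
      rcases hr with h | h
      · exact hT h
      · exact (Finset.mem_sdiff.1 h).1
    · rw [prod_flatP e g m he0 he hg, h1, h2, hu, hv, Finset.sum_toList, Finset.sum_toList,
        ← Finset.sum_sdiff hT]
      congr 1
      rw [List.length_zip]
      simp only [← hu, ← hv, hul, hvl, min_self]
      ring

end grp

theorem card_prodTuples_eq_iff_of_even_even (n : ℕ) (m : ℤ) (hn : 2 ≤ n) (hne : Even n)
    {G : Type*} [Group G] [Fintype G]
    (hG : Fintype.card G = 2 * n) (x y : G)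
    (hx : orderOf x = n) (hy : y ^ 2 = x ^ m) (hyx : y * x = x⁻¹ * y)
    (hgen : Subgroup.closure {x, y} = ⊤)
    (t : ℕ) (ht : 2 ≤ t) (hte : Even t) (α : Fin t → ℕ) (hmono : StrictMono α)
    (hα : ∀ i, α i < n) :
    (prodTuples t (Set.range fun i => x ^ α i * y)).ncard = t / 2 ↔
      t ∣ n ∧ ∃ b, b ≤ n / t - 1 ∧
        Set.range α = {a : ℕ | ∃ k, k ≤ t - 1 ∧ a = b + k * (n / t)} := by
  have : NeZero n := ⟨by omega⟩
  obtain ⟨k, hk⟩ := hte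
  have hk2 : t = 2 * k := by omega
  -- the exponential map
  set e : ZMod n → G := fun z => x ^ (z.cast : ℤ) with he_def
  have heZ : ∀ i : ℤ, x ^ i = e (i : ZMod n) := by
    intro i
    simp only [he_def]
    rw [zpow_eq_zpow_iff_modEq, hx, ← ZMod.intCast_eq_intCast_iff]
    simp
  have heinj : Function.Injective e := by
    intro a b hab
    simp only [he_def] at hab
    rw [zpow_eq_zpow_iff_modEq, hx, ← ZMod.intCast_eq_intCast_iff] at hab
    simpa using hab
  have he0 : e 0 = 1 := by simpa using (heZ 0).symm
  have he : ∀ a b, e (a + b) = e a * e b := by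
    intro a b
    have h := heZ ((a.cast : ℤ) + (b.cast : ℤ))
    rw [zpow_add] at h
    simp only [Int.cast_add, ZMod.intCast_cast, ZMod.cast_id', id] at h
    exact h.symm
  have hye : ∀ a, y * e a = e (-a) * y := by
    intro a
    have hs : SemiconjBy y x x⁻¹ := hyx
    have h := (hs.zpow_right (a.cast : ℤ)).eq
    rw [inv_zpow', heZ (-_)] at h
    simp only [Int.cast_neg, ZMod.intCast_cast, ZMod.cast_id', id] at h
    exact h
  set g : ZMod n → G := fun z => e z * y with hg_def
  have hginj : Function.Injective g := fun a b hab => heinj (mul_right_cancel hab)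
  have hg : ∀ a b, g a * g b = e (a - b + (m : ZMod n)) := by
    intro a b
    simp only [hg_def]
    rw [he, ← heZ m, ← hy, sub_eq_add_neg, he, mul_assoc, ← mul_assoc y, hye, pow_two]
    simp only [mul_assoc]
  have hainj : Function.Injective (fun i => (α i : ZMod n)) := by
    intro i j hij
    apply hmono.injective
    have := (ZMod.natCast_eq_natCast_iff' _ _ _).1 hij
    rwa [Nat.mod_eq_of_lt (hα i), Nat.mod_eq_of_lt (hα j)] at this
  set A : Finset (ZMod n) := Finset.univ.image (fun i => (α i : ZMod n)) with hA_def
  have hA : A.card = 2 * k := by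
    rw [hA_def, Finset.card_image_of_injective _ hainj]; simp [hk2]
  have hS : (Set.range fun i => x ^ α i * y) = g '' A := by
    rw [hA_def, Finset.coe_image, Finset.coe_univ, Set.image_univ, ← Set.range_comp]
    congr 1
    funext i
    have := heZ (α i)
    simp only [Function.comp, hg_def]
    rw [zpow_natCast] at this
    rw [this]; simp
  have hcard : (prodTuples t (Set.range fun i => x ^ α i * y)).ncard = (XX k A).card := by
    rw [hS, hk2, prodTuples_eq e g m he0 he hg hginj k A hA,
      Set.ncard_image_of_injective _ (fun a b hab => add_right_cancel (heinj hab)),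
      Set.ncard_coe_finset]
  have hN : (2 : ZMod n) * ((n / 2 : ℕ) : ZMod n) = 0 := by
    have : 2 * (n / 2) = n := Nat.two_mul_div_two_of_even hne
    have h : ((2 * (n / 2) : ℕ) : ZMod n) = 0 := by rw [this]; simp
    simpa using h
  have hN0 : ((n / 2 : ℕ) : ZMod n) ≠ 0 := by
    rw [Ne, ZMod.natCast_eq_zero_iff]
    intro h
    have := Nat.le_of_dvd (by omega) h
    omega
  have h2 : ∀ z : ZMod n, 2 * z = 0 → z = 0 ∨ z = ((n / 2 : ℕ) : ZMod n) := by
    intro z hz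
    have h : ((2 * z.val : ℕ) : ZMod n) = 0 := by simpa using hz
    rw [ZMod.natCast_eq_zero_iff] at h
    obtain ⟨c, hc⟩ := h
    have hlt := z.val_lt
    have hc2 : c < 2 := by
      by_contra hcc
      have : n * 2 ≤ n * c := Nat.mul_le_mul_left _ (by omega)
      omega
    interval_cases c
    · left; rw [← ZMod.val_eq_zero]; omega
    · right; rw [← ZMod.natCast_zmod_val z]; congr 1; omega
  have hstr := fun h => structure_of_periodic _ hN h2 hA h (periodic _ hN hN0 h2 k A hA h)
  rw [hcard, show t / 2 = k by omega]
  constructor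
  · intro hX
    have hcl := (hstr hX.le).2.2
    have hmemA : ∀ i, (α i : ZMod n) ∈ A := fun i =>
      Finset.mem_image_of_mem _ (Finset.mem_univ i)
    let i0 : Fin t := ⟨0, by omega⟩
    let K : AddSubgroup (ZMod n) :=
      { carrier := {z | z + α i0 ∈ A}
        zero_mem' := by simpa using hmemA i0
        add_mem' := by
          intro a b ha hb
          have := hcl _ ha _ hb _ (hmemA i0)
          show a + b + _ ∈ A
          convert this using 1
          ring
        neg_mem' := by
          intro a ha
          have := hcl _ (hmemA i0) _ (hmemA i0) _ ha
          show -a + _ ∈ A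
          convert this using 1
          ring }
    have hKc : Nat.card K = t := by
      have : (K : Set (ZMod n)) = (A.image (fun z => z - (α i0 : ZMod n)) : Finset (ZMod n)) := by
        ext z
        simp only [Finset.coe_image, Set.mem_image]
        constructor
        · intro hz; exact ⟨_, hz, by ring⟩
        · rintro ⟨w, hw, rfl⟩
          show _ - _ + _ ∈ A
          simpa using hw
      rw [← SetLike.coe_sort_coe, this, Nat.card_coe_set_eq, Set.ncard_coe_finset,
        Finset.card_image_of_injective _ (sub_left_injective), hA, hk2]
    have htn : t ∣ n := by
      have := AddSubgroup.card_addSubgroup_dvd_card K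
      rwa [hKc, Nat.card_zmod] at this
    refine ⟨htn, ?_⟩
    obtain ⟨q, hq⟩ := htn
    have hq0 : 0 < q := by
      rcases Nat.eq_zero_or_pos q with h | h
      · subst h; omega
      · exact h
    have hnq : n / t = q := by rw [hq]; exact Nat.mul_div_cancel_left q (by omega)
    rw [hnq]
    have hmod : ∀ i, α i % q = α i0 % q := by
      intro i
      have hz : ((α i : ZMod n) - α i0) ∈ K := by
        show _ - _ + _ ∈ A
        simpa using hmemA i
      have h1 : t • (⟨_, hz⟩ : K) = 0 := by rw [← hKc]; exact card_nsmul_eq_zero'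
      have h1' := congrArg Subtype.val h1
      simp only [AddSubgroup.coe_nsmul, AddSubgroup.coe_zero, nsmul_eq_mul] at h1'
      have h2' : (((t : ℤ) * ((α i : ℤ) - α i0) : ℤ) : ZMod n) = 0 := by
        push_cast; exact h1'
      rw [ZMod.intCast_zmod_eq_zero_iff_dvd, hq] at h2'
      push_cast at h2'
      have h3 : (q : ℤ) ∣ (α i : ℤ) - α i0 :=
        Int.dvd_of_mul_dvd_mul_left (by omega) h2'
      exact (Nat.modEq_iff_dvd.2 h3).symm
    refine ⟨α i0 % q, by have := Nat.mod_lt (α i0) hq0; omega, ?_⟩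
    have hsub : Finset.univ.image α ⊆ (Finset.range t).image (fun j => α i0 % q + j * q) := by
      intro a ha
      obtain ⟨i, -, rfl⟩ := Finset.mem_image.1 ha
      refine Finset.mem_image.2 ⟨α i / q, ?_, ?_⟩
      · rw [Finset.mem_range, Nat.div_lt_iff_lt_mul hq0, ← hq]; exact hα i
      · rw [← hmod i, mul_comm]; exact Nat.mod_add_div _ _
    have heq := Finset.eq_of_subset_of_card_le hsub (by
      rw [Finset.card_image_of_injective _ hmono.injective]
      exact Finset.card_image_le.trans (by simp))
    ext a
    have := Finset.ext_iff.1 heq a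
    simp only [Finset.mem_image, Finset.mem_univ, true_and, Finset.mem_range] at this
    rw [Set.mem_range, this, Set.mem_ofPred_eq]
    constructor
    · rintro ⟨j, hj, rfl⟩; exact ⟨j, by omega, rfl⟩
    · rintro ⟨j, hj, rfl⟩; exact ⟨j, by omega, rfl⟩
  · rintro ⟨⟨q, hq⟩, b, -, hr⟩
    have hnq : n / t = q := by rw [hq]; exact Nat.mul_div_cancel_left q (by omega)
    rw [hnq] at hr
    have hform : ∀ a ∈ A, ∃ c : ℕ, a = (b : ZMod n) + c * q := by
      intro a ha
      obtain ⟨i, -, rfl⟩ := Finset.mem_image.1 ha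
      have : α i ∈ Set.range α := ⟨i, rfl⟩
      rw [hr] at this
      obtain ⟨c, -, hc⟩ := this
      exact ⟨c, by simp [hc]⟩
    choose! c hc using hform
    have hle : (XX k A).card ≤ k := by
      have hsub : XX k A ⊆ (Finset.range k).image
          (fun j : ℕ => 2 * ((k : ZMod n) * b) + 2 * (j * q)) := by
        intro w hw
        obtain ⟨T, hT, hTc, rfl⟩ := mem_XX.1 hw
        refine Finset.mem_image.2 ⟨(∑ a ∈ T, c a) % k, ?_, ?_⟩
        · rw [Finset.mem_range]; exact Nat.mod_lt _ (by omega)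
        · have hs : ∑ a ∈ T, a = (k : ZMod n) * b + (∑ a ∈ T, c a : ℕ) * q := by
            rw [Finset.sum_congr rfl (fun a ha => hc a (hT ha)), Finset.sum_add_distrib,
              Finset.sum_const, hTc, ← Finset.sum_mul, nsmul_eq_mul]
            push_cast
            rfl
          have hn0 : (2 : ZMod n) * k * q = 0 := by
            have : ((2 * k * q : ℕ) : ZMod n) = 0 := by
              rw [← hk2, ← hq]; simp
            simpa using this
          rw [hs]
          have hd := congrArg (Nat.cast : ℕ → ZMod n) (Nat.mod_add_div (∑ a ∈ T, c a) k)
          rw [Nat.cast_add, Nat.cast_mul] at hd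
          linear_combination (2 * q : ZMod n) * hd -
            (((∑ a ∈ T, c a) / k : ℕ) : ZMod n) * hn0
      exact (Finset.card_le_card hsub).trans (Finset.card_image_le.trans (by simp))
    exact (hstr hle).1
end

section
/- Let n ≥ 2 be even, m an integer, and G ≅ H_{n,m} with generators x, y as above. Let t ≥ 5 be odd, let 0 ≤ α₁ < ... < α_t < n be integers, and S = {x^{α₁}y, ..., x^{α_t}y}. Then |∏_t(S)| = (t+1)/2 if and only if t+1 divides n and there exist integers b and ℓ with 0 ≤ b ≤ n/(t+1) − 1 and 0 ≤ ℓ ≤ t such that {α₁, ..., α_t} = {b + k·(n/(t+1)) : 0 ≤ k ≤ t} \ {b + ℓ·(n/(t+1))}. -/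
open Finset in
def Sg {ι A : Type*} [AddCommGroup A] [DecidableEq A] (v : ι → A) (k : ℕ) (M : Finset ι) : Finset A :=
  (M.powersetCard k).image (fun u => ∑ i ∈ u, v i)

set_option linter.unusedSectionVars false
section core
variable {ι A : Type*} [DecidableEq ι] [AddCommGroup A] [DecidableEq A]

lemma mem_Sg {v : ι → A} {k : ℕ} {M : Finset ι} {x : A} :
    x ∈ Sg v k M ↔ ∃ u ⊆ M, u.card = k ∧ ∑ i ∈ u, v i = x := by
  simp [Sg, Finset.mem_powersetCard, and_assoc]

lemma Sg_insert_mem {v : ι → A} {k : ℕ} {M M' : Finset ι} (hM : M' ⊆ M) {i : ι} (hi : i ∈ M)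
    (hi' : i ∉ M') {x : A} (hx : x ∈ Sg v k M') : v i + x ∈ Sg v (k+1) M := by
  obtain ⟨u, hu, hc, rfl⟩ := mem_Sg.1 hx
  refine mem_Sg.2 ⟨insert i u, ?_, ?_, ?_⟩
  · exact Finset.insert_subset hi (hu.trans hM)
  · rw [Finset.card_insert_of_notMem (fun h => hi' (hu h)), hc]
  · rw [Finset.sum_insert (fun h => hi' (hu h))]

/-- fibre counting -/
lemma fibre_count {v : ι → A} {M : Finset ι} (hm : ∀ a, (M.filter (fun i => v i = a)).card ≤ 2)
    {X : Finset A} (z : A) (h : ∀ q ∈ M, v q + z ∈ X) : M.card ≤ 2 * X.card := by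
  refine Finset.card_le_mul_card_image_of_maps_to (f := fun q => v q + z) h 2 ?_
  intro b _
  refine le_trans (Finset.card_le_card ?_) (hm (b - z))
  intro i hi
  simp only [Finset.mem_filter] at hi ⊢
  exact ⟨hi.1, eq_sub_of_add_eq hi.2⟩

lemma mult_mono {v : ι → A} {M M' : Finset ι} (hM : M' ⊆ M)
    (hm : ∀ a, (M.filter (fun i => v i = a)).card ≤ 2) :
    ∀ a, (M'.filter (fun i => v i = a)).card ≤ 2 := fun a =>
  (Finset.card_le_card (Finset.filter_subset_filter _ hM)).trans (hm a)

lemma card_erase2 {M : Finset ι} {i j : ι} (hi : i ∈ M) (hj : j ∈ M) (hij : i ≠ j) :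
    ((M.erase i).erase j).card + 2 = M.card := by
  have h1 := Finset.card_erase_add_one hi
  have h2 := Finset.card_erase_add_one (Finset.mem_erase.2 ⟨hij.symm, hj⟩)
  omega

/-- if the reduced sumset is as large as the full one, the difference stabilises. -/
lemma stab_of_card {v : ι → A} {k : ℕ} {M : Finset ι} {i j : ι} (hi : i ∈ M) (hj : j ∈ M)
    (hc : (Sg v (k+1) M).card ≤ (Sg v k ((M.erase i).erase j)).card) :
    ∀ x ∈ Sg v (k+1) M, v i - v j + x ∈ Sg v (k+1) M := by
  set M' := (M.erase i).erase j with hM'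
  have hsub : M' ⊆ M := (Finset.erase_subset _ _).trans (Finset.erase_subset _ _)
  have him : i ∉ M' := by simp [hM']
  have hjm : j ∉ M' := by simp [hM']
  have hE : (Sg v k M').image (fun x => v j + x) = Sg v (k+1) M := by
    apply Finset.eq_of_subset_of_card_le
    · intro y hy
      obtain ⟨x, hx, rfl⟩ := Finset.mem_image.1 hy
      exact Sg_insert_mem hsub hj hjm hx
    · rwa [Finset.card_image_of_injective _ (add_right_injective _)]
  intro x hx
  rw [← hE] at hx
  obtain ⟨y, hy, rfl⟩ := Finset.mem_image.1 hx
  have := Sg_insert_mem hsub hi him hy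
  simpa [sub_add_eq_add_sub, add_sub_assoc] using this

lemma Sg_nonempty {v : ι → A} {k : ℕ} {M : Finset ι} (h : k ≤ M.card) : (Sg v k M).Nonempty := by
  obtain ⟨u, hu, hc⟩ := Finset.exists_subset_card_eq h
  exact ⟨_, mem_Sg.2 ⟨u, hu, hc, rfl⟩⟩

lemma Sg_lower (v : ι → A) (k : ℕ) : ∀ (M : Finset ι), M.card = 2 * k + 1 →
    (∀ a, (M.filter (fun i => v i = a)).card ≤ 2) → k + 1 ≤ (Sg v (k+1) M).card := by
  induction k with
  | zero =>
    intro M hM _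
    exact Finset.card_pos.2 (Sg_nonempty (by omega))
  | succ k ih =>
    intro M hM hm
    by_contra hlt
    push Not at hlt
    have key : ∀ i ∈ M, ∀ j ∈ M, ∀ x ∈ Sg v (k+1+1) M, v i - v j + x ∈ Sg v (k+1+1) M := by
      intro i hi j hj
      by_cases hij : i = j
      · subst hij; intro x hx; simpa using hx
      · apply stab_of_card hi hj
        have h1 := card_erase2 hi hj hij
        have := ih ((M.erase i).erase j) (by omega)
          (mult_mono ((Finset.erase_subset _ _).trans (Finset.erase_subset _ _)) hm)
        omega
    obtain ⟨x0, hx0⟩ := Sg_nonempty (v := v) (k := k+1+1) (M := M) (by omega)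
    obtain ⟨i0, hi0⟩ : M.Nonempty := Finset.card_pos.1 (by omega)
    have := fibre_count hm (X := Sg v (k+1+1) M) (x0 - v i0) (fun q hq => by
      have := key q hq i0 hi0 x0 hx0
      convert this using 1; abel)
    omega


lemma three_eq {S : Finset A} (hc : S.card ≤ 3) {a b c : A} (ha : a ∈ S) (hb : b ∈ S) (hcS : c ∈ S)
    (hab : a ≠ b) (hac : a ≠ c) (hbc : b ≠ c) : S = {a, b, c} := by
  symm
  apply Finset.eq_of_subset_of_card_le
  · intro x; simp; rintro (rfl | rfl | rfl) <;> assumption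
  · rw [Finset.card_eq_three.2 ⟨a, b, c, hab, hac, hbc, rfl⟩]; exact hc


lemma base0 {S : Finset A} (hc : S.card ≤ 3) {g a b : A} (hg0 : g ≠ 0) (ha0 : a ≠ 0) (hb0 : b ≠ 0)
    (hab : a ≠ b) (hg : g ∈ S) (ha : a ∈ S) (hb : b ∈ S) (hga : g + a ∈ S) (hgb : g + b ∈ S)
    (hsab : a + b ∈ S) (hgab : g + a + b ∈ S) : ∀ x ∈ S, a - b + x ∈ S := by
  by_cases h1 : a = g
  · subst h1
    have hS := three_eq hc ha hga hgb (by simpa using ha0) (by simpa using hb0)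
      (by simpa using hab)
    have e1 : b = a + a := by
      rw [hS] at hb
      simp only [Finset.mem_insert, Finset.mem_singleton] at hb
      rcases hb with h | h | h
      · exact absurd h.symm hab
      · exact h
      · simp at h; exact absurd h ha0
    subst e1
    have e2 : a + a + a = 0 := by
      rw [hS] at hgab
      simp only [Finset.mem_insert, Finset.mem_singleton] at hgab
      rcases hgab with h | h | h
      · have : a + a + (a + a) = a + (a + a + a) := by abel
        rw [this] at h; simpa using h
      · simp at h; exact absurd h hb0
      · have : a + a + (a + a) = a + (a + (a + a)) := by abel
        rw [this] at h; simp at h; exact absurd h ha0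
    intro x hx
    rw [hS] at hx ⊢
    simp only [Finset.mem_insert, Finset.mem_singleton] at hx ⊢
    rcases hx with h | h | h
    · right; right; rw [h, ← add_assoc, e2]; abel
    · left; rw [h]; abel
    · right; left; rw [h]; abel
  by_cases h2 : b = g
  · subst h2
    have hS := three_eq hc hb hgb hga (by simpa using hb0) (by simpa using ha0)
      (by simpa using hab.symm)
    have e1 : a = b + b := by
      rw [hS] at ha
      simp only [Finset.mem_insert, Finset.mem_singleton] at ha
      rcases ha with h | h | h
      · exact absurd h hab
      · exact h
      · simp at h; exact absurd h hb0
    subst e1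
    have e2 : b + b + b = 0 := by
      rw [hS] at hgab
      simp only [Finset.mem_insert, Finset.mem_singleton] at hgab
      rcases hgab with h | h | h
      · have : b + (b + b) + b = b + (b + b + b) := by abel
        rw [this] at h; simpa using h
      · have : b + (b + b) + b = (b + b) + (b + b) := by abel
        rw [this] at h; simp at h; exact absurd h ha0
      · simp at h; exact absurd h hb0
    intro x hx
    rw [hS] at hx ⊢
    simp only [Finset.mem_insert, Finset.mem_singleton] at hx ⊢
    rcases hx with h | h | h
    · right; left; rw [h]; abel
    · right; right; rw [h]; abel
    · left; rw [h, ← add_assoc b b b, e2]; abel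
  · exfalso
    have hS := three_eq hc ha hb hg hab h1 h2
    rw [hS] at hga hgb hsab hgab
    simp only [Finset.mem_insert, Finset.mem_singleton] at hga hgb hsab hgab
    have q1 : g + a = b := by
      rcases hga with h | h | h
      · simp at h; exact absurd h hg0
      · exact h
      · simp at h; exact absurd h ha0
    have q2 : g + b = a := by
      rcases hgb with h | h | h
      · exact h
      · simp at h; exact absurd h hg0
      · simp at h; exact absurd h hb0
    have q3 : a + b = g := by
      rcases hsab with h | h | h
      · simp at h; exact absurd h hb0
      · simp at h; exact absurd h ha0
      · exact h
    rcases hgab with h | h | h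
    · rw [add_right_comm, q2] at h; simp at h; exact ha0 h
    · rw [q1] at h; simp at h; exact hb0 h
    · rw [add_assoc, q3] at h; simp at h; exact hg0 h

lemma base1 {S : Finset A} (hc : S.card ≤ 3) {e g a b : A} (hg0 : g ≠ e) (ha0 : a ≠ e) (hb0 : b ≠ e)
    (hab : a ≠ b) (hg : e + e + g ∈ S) (ha : e + e + a ∈ S) (hb : e + e + b ∈ S)
    (hga : e + g + a ∈ S) (hgb : e + g + b ∈ S)
    (hsab : e + a + b ∈ S) (hgab : g + a + b ∈ S) : ∀ x ∈ S, a - b + x ∈ S := by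
  have hT : ∀ y, y ∈ S.image (fun x => x - (e + e + e)) ↔ y + (e + e + e) ∈ S := by
    intro y
    simp only [Finset.mem_image]
    constructor
    · rintro ⟨x, hx, rfl⟩; simpa using hx
    · intro h; exact ⟨_, h, by simp⟩
  have := base0 (S := S.image (fun x => x - (e + e + e))) (Finset.card_image_le.trans hc)
    (g := g - e) (a := a - e) (b := b - e) (sub_ne_zero.2 hg0) (sub_ne_zero.2 ha0)
    (sub_ne_zero.2 hb0) (by simpa using hab)
    ((hT _).2 (by convert hg using 1; abel)) ((hT _).2 (by convert ha using 1; abel))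
    ((hT _).2 (by convert hb using 1; abel)) ((hT _).2 (by convert hga using 1; abel))
    ((hT _).2 (by convert hgb using 1; abel)) ((hT _).2 (by convert hsab using 1; abel))
    ((hT _).2 (by convert hgab using 1; abel))
  intro x hx
  have h2 := this (x - (e + e + e)) ((hT _).2 (by simpa using hx))
  rw [hT] at h2
  convert h2 using 1; abel

lemma Sg_three {v : ι → A} {M : Finset ι} {i j k : ι} (hi : i ∈ M) (hj : j ∈ M) (hk : k ∈ M)
    (hij : i ≠ j) (hik : i ≠ k) (hjk : j ≠ k) : v i + v j + v k ∈ Sg v 3 M := by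
  refine mem_Sg.2 ⟨{i, j, k}, ?_, Finset.card_eq_three.2 ⟨i, j, k, hij, hik, hjk, rfl⟩, ?_⟩
  · intro x; simp; rintro (rfl | rfl | rfl) <;> assumption
  · rw [Finset.sum_insert (by simp [hij, hik]), Finset.sum_insert (by simp [hjk]),
      Finset.sum_singleton, add_assoc]

lemma Sg_two {v : ι → A} {M : Finset ι} {i j : ι} (hi : i ∈ M) (hj : j ∈ M)
    (hij : i ≠ j) : v i + v j ∈ Sg v 2 M := by
  refine mem_Sg.2 ⟨{i, j}, ?_, Finset.card_eq_two.2 ⟨i, j, hij, rfl⟩, ?_⟩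
  · intro x; simp; rintro (rfl | rfl) <;> assumption
  · rw [Finset.sum_pair hij]

lemma mult3 {v : ι → A} {M : Finset ι} (hm : ∀ a, (M.filter (fun i => v i = a)).card ≤ 2)
    {i j k : ι} (hi : i ∈ M) (hj : j ∈ M) (hk : k ∈ M)
    (hij : i ≠ j) (hik : i ≠ k) (hjk : j ≠ k) (h1 : v i = v j) : v k ≠ v i := by
  intro h2
  have := Finset.card_le_card (s := {i, j, k}) (t := M.filter (fun l => v l = v i)) (by
    intro x; simp only [Finset.mem_insert, Finset.mem_singleton, Finset.mem_filter]
    rintro (rfl | rfl | rfl)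
    · exact ⟨hi, rfl⟩
    · exact ⟨hj, h1.symm⟩
    · exact ⟨hk, h2⟩)
  rw [Finset.card_eq_three.2 ⟨i, j, k, hij, hik, hjk, rfl⟩] at this
  have := hm (v i)
  omega

lemma upper_base_aux {v : ι → A} {M : Finset ι}
    (hm : ∀ a, (M.filter (fun i => v i = a)).card ≤ 2) (hc : (Sg v 3 M).card ≤ 3)
    {i j p q r : ι} (hi : i ∈ M) (hj : j ∈ M) (hp : p ∈ M) (hq : q ∈ M) (hr : r ∈ M)
    (hvij : v i ≠ v j) (hpi : p ≠ i) (hpj : p ≠ j) (hqi : q ≠ i) (hqj : q ≠ j) (hri : r ≠ i)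
    (hrj : r ≠ j) (hpq : p ≠ q) (hpr : p ≠ r) (hqr : q ≠ r) (hv : v p = v q) :
    ∀ x ∈ Sg v 3 M, v i - v j + x ∈ Sg v 3 M := by
  have hij : i ≠ j := fun h => hvij (by rw [h])
  refine base1 hc (e := v p) (g := v r) (a := v i) (b := v j)
    (mult3 hm hp hq hr hpq hpr hqr hv) (mult3 hm hp hq hi hpq hpi hqi hv)
    (mult3 hm hp hq hj hpq hpj hqj hv) hvij ?_ ?_ ?_ ?_ ?_ ?_ ?_
  · have := Sg_three (v := v) hp hq hr hpq hpr hqr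
    rwa [← hv] at this
  · have := Sg_three (v := v) hp hq hi hpq hpi hqi
    rwa [← hv] at this
  · have := Sg_three (v := v) hp hq hj hpq hpj hqj
    rwa [← hv] at this
  · exact Sg_three hp hr hi hpr hpi hri
  · exact Sg_three hp hr hj hpr hpj hrj
  · exact Sg_three hp hi hj hpi hpj hij
  · exact Sg_three hr hi hj hri hrj hij

lemma upper_base {v : ι → A} {M : Finset ι} (hM : M.card = 5)
    (hm : ∀ a, (M.filter (fun i => v i = a)).card ≤ 2) (hc : (Sg v 3 M).card ≤ 3) :
    ∀ i ∈ M, ∀ j ∈ M, ∀ x ∈ Sg v 3 M, v i - v j + x ∈ Sg v 3 M := by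
  intro i hi j hj
  by_cases hvij : v i = v j
  · intro x hx; simpa [hvij] using hx
  have hij : i ≠ j := fun h => hvij (by rw [h])
  have h1 := card_erase2 hi hj hij
  by_cases h3 : 3 ≤ (Sg v 2 ((M.erase i).erase j)).card
  · exact stab_of_card hi hj (le_trans hc h3)
  push Not at h3
  obtain ⟨p, q, r, hpq, hpr, hqr, hE⟩ := Finset.card_eq_three.1 (show ((M.erase i).erase j).card = 3 by omega)
  have hp : p ∈ ((M.erase i).erase j) := by simp [hE]
  have hq : q ∈ ((M.erase i).erase j) := by simp [hE]
  have hr : r ∈ ((M.erase i).erase j) := by simp [hE]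
  have s1 := Sg_two (v := v) hp hq hpq
  have s2 := Sg_two (v := v) hp hr hpr
  have s3 := Sg_two (v := v) hq hr hqr
  simp only [Finset.mem_erase] at hp hq hr
  obtain ⟨hpj, hpi, hp⟩ := hp
  obtain ⟨hqj, hqi, hq⟩ := hq
  obtain ⟨hrj, hri, hr⟩ := hr
  by_cases e1 : v p = v q
  · exact upper_base_aux hm hc hi hj hp hq hr hvij hpi hpj hqi hqj hri hrj hpq hpr hqr e1
  by_cases e2 : v p = v r
  · exact upper_base_aux hm hc hi hj hp hr hq hvij hpi hpj hri hrj hqi hqj hpr hpq hqr.symm e2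
  by_cases e3 : v q = v r
  · exact upper_base_aux hm hc hi hj hq hr hp hvij hqi hqj hri hrj hpi hpj hqr hpq.symm hpr.symm e3
  exfalso
  have := three_eq (by omega) s1 s2 s3 (by simpa using e3)
    (by rw [add_comm (v p)]; simpa using e2) (by simpa using e1)
  rw [this, Finset.card_eq_three.2 ⟨_, _, _, by simpa using e3,
    by rw [add_comm (v p)]; simpa using e2, by simpa using e1, rfl⟩] at h3
  omega

open Pointwise in
lemma mem_stabF {X : Finset A} {a : A} :
    a ∈ AddAction.stabilizer A X ↔ ∀ x ∈ X, a + x ∈ X := by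
  rw [AddAction.mem_stabilizer_iff]
  constructor
  · intro h x hx
    have := Finset.vadd_mem_vadd_finset (a := a) hx
    rwa [h] at this
  · intro h
    apply Finset.eq_of_subset_of_card_le
    · intro y hy
      obtain ⟨x, hx, rfl⟩ := Finset.mem_vadd_finset.1 hy
      exact h x hx
    · simp

/-- when all differences stabilise a small set, the set is a single coset -/
lemma single_coset {v : ι → A} {M : Finset ι} {X : Finset A} {r : ℕ} (hM : 2 * r ≤ M.card + 1)
    (hm : ∀ a, (M.filter (fun i => v i = a)).card ≤ 2) (hX : X.card ≤ r)
    {i0 : ι} {x0 : A} (hx0 : x0 ∈ X)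
    (h : ∀ i ∈ M, ∀ x ∈ X, v i - v i0 + x ∈ X) :
    ∀ y ∈ X, ∃ q ∈ M, y = v q - v i0 + x0 := by
  have hsub : M.image (fun q => v q - v i0 + x0) ⊆ X := by
    intro y hy
    obtain ⟨q, hq, rfl⟩ := Finset.mem_image.1 hy
    exact h q hq x0 hx0
  have hcard := fibre_count hm (X := M.image (fun q => v q - v i0 + x0)) (x0 - v i0) (by
    intro q hq
    refine Finset.mem_image.2 ⟨q, hq, by abel⟩)
  have := Finset.eq_of_subset_of_card_le hsub (by omega)
  intro y hy
  rw [← this] at hy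
  obtain ⟨q, hq, rfl⟩ := Finset.mem_image.1 hy
  exact ⟨q, hq, rfl⟩

open Pointwise in
lemma Sg_eq (v : ι → A) (k : ℕ) (hk : 3 ≤ k) : ∀ (M : Finset ι), M.card + 1 = 2 * k →
    (∀ a, (M.filter (fun i => v i = a)).card ≤ 2) → (Sg v k M).card ≤ k →
    ∀ i ∈ M, ∀ j ∈ M, ∀ x ∈ Sg v k M, v i - v j + x ∈ Sg v k M := by
  induction k, hk using Nat.le_induction with
  | base => intro M hM hm hc; exact upper_base (by omega) hm hc
  | succ k hk ih =>
    intro M hM hm hc i hi j hj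
    by_cases hij : i = j
    · subst hij; intro x hx; simpa using hx
    have h1 := card_erase2 hi hj hij
    by_cases h3 : k + 1 ≤ (Sg v k ((M.erase i).erase j)).card
    · exact stab_of_card hi hj (by omega)
    exfalso
    push Not at h3
    set M' := (M.erase i).erase j with hM'
    have hsub : M' ⊆ M := (Finset.erase_subset _ _).trans (Finset.erase_subset _ _)
    have him : i ∉ M' := by simp [hM']
    have hjm : j ∉ M' := by simp [hM']
    have hm' := mult_mono hsub hm
    have hlow : k ≤ (Sg v k M').card := by
      obtain ⟨l, rfl⟩ : ∃ l, k = l + 1 := ⟨k - 1, by omega⟩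
      exact Sg_lower v l M' (by omega) hm'
    have hst := ih M' (by omega) hm' (by omega)
    obtain ⟨x0, hx0⟩ := Sg_nonempty (v := v) (k := k) (M := M') (by omega)
    obtain ⟨i0, hi0⟩ : M'.Nonempty := Finset.card_pos.1 (by omega)
    set H := AddAction.stabilizer A (Sg v k M') with hH
    have hd : ∀ p ∈ M', v p - v i0 ∈ H := fun p hp => mem_stabF.2 (hst p hp i0 hi0)
    have hcos := single_coset (r := k) (by omega) hm' (by omega) hx0 (fun p hp => hst p hp i0 hi0)
    have hdiff : ∀ y ∈ Sg v k M', ∀ z ∈ Sg v k M', y - z ∈ H := by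
      intro y hy z hz
      obtain ⟨p, hp, rfl⟩ := hcos y hy
      obtain ⟨q, hq, rfl⟩ := hcos z hz
      have := H.sub_mem (hd p hp) (hd q hq)
      convert this using 1; abel
    have hIi : (Sg v k M').image (fun x => v i + x) ⊆ Sg v (k+1) M := by
      intro y hy
      obtain ⟨x, hx, rfl⟩ := Finset.mem_image.1 hy
      exact Sg_insert_mem hsub hi him hx
    have hIj : (Sg v k M').image (fun x => v j + x) ⊆ Sg v (k+1) M := by
      intro y hy
      obtain ⟨x, hx, rfl⟩ := Finset.mem_image.1 hy
      exact Sg_insert_mem hsub hj hjm hx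
    have ci : ((Sg v k M').image (fun x => v i + x)).card = (Sg v k M').card :=
      Finset.card_image_of_injective _ (add_right_injective _)
    have cj : ((Sg v k M').image (fun x => v j + x)).card = (Sg v k M').card :=
      Finset.card_image_of_injective _ (add_right_injective _)
    by_cases hvH : v i - v j ∈ H
    · by_cases hiH : v i - v i0 ∈ H
      · have hjH : v j - v i0 ∈ H := by
          have := H.sub_mem hiH hvH
          convert this using 1; abel
        have := fibre_count hm (X := Sg v k M') (x0 - v i0) (by
          intro q hq
          have hqH : v q - v i0 ∈ H := by
            by_cases q1 : q = i
            · rwa [q1]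
            by_cases q2 : q = j
            · rwa [q2]
            exact hd q (by simp [hM', q1, q2, hq])
          have := mem_stabF.1 hqH x0 hx0
          convert this using 1; abel)
        omega
      · -- find p q
        obtain ⟨p, hp, q, hq, hvpq⟩ : ∃ p ∈ M', ∃ q ∈ M', v p ≠ v q := by
          by_contra hcon
          push Not at hcon
          have := hm' (v i0)
          rw [Finset.filter_true_of_mem (fun p hp => hcon p hp i0 hi0)] at this
          omega
        have hpq : p ≠ q := fun h => hvpq (by rw [h])
        have h2 := card_erase2 hp hq hpq
        obtain ⟨u, hu, huc⟩ := Finset.exists_subset_card_eq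
          (show k ≤ ((M'.erase p).erase q).card by omega)
        have husub : u ⊆ M' := hu.trans ((Finset.erase_subset _ _).trans (Finset.erase_subset _ _))
        have hs : ∑ l ∈ u, v l ∈ Sg v k M' := mem_Sg.2 ⟨u, husub, huc, rfl⟩
        have hsu : ∑ l ∈ u, v l ∈ Sg v k u := mem_Sg.2 ⟨u, subset_rfl, huc, rfl⟩
        set s := ∑ l ∈ u, v l
        have hps : v p + s ∈ Sg v (k+1) M := Sg_insert_mem (husub.trans hsub) (hsub hp)
          (fun h => by simpa using hu h) hsu
        have hqs : v q + s ∈ Sg v (k+1) M := Sg_insert_mem (husub.trans hsub) (hsub hq)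
          (fun h => by simpa using hu h) hsu
        have hnot : ∀ p ∈ M', v p + s ∉ (Sg v k M').image (fun x => v i + x) := by
          intro p hp hmem
          obtain ⟨y, hy, hyy⟩ := Finset.mem_image.1 hmem
          apply hiH
          have h5 := H.sub_mem (hd p hp) (hdiff y hy s hs)
          have : v i - v i0 = v p - v i0 - (y - s) := by
            have : v i = v p + s - y := by rw [← hyy]; abel
            rw [this]; abel
          rwa [this]
        have hfin := Finset.card_le_card (s := insert (v p + s) (insert (v q + s)
          ((Sg v k M').image (fun x => v i + x)))) (t := Sg v (k+1) M)
          (Finset.insert_subset hps (Finset.insert_subset hqs hIi))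
        rw [Finset.card_insert_of_notMem, Finset.card_insert_of_notMem (hnot q hq)] at hfin
        · omega
        · rw [Finset.mem_insert, not_or]
          exact ⟨by simpa using hvpq, hnot p hp⟩
    · have hdis : Disjoint ((Sg v k M').image (fun x => v i + x))
          ((Sg v k M').image (fun x => v j + x)) := by
        rw [Finset.disjoint_left]
        intro z hz hz'
        obtain ⟨y, hy, rfl⟩ := Finset.mem_image.1 hz
        obtain ⟨y', hy', hyy⟩ := Finset.mem_image.1 hz'
        apply hvH
        have := hdiff y' hy' y hy
        have e : v i - v j = y' - y := by
          have hyy : v j + y' = v i + y := hyy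
          have : v i = v j + y' - y := by rw [hyy]; abel
          rw [this]; abel
        rwa [e]
      have := Finset.card_le_card (Finset.union_subset hIi hIj)
      rw [Finset.card_union_of_disjoint hdis] at this
      omega

lemma Sg_smul {v : ι → A} {k : ℕ} (hk : 3 ≤ k) {M : Finset ι} (hM : M.card + 1 = 2 * k)
    (hm : ∀ a, (M.filter (fun i => v i = a)).card ≤ 2) (hc : (Sg v k M).card = k) :
    ∀ i ∈ M, ∀ j ∈ M, k • (v i - v j) = 0 := by
  intro i hi j hj
  have h := Sg_eq v k hk M hM hm hc.le i hi j hj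
  have hE : (Sg v k M).image (fun x => v i - v j + x) = Sg v k M := by
    apply Finset.eq_of_subset_of_card_le
    · intro y hy
      obtain ⟨x, hx, rfl⟩ := Finset.mem_image.1 hy
      exact h x hx
    · rw [Finset.card_image_of_injective _ (add_right_injective _)]
  have h2 : ∑ x ∈ Sg v k M, x = ∑ x ∈ Sg v k M, (v i - v j + x) := by
    conv_lhs => rw [← hE]
    rw [Finset.sum_image]
    intro a _ b _ hab
    simpa using hab
  rw [Finset.sum_add_distrib, Finset.sum_const, hc] at h2
  simpa using h2

end core

lemma alt_fwd_s6 {ι : Type*} [DecidableEq ι] (f : ι → ℤ) (l : List ι) (hl : l.Nodup) :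
    ∃ A B : Finset ι, Disjoint A B ∧ A ∪ B = l.toFinset ∧ A.card = (l.length + 1) / 2 ∧
      (l.map f).alternatingSum = ∑ i ∈ A, f i - ∑ i ∈ B, f i := by
  induction l with
  | nil => exact ⟨∅, ∅, by simp⟩
  | cons a l ih =>
    rw [List.nodup_cons] at hl
    obtain ⟨A, B, hd, hu, hc, hs⟩ := ih hl.2
    have hcu := Finset.card_union_of_disjoint hd
    rw [hu, List.toFinset_card_of_nodup hl.2] at hcu
    have haA : a ∉ A ∪ B := by rw [hu]; simpa using hl.1
    rw [Finset.mem_union, not_or] at haA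
    refine ⟨insert a B, A, ?_, ?_, ?_, ?_⟩
    · rw [Finset.disjoint_insert_left]; exact ⟨haA.1, hd.symm⟩
    · rw [List.toFinset_cons, ← hu, Finset.insert_union, Finset.union_comm]
    · rw [Finset.card_insert_of_notMem haA.2, List.length_cons]; omega
    · rw [List.map_cons, List.alternatingSum_cons, hs, Finset.sum_insert haA.2]; ring

lemma alt_bwd_s6 {ι : Type*} [DecidableEq ι] (f : ι → ℤ) (m : ℕ) : ∀ (A B : Finset ι), Disjoint A B →
    A.card = (m + 1) / 2 → B.card = m / 2 → ∃ l : List ι, l.Nodup ∧ l.length = m ∧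
      l.toFinset = A ∪ B ∧ (l.map f).alternatingSum = ∑ i ∈ A, f i - ∑ i ∈ B, f i := by
  induction m with
  | zero =>
    intro A B _ hA hB
    have hA : A = ∅ := by simpa using hA
    have hB : B = ∅ := by simpa using hB
    subst hA hB
    exact ⟨[], by simp⟩
  | succ m ih =>
    intro A B hd hA hB
    obtain ⟨a, ha⟩ : A.Nonempty := Finset.card_pos.1 (by omega)
    have hc := Finset.card_erase_add_one ha
    obtain ⟨l, hl, hlen, hset, hs⟩ := ih B (A.erase a)
      (hd.symm.mono_right (Finset.erase_subset _ _)) (by omega) (by omega)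
    have haB : a ∉ B := Finset.disjoint_left.1 hd ha
    refine ⟨a :: l, ?_, ?_, ?_, ?_⟩
    · rw [List.nodup_cons]
      refine ⟨fun h => ?_, hl⟩
      rw [← List.mem_toFinset, hset] at h
      simp [haB] at h
    · simp [hlen]
    · rw [List.toFinset_cons, hset]
      ext z
      simp only [Finset.mem_insert, Finset.mem_union, Finset.mem_erase]
      by_cases hz : z = a
      · simp [hz, ha]
      · simp [hz, or_comm]
    · rw [List.map_cons, List.alternatingSum_cons, hs, ← Finset.add_sum_erase A f ha]; ring

lemma y_zpow {G : Type*} [Group G] {x y : G} (hyx : y * x = x⁻¹ * y) (s : ℤ) :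
    y * x ^ s = x ^ (-s) * y := by
  have h : SemiconjBy y x x⁻¹ := hyx
  have := h.zpow_right s
  rw [inv_zpow', SemiconjBy] at this
  exact this

lemma prod_alt_s6 {G ι : Type*} [Group G] {x y : G} (hyx : y * x = x⁻¹ * y) (f : ι → ℤ) (l : List ι) :
    (l.map (fun i => x ^ f i * y)).prod = x ^ (l.map f).alternatingSum * y ^ l.length := by
  induction l with
  | nil => simp
  | cons a l ih =>
    rw [List.map_cons, List.prod_cons, ih, List.map_cons, List.alternatingSum_cons,
      List.length_cons, mul_assoc, ← mul_assoc y, y_zpow hyx, sub_eq_add_neg, zpow_add, pow_succ']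
    simp only [mul_assoc]

lemma zpow_zmod {G : Type*} [Group G] {x : G} {n : ℕ} [NeZero n] (hx : orderOf x = n) (z : ℤ) :
    x ^ ((z : ZMod n).val) = x ^ z := by
  rw [← zpow_natCast, ZMod.val_intCast, ← hx, zpow_mod_orderOf]

/-- the number of products equals the number of half sums -/
lemma ncard_prod_s6 {n : ℕ} [NeZero n] {G : Type*} [Group G] {x y : G}
    (hx : orderOf x = n) (hyx : y * x = x⁻¹ * y) {t k : ℕ} (htk : t + 1 = 2 * k) (α : Fin t → ℕ)
    (hinj : Function.Injective α) (hα : ∀ i, α i < n) :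
    (prodTuples t (Set.range fun i => x ^ α i * y)).ncard =
      (Sg (fun i => ((2 * α i : ℕ) : ZMod n)) k Finset.univ).card := by
  set v : Fin t → ZMod n := fun i => ((2 * α i : ℕ) : ZMod n) with hv
  set T : ZMod n := ∑ i, (α i : ZMod n) with hT
  let ψ : ZMod n → G := fun s => x ^ (s - T).val * y ^ t
  have hψ : Function.Injective ψ := by
    intro a b hab
    have h1 : x ^ (a - T).val = x ^ (b - T).val := mul_right_cancel hab
    have h2 := (pow_inj_mod (x := x)).1 h1
    rw [hx, Nat.mod_eq_of_lt (ZMod.val_lt _), Nat.mod_eq_of_lt (ZMod.val_lt _)] at h2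
    simpa using ZMod.val_injective n h2
  have hF : (fun i => x ^ α i * y) = (fun i => x ^ ((α i : ℤ)) * y) := by
    funext i; rw [zpow_natCast]
  have hFinj : Function.Injective (fun i => x ^ α i * y) := by
    intro i j hij
    have h1 : x ^ α i = x ^ α j := mul_right_cancel hij
    have h2 := (pow_inj_mod (x := x)).1 h1
    rw [hx, Nat.mod_eq_of_lt (hα _), Nat.mod_eq_of_lt (hα _)] at h2
    exact hinj h2
  have hval : ∀ A B : Finset (Fin t), Disjoint A B → A ∪ B = Finset.univ →
      ψ (∑ i ∈ A, v i) = x ^ (∑ i ∈ A, (α i : ℤ) - ∑ i ∈ B, (α i : ℤ)) * y ^ t := by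
    intro A B hd hu
    simp only [ψ]
    rw [← zpow_zmod hx (∑ i ∈ A, (α i : ℤ) - ∑ i ∈ B, (α i : ℤ))]
    congr 3
    rw [hT, ← hu, Finset.sum_union hd]
    simp only [hv]
    push_cast
    rw [← Finset.mul_sum]
    ring_nf
  have hset : prodTuples t (Set.range fun i => x ^ α i * y) =
      ψ '' (Sg v k Finset.univ : Finset (ZMod n)) := by
    ext g
    constructor
    · rintro ⟨l, hnd, hlen, hmem, rfl⟩
      have : l ∈ Set.range (List.map (fun i => x ^ α i * y)) := by
        rw [Set.range_list_map]; exact hmem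
      obtain ⟨l', rfl⟩ := this
      have hnd' := List.Nodup.of_map _ hnd
      rw [List.length_map] at hlen
      obtain ⟨A, B, hd, hu, hc, hs⟩ := alt_fwd_s6 (fun i => (α i : ℤ)) l' hnd'
      have huniv : l'.toFinset = Finset.univ := by
        rw [← Finset.card_eq_iff_eq_univ, List.toFinset_card_of_nodup hnd', hlen, Fintype.card_fin]
      rw [huniv] at hu
      refine ⟨∑ i ∈ A, v i, ?_, ?_⟩
      · exact mem_Sg.2 ⟨A, Finset.subset_univ _, by omega, rfl⟩
      · rw [hval A B hd hu, hF, prod_alt_s6 hyx, hs, hlen]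
    · rintro ⟨s, hs, rfl⟩
      obtain ⟨A, -, hc, rfl⟩ := mem_Sg.1 hs
      have hcompl := Finset.card_add_card_compl A
      rw [Fintype.card_fin] at hcompl
      obtain ⟨l, hl, hlen, hset, hs⟩ := alt_bwd_s6 (fun i => (α i : ℤ)) t A Aᶜ disjoint_compl_right
        (by omega) (by omega)
      refine ⟨l.map (fun i => x ^ α i * y), hl.map hFinj, by simpa using hlen, ?_, ?_⟩
      · intro a ha
        obtain ⟨i, _, rfl⟩ := List.mem_map.1 ha
        exact ⟨i, rfl⟩
      · rw [hval A Aᶜ disjoint_compl_right (Finset.union_compl A), hF, prod_alt_s6 hyx, hs, hlen]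
  rw [hset, Set.ncard_image_of_injective _ hψ, Set.ncard_coe_finset]

lemma mult_two {n : ℕ} [NeZero n] {t : ℕ} (α : Fin t → ℕ)
    (hinj : Function.Injective α) (hα : ∀ i, α i < n) (hne : Even n) (a : ZMod n) :
    ((Finset.univ : Finset (Fin t)).filter (fun i => ((2 * α i : ℕ) : ZMod n) = a)).card ≤ 2 := by
  by_contra hcon
  push Not at hcon
  obtain ⟨i, j, l, hi, hj, hl, hij, hil, hjl⟩ := Finset.two_lt_card_iff.1 hcon
  simp only [Finset.mem_filter, Finset.mem_univ, true_and] at hi hj hl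
  have h1 := (ZMod.natCast_eq_natCast_iff' _ _ _).1 (hi.trans hj.symm)
  have h2 := (ZMod.natCast_eq_natCast_iff' _ _ _).1 (hi.trans hl.symm)
  have n1 : α i ≠ α j := fun h => hij (hinj h)
  have n2 : α i ≠ α l := fun h => hil (hinj h)
  have n3 : α j ≠ α l := fun h => hjl (hinj h)
  have b1 := hα i
  have b2 := hα j
  have b3 := hα l
  have key : ∀ u, u < n → (2 * u) % n = if 2 * u < n then 2 * u else 2 * u - n := by
    intro u hu
    split_ifs with h
    · exact Nat.mod_eq_of_lt h
    · rw [Nat.mod_eq_sub_mod (by omega), Nat.mod_eq_of_lt (by omega)]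
  rw [key _ b1, key _ b2] at h1
  rw [key _ b1, key _ b3] at h2
  split_ifs at h1 h2 <;> omega

lemma forward {n : ℕ} (hn : 2 ≤ n) {t : ℕ} (ht : 5 ≤ t) (α : Fin t → ℕ)
    (hinj : Function.Injective α) (hα : ∀ i, α i < n)
    (h : ∀ i j, (n : ℤ) ∣ (t + 1 : ℕ) * ((α i : ℤ) - α j)) :
    (t + 1) ∣ n ∧ ∃ b, b ≤ n / (t + 1) - 1 ∧ ∃ ℓ, ℓ ≤ t ∧
        Set.range α =
          {a : ℕ | ∃ k, k ≤ t ∧ a = b + k * (n / (t + 1))} \ {b + ℓ * (n / (t + 1))} := by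
  set g := Nat.gcd n (t + 1) with hg
  have hgpos : 0 < g := Nat.gcd_pos_of_pos_left _ (by omega)
  obtain ⟨q, hq⟩ : g ∣ n := Nat.gcd_dvd_left _ _
  obtain ⟨c, hc⟩ : g ∣ t + 1 := Nat.gcd_dvd_right _ _
  have hqpos : 0 < q := by
    rcases Nat.eq_zero_or_pos q with h0 | h0
    · rw [h0] at hq; omega
    · exact h0
  have hcop : Nat.Coprime q c := by
    have := Nat.coprime_div_gcd_div_gcd (m := n) (n := t + 1) hgpos
    rw [← hg] at this
    rwa [hq, hc, Nat.mul_div_cancel_left _ hgpos, Nat.mul_div_cancel_left _ hgpos] at this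
  have hmod : ∀ i j, α i % q = α j % q := by
    intro i j
    have h1 := h i j
    rw [hc, hq] at h1
    push_cast at h1
    rw [mul_assoc] at h1
    have h2 := Int.dvd_of_mul_dvd_mul_left (by exact_mod_cast hgpos.ne') h1
    have h3 : (q : ℤ) ∣ (α i : ℤ) - α j :=
      IsCoprime.dvd_of_dvd_mul_left (Nat.isCoprime_iff_coprime.2 hcop) h2
    have := (Int.modEq_iff_dvd.2 h3)
    exact (Int.natCast_modEq_iff.1 this).symm
  have hdivinj : Function.Injective (fun i => α i / q) := by
    intro i j hij
    apply hinj
    have hij : α i / q = α j / q := hij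
    rw [← Nat.div_add_mod (α i) q, ← Nat.div_add_mod (α j) q, hij, hmod i j]
  have hdivlt : ∀ i, α i / q < g := by
    intro i
    rw [Nat.div_lt_iff_lt_mul hqpos, ← hq]; exact hα i
  have htg : t ≤ g := by
    have := Finset.card_le_card_of_injOn (s := (Finset.univ : Finset (Fin t))) (t := Finset.range g)
      (fun i => α i / q) (by intro i _; simpa using hdivlt i) (hdivinj.injOn)
    simpa using this
  have hgt : g = t + 1 := by
    rcases Nat.lt_or_ge c 2 with h2 | h2
    · interval_cases c <;> omega
    · nlinarith
  have hnq : n / (t + 1) = q := by rw [← hgt, hq, Nat.mul_div_cancel_left _ hgpos]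
  rw [hnq]
  refine ⟨⟨q, by rw [← hgt]; exact hq⟩, ?_⟩
  let i0 : Fin t := ⟨0, by omega⟩
  have hlt := Nat.mod_lt (α i0) hqpos
  set K := (Finset.univ : Finset (Fin t)).image (fun i => α i / q) with hK
  have hKc : K.card = t := by rw [hK, Finset.card_image_of_injective _ hdivinj]; simp
  have hKs : K ⊆ Finset.range (t + 1) := by
    intro z hz
    obtain ⟨i, _, rfl⟩ := Finset.mem_image.1 hz
    rw [Finset.mem_range, ← hgt]; exact hdivlt i
  obtain ⟨ℓ, hℓ, hℓK⟩ : ∃ ℓ ∈ Finset.range (t + 1), ℓ ∉ K :=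
    Finset.exists_mem_notMem_of_card_lt_card (by simp [hKc])
  have hKe : K = (Finset.range (t + 1)).erase ℓ := by
    apply Finset.eq_of_subset_of_card_le
    · intro z hz
      exact Finset.mem_erase.2 ⟨fun h => hℓK (h ▸ hz), hKs hz⟩
    · rw [Finset.card_erase_of_mem hℓ]; simp [hKc]
  refine ⟨α i0 % q, by omega, ℓ, by simpa [Nat.lt_succ_iff] using hℓ, ?_⟩
  have hrep : ∀ i, α i = α i0 % q + (α i / q) * q := by
    intro i
    rw [hmod i0 i, mul_comm]; exact (Nat.mod_add_div _ _).symm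
  ext a
  simp only [Set.mem_range, Set.mem_diff, Set.mem_setOf_eq, Set.mem_singleton_iff]
  constructor
  · rintro ⟨i, rfl⟩
    have hmem : α i / q ∈ K := Finset.mem_image.2 ⟨i, Finset.mem_univ _, rfl⟩
    refine ⟨⟨α i / q, ?_, hrep i⟩, ?_⟩
    · have := hdivlt i; omega
    · intro he
      rw [hrep i] at he
      have : α i / q = ℓ := Nat.eq_of_mul_eq_mul_right hqpos (Nat.add_left_cancel he)
      exact hℓK (this ▸ hmem)
  · rintro ⟨⟨k, hk, rfl⟩, hne⟩
    have : k ∈ K := by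
      rw [hKe, Finset.mem_erase, Finset.mem_range]
      exact ⟨fun h => hne (by rw [h]), by omega⟩
    obtain ⟨i, _, hi⟩ := Finset.mem_image.1 this
    exact ⟨i, by rw [hrep i, ← hi]⟩

lemma backward {n : ℕ} {t k : ℕ} (htk : t + 1 = 2 * k) (hk : 0 < k) (α : Fin t → ℕ)
    (hd : (t + 1) ∣ n) (b : ℕ) (h : ∀ i, ∃ c, α i = b + c * (n / (t + 1))) :
    (Sg (fun i => ((2 * α i : ℕ) : ZMod n)) k Finset.univ).card ≤ k := by
  obtain ⟨q, hq⟩ := hd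
  have hnq : n / (t + 1) = q := by rw [hq]; exact Nat.mul_div_cancel_left _ (by omega)
  rw [hnq] at h
  choose c hc using h
  have hsub : Sg (fun i => ((2 * α i : ℕ) : ZMod n)) k Finset.univ ⊆
      (Finset.range k).image (fun r => ((2 * (k * b) + 2 * q * r : ℕ) : ZMod n)) := by
    intro z hz
    obtain ⟨u, -, hu, rfl⟩ := mem_Sg.1 hz
    refine Finset.mem_image.2 ⟨(∑ i ∈ u, c i) % k, Finset.mem_range.2 (Nat.mod_lt _ hk), ?_⟩
    rw [← Nat.cast_sum]
    have e1 : ∑ i ∈ u, 2 * α i = 2 * (k * b) + 2 * q * (∑ i ∈ u, c i) := by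
      simp only [hc]
      rw [← Finset.mul_sum, Finset.sum_add_distrib, Finset.sum_const, hu, ← Finset.sum_mul,
        smul_eq_mul]
      ring
    rw [e1, ZMod.natCast_eq_natCast_iff]
    apply Nat.ModEq.add_left
    have hn' : n = 2 * q * k := by rw [hq, htk]; ring
    rw [hn']
    exact Nat.ModEq.mul_left' _ (Nat.mod_modEq _ _)
  exact (Finset.card_le_card hsub).trans (Finset.card_image_le.trans (by simp))

/-- For `n` even and `t ≥ 5` odd, the set `S = {x^{α_1} y, …, x^{α_t} y}` has exactly
`(t+1)/2` distinct `t`-fold products if and only if `t+1 ∣ n` and the `α_i` form an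
arithmetic progression `{b + k(n/(t+1)) : 0 ≤ k ≤ t}` with one term removed. -/
theorem card_prodTuples_eq_iff_of_even_odd (n : ℕ) (m : ℤ) (hn : 2 ≤ n) (hne : Even n)
    {G : Type*} [Group G] [Fintype G]
    (hG : Fintype.card G = 2 * n) (x y : G)
    (hx : orderOf x = n) (hy : y ^ 2 = x ^ m) (hyx : y * x = x⁻¹ * y)
    (hgen : Subgroup.closure {x, y} = ⊤)
    (t : ℕ) (ht : 5 ≤ t) (hto : Odd t) (α : Fin t → ℕ) (hmono : StrictMono α)
    (hα : ∀ i, α i < n) :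
    (prodTuples t (Set.range fun i => x ^ α i * y)).ncard = (t + 1) / 2 ↔
      (t + 1) ∣ n ∧ ∃ b, b ≤ n / (t + 1) - 1 ∧ ∃ ℓ, ℓ ≤ t ∧
        Set.range α =
          {a : ℕ | ∃ k, k ≤ t ∧ a = b + k * (n / (t + 1))} \ {b + ℓ * (n / (t + 1))} := by
  have : NeZero n := ⟨by omega⟩
  obtain ⟨r, hr⟩ := hto
  set k := r + 1 with hk
  have htk : t + 1 = 2 * k := by omega
  have hk2 : (t + 1) / 2 = k := by omega
  rw [hk2, ncard_prod_s6 hx hyx htk α hmono.injective hα]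
  have hm := mult_two α hmono.injective hα hne
  constructor
  · intro hc
    apply forward hn ht α hmono.injective hα
    intro i j
    have := Sg_smul (by omega) (by simpa using htk) hm hc i (Finset.mem_univ _) j
      (Finset.mem_univ _)
    rw [← ZMod.intCast_zmod_eq_zero_iff_dvd, htk]
    rw [nsmul_eq_mul] at this
    push_cast at this ⊢
    rw [← this]; ring
  · rintro ⟨hd, b, -, ℓ, -, hR⟩
    apply le_antisymm
    · apply backward htk (by omega) α hd b
      intro i
      have : α i ∈ Set.range α := ⟨i, rfl⟩
      rw [hR] at this
      obtain ⟨⟨c, _, hc⟩, _⟩ := this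
      exact ⟨c, hc⟩
    · exact Sg_lower _ r Finset.univ (by simpa using hr) hm
end

section
/- For every ε > 0 there exists N such that for all even integers n ≥ N, all even integers m, and every group G ≅ H_{n,m} with generators x, y as above, the number F of n-element subsets S of G with 1 ∉ ∏_n(S) satisfies |F / C(2n,n) − 3/4| < ε; equivalently, if an n-element subset of H_{n,m} is chosen uniformly at random, the probability that it contains no n distinct elements with product 1 tends to 3/4 as n → ∞. -/
open Finset in
lemma cntAux {G : Type} [Fintype G] [DecidableEq G] (f g : ℕ → G) (r : ℕ)
    (h0 : ∀ i < r, f i ≠ g i)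
    (h1 : ∀ i j, i < j → j < r → f i ≠ f j ∧ f i ≠ g j ∧ g i ≠ f j ∧ g i ≠ g j) :
    (univ.filter (fun S : Finset G => ∀ i < r, ¬ (f i ∈ S ∧ g i ∈ S))).card * 4 ^ r
      ≤ 3 ^ r * 2 ^ (Fintype.card G) := by
  induction r with
  | zero => simp
  | succ r ih =>
    have ih := ih (fun i hi => h0 i (by omega)) (fun i j hij hj => h1 i j hij (by omega))
    set X := univ.filter (fun S : Finset G => ∀ i < r, ¬ (f i ∈ S ∧ g i ∈ S)) with hX
    set P := X.filter (fun S => ¬ (f r ∈ S ∧ g r ∈ S)) with hP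
    set Q := X.filter (fun S => (f r ∈ S ∧ g r ∈ S)) with hQ
    have e1 : univ.filter (fun S : Finset G => ∀ i < r + 1, ¬ (f i ∈ S ∧ g i ∈ S)) = P := by
      ext S
      simp only [hP, hX, mem_filter, mem_univ, true_and]
      constructor
      · intro h
        exact ⟨fun i hi => h i (by omega), h r (by omega)⟩
      · rintro ⟨ha, hb⟩ i hi
        rcases Nat.lt_succ_iff_lt_or_eq.mp hi with h | h
        · exact ha i h
        · subst h; exact hb
    have e2 : Q.card + P.card = X.card := card_filter_add_card_filter_not _
    have e3 : P.card ≤ 3 * Q.card := by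
      refine card_le_mul_card_image_of_maps_to (f := fun S => insert (f r) (insert (g r) S)) ?_ 3 ?_
      · intro S hS
        simp only [hP, hQ, hX, mem_filter, mem_univ, true_and, mem_insert] at hS ⊢
        refine ⟨fun i hi => ?_, by simp⟩
        obtain ⟨a, b, c, d⟩ := h1 i r hi (by omega)
        have := hS.1 i hi
        tauto
      · intro T hT
        refine le_trans (card_le_card (t := {T.erase (f r), T.erase (g r), (T.erase (f r)).erase (g r)}) ?_) card_le_three
        intro S hS
        simp only [mem_filter, hP] at hS
        obtain ⟨⟨-, hn⟩, rfl⟩ := hS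
        have hfg := h0 r (by omega)
        simp only [mem_insert, mem_singleton]
        by_cases hf : f r ∈ S
        · have hg : g r ∉ S := fun h => hn ⟨hf, h⟩
          right; left
          ext a; simp only [mem_erase, mem_insert]
          grind
        · by_cases hg : g r ∈ S
          · left
            ext a; simp only [mem_erase, mem_insert]
            grind
          · right; right
            ext a; simp only [mem_erase, mem_insert]
            grind
    rw [e1, pow_succ, pow_succ]
    nlinarith [Nat.zero_le (4 ^ r)]

lemma charBound {G : Type} [Group G] [Fintype G] [DecidableEq G] (n : ℕ) (hc : Fintype.card G = 2 * n)
    (χ : G →* ℤ) (hχ : ∀ g, χ g = 1 ∨ χ g = -1) (hne : χ ≠ 1) :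
    |∑ S ∈ Finset.powersetCard n (Finset.univ : Finset G), ∏ g ∈ S, χ g| ≤ 2 ^ n := by
  have h0 : ∑ g, χ g = 0 := sum_hom_units_eq_zero χ hne
  set A := Finset.univ.filter (fun g => χ g = 1)
  set B := Finset.univ.filter (fun g => ¬ χ g = 1)
  have hAB : A.card + B.card = 2 * n := by
    rw [← hc]; exact Finset.card_filter_add_card_filter_not _
  have hB1 : ∀ g ∈ B, χ g = -1 := by
    intro g hg; exact (hχ g).resolve_left (Finset.mem_filter.mp hg).2
  have hA1 : ∀ g ∈ A, χ g = 1 := fun g hg => (Finset.mem_filter.mp hg).2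
  have h0' : (A.card : ℤ) - B.card = 0 := by
    rw [← h0, ← Finset.sum_filter_add_sum_filter_not Finset.univ (fun g => χ g = 1),
      Finset.sum_congr rfl hA1, Finset.sum_congr rfl hB1]
    simp [A, B]; ring
  have hA : A.card = n := by omega
  have hB : B.card = n := by omega
  have hp : ∏ g : G, (Polynomial.X + Polynomial.C (χ g)) =
      Polynomial.expand ℤ 2 ((Polynomial.X + Polynomial.C (-1)) ^ n) := by
    rw [← Finset.prod_filter_mul_prod_filter_not Finset.univ (fun g => χ g = 1),
      Finset.prod_congr rfl (fun g hg => by rw [hA1 g hg]),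
      Finset.prod_congr (s₁ := Finset.univ.filter (fun g => ¬ χ g = 1)) rfl (fun g hg => by rw [hB1 g hg])]
    rw [Finset.prod_const, Finset.prod_const]
    change _ ^ A.card * _ ^ B.card = _
    rw [hA, hB, ← mul_pow]
    simp
    ring
  have h2 := Finset.prod_X_add_C_coeff (Finset.univ : Finset G) (fun g => χ g) (k := n)
    (by simp [hc]; omega)
  rw [hp, Finset.card_univ, hc, show 2 * n - n = n by omega] at h2
  rw [← h2, Polynomial.coeff_expand (by norm_num)]
  split_ifs
  · rw [Polynomial.coeff_X_add_C_pow, abs_mul, abs_pow]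
    simp
    exact_mod_cast Nat.choose_le_two_pow n (n / 2)
  · simp

/-- products of all elements of a finset in some order -/
def IsOrdProd {G : Type} [Group G] [DecidableEq G] (S : Finset G) (g : G) : Prop :=
  ∃ l : List G, l.Nodup ∧ l.toFinset = S ∧ l.prod = g

lemma IsOrdProd.mul {G : Type} [Group G] [DecidableEq G] {S T : Finset G} {g k : G}
    (hS : IsOrdProd S g) (hT : IsOrdProd T k) (hd : Disjoint S T) : IsOrdProd (S ∪ T) (g * k) := by
  obtain ⟨l, hl, rfl, rfl⟩ := hS
  obtain ⟨l', hl', rfl, rfl⟩ := hT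
  refine ⟨l ++ l', ?_, by simp, by simp⟩
  rw [List.nodup_append']
  refine ⟨hl, hl', ?_⟩
  rwa [List.disjoint_toFinset_iff_disjoint] at hd

lemma IsOrdProd.exists' {G : Type} [Group G] [DecidableEq G] (S : Finset G) : ∃ g, IsOrdProd S g :=
  ⟨_, S.toList, S.nodup_toList, by simp, rfl⟩

lemma IsOrdProd.pair {G : Type} [Group G] [DecidableEq G] {a b : G} (h : a ≠ b) :
    IsOrdProd {a, b} (a * b) :=
  ⟨[a, b], by simp [h], by simp, by simp⟩

lemma isOrdProd_pairs {G : Type} [Group G] [DecidableEq G] (p q : ℕ → G) (z w : G) (t : ℕ)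
    (hzw : Commute z w)
    (h0 : ∀ i < t, p i ≠ q i)
    (h1 : ∀ i j, i < j → j < t → p i ≠ p j ∧ p i ≠ q j ∧ q i ≠ p j ∧ q i ≠ q j)
    (hpq : ∀ i < t, p i * q i = z * w) (hqp : ∀ i < t, q i * p i = z) (j : ℕ) (hj : j ≤ t) :
    IsOrdProd ((Finset.range t).biUnion (fun i => {p i, q i})) (z ^ t * w ^ j) := by
  induction t generalizing j with
  | zero => 
    obtain rfl : j = 0 := by omega
    exact ⟨[], by simp, by simp, by simp⟩
  | succ t ih =>
    have ih := ih (fun i hi => h0 i (by omega)) (fun i j hij hj => h1 i j hij (by omega))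
      (fun i hi => hpq i (by omega)) (fun i hi => hqp i (by omega))
    have hd : Disjoint ((Finset.range t).biUnion (fun i => ({p i, q i} : Finset G))) {p t, q t} := by
      rw [Finset.disjoint_biUnion_left]
      intro i hi
      have := h1 i t (Finset.mem_range.mp hi) (by omega)
      rw [Finset.disjoint_left]
      intro a ha hb
      simp only [Finset.mem_insert, Finset.mem_singleton] at ha hb
      grind
    have hU : (Finset.range (t+1)).biUnion (fun i => ({p i, q i} : Finset G)) =
       (Finset.range t).biUnion (fun i => ({p i, q i} : Finset G)) ∪ {p t, q t} := by
      rw [Finset.range_add_one, Finset.biUnion_insert, Finset.union_comm]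
    rw [hU]
    rcases Nat.lt_or_ge t j with h | h
    · obtain rfl : j = t + 1 := by omega
      have := (ih t le_rfl).mul (IsOrdProd.pair (h0 t (by omega))) hd
      rw [hpq t (by omega)] at this
      convert this using 1
      rw [pow_succ, pow_succ, mul_assoc, mul_assoc]
      congr 1
      rw [← mul_assoc, ← mul_assoc, (hzw.pow_right t).eq]
    · have := (ih j h).mul (T := {p t, q t}) (by
        have := IsOrdProd.pair (h0 t (by omega)).symm
        rwa [Finset.pair_comm] at this) hd
      rw [hqp t (by omega)] at this
      convert this using 1
      rw [pow_succ, mul_assoc, mul_assoc, (hzw.pow_right j).eq]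

lemma isOrdProd_iff {G : Type} [Group G] [DecidableEq G] (S : Finset G) (g : G) :
    g ∈ prodTuples S.card (S : Set G) ↔ IsOrdProd S g := by
  constructor
  · rintro ⟨l, hl, hc, hm, rfl⟩
    refine ⟨l, hl, ?_, rfl⟩
    apply Finset.eq_of_subset_of_card_le
    · intro a ha
      simpa using hm a (by simpa using ha)
    · rw [List.toFinset_card_of_nodup hl, hc]
  · rintro ⟨l, hl, rfl, rfl⟩
    exact ⟨l, hl, (List.toFinset_card_of_nodup hl).symm, by simp, rfl⟩

lemma IsOrdProd.map {G : Type} [Group G] [DecidableEq G] {S : Finset G} {g : G} (h : IsOrdProd S g)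
    (χ : G →* ℤ) : χ g = ∏ a ∈ S, χ a := by
  obtain ⟨l, hl, rfl, rfl⟩ := h
  rw [map_list_prod, List.prod_toFinset _ hl]

open Classical in
/-- sign character of an index two subgroup -/
noncomputable def sgnChar {G : Type} [Group G] (H : Subgroup G) (hH : H.index = 2) : G →* ℤ where
  toFun g := if g ∈ H then 1 else -1
  map_one' := by simp [H.one_mem]
  map_mul' a b := by
    have := Subgroup.mul_mem_iff_of_index_two hH (a := a) (b := b)
    by_cases ha : a ∈ H <;> by_cases hb : b ∈ H <;> simp_all

lemma sgnChar_eq_one {G : Type} [Group G] (H : Subgroup G) (hH : H.index = 2) (g : G) :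
    sgnChar H hH g = 1 ↔ g ∈ H := by
  classical
  change (if g ∈ H then (1 : ℤ) else -1) = 1 ↔ _
  split_ifs with h <;> simp [h]

lemma sgnChar_or {G : Type} [Group G] (H : Subgroup G) (hH : H.index = 2) (g : G) :
    sgnChar H hH g = 1 ∨ sgnChar H hH g = -1 := by
  classical
  change (if g ∈ H then (1 : ℤ) else -1) = 1 ∨ (if g ∈ H then (1 : ℤ) else -1) = -1
  split_ifs with h <;> simp

section grp
variable {G : Type} [Group G] {x y : G}

lemma y_mul_zpow (h : y * x = x⁻¹ * y) (i : ℤ) : y * x ^ i = x ^ (-i) * y := by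
  have : SemiconjBy y x x⁻¹ := h
  have := this.zpow_right i
  rw [inv_zpow'] at this
  exact this

lemma normal_form {m : ℤ} (h2 : y ^ 2 = x ^ m) (h : y * x = x⁻¹ * y)
    (hc : Subgroup.closure {x, y} = ⊤) (g : G) : ∃ i : ℤ, g = x ^ i ∨ g = x ^ i * y := by
  have hg : g ∈ Subgroup.closure {x, y} := by rw [hc]; trivial
  have hyy : y * y = x ^ m := by rw [← h2, sq]
  induction hg using Subgroup.closure_induction with
  | mem g hg =>
    rcases hg with rfl | rfl
    · exact ⟨1, by simp⟩
    · exact ⟨0, by simp⟩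
  | one => exact ⟨0, by simp⟩
  | mul a b _ _ ha hb =>
    obtain ⟨i, rfl | rfl⟩ := ha <;> obtain ⟨j, rfl | rfl⟩ := hb
    · exact ⟨i + j, Or.inl (zpow_add ..).symm⟩
    · exact ⟨i + j, Or.inr (by rw [zpow_add, mul_assoc])⟩
    · exact ⟨i - j, Or.inr (by rw [mul_assoc, y_mul_zpow h, ← mul_assoc, ← zpow_add, sub_eq_add_neg])⟩
    · exact ⟨i - j + m, Or.inl (by
        rw [mul_assoc, ← mul_assoc y, y_mul_zpow h, mul_assoc, hyy, ← zpow_add, ← zpow_add]; ring_nf)⟩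
  | inv a _ ha =>
    obtain ⟨i, rfl | rfl⟩ := ha
    · exact ⟨-i, Or.inl (by simp)⟩
    · refine ⟨i + m, Or.inr ?_⟩
      rw [inv_eq_iff_mul_eq_one, mul_assoc, ← mul_assoc y, y_mul_zpow h, mul_assoc, hyy, ← zpow_add, ← zpow_add]
      rw [show i + (-(i + m) + m) = 0 by ring, zpow_zero]

/-- the subgroup of elements with even exponent -/
def evenSub {m : ℤ} (h2 : y ^ 2 = x ^ m) (h : y * x = x⁻¹ * y) (hm : Even m) : Subgroup G where
  carrier := {g | ∃ i : ℤ, Even i ∧ (g = x ^ i ∨ g = x ^ i * y)}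
  one_mem' := ⟨0, by simp⟩
  mul_mem' := by
    have hyy : y * y = x ^ m := by rw [← h2, sq]
    rintro _ _ ⟨i, hi, rfl | rfl⟩ ⟨j, hj, rfl | rfl⟩
    · exact ⟨i + j, hi.add hj, Or.inl (zpow_add ..).symm⟩
    · exact ⟨i + j, hi.add hj, Or.inr (by rw [zpow_add, mul_assoc])⟩
    · exact ⟨i - j, hi.sub hj, Or.inr (by rw [mul_assoc, y_mul_zpow h, ← mul_assoc, ← zpow_add, sub_eq_add_neg])⟩
    · exact ⟨i - j + m, (hi.sub hj).add hm, Or.inl (by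
        rw [mul_assoc, ← mul_assoc y, y_mul_zpow h, mul_assoc, hyy, ← zpow_add, ← zpow_add]; ring_nf)⟩
  inv_mem' := by
    have hyy : y * y = x ^ m := by rw [← h2, sq]
    rintro _ ⟨i, hi, rfl | rfl⟩
    · exact ⟨-i, hi.neg, Or.inl (by simp)⟩
    · refine ⟨i + m, hi.add hm, Or.inr ?_⟩
      rw [inv_eq_iff_mul_eq_one, mul_assoc, ← mul_assoc y, y_mul_zpow h, mul_assoc, hyy, ← zpow_add, ← zpow_add]
      rw [show i + (-(i + m) + m) = 0 by ring, zpow_zero]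

lemma y_notMem [Fintype G] {n : ℕ} {m : ℤ} (hn : 2 ≤ n) (hG : Fintype.card G = 2 * n) (hx : orderOf x = n)
    (h2 : y ^ 2 = x ^ m) (h : y * x = x⁻¹ * y)
    (hc : Subgroup.closure {x, y} = ⊤) : y ∉ Subgroup.zpowers x := by
  intro hy
  have htop : Subgroup.zpowers x = ⊤ := by
    rw [eq_top_iff, ← hc, Subgroup.closure_le]
    rintro g (rfl | rfl)
    · exact Subgroup.mem_zpowers _
    · exact hy
  have := Nat.card_zpowers x
  rw [htop, Subgroup.card_top, Nat.card_eq_fintype_card, hG, hx] at this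
  omega

lemma zp_index [Fintype G] {n : ℕ} (hn : 2 ≤ n) (hG : Fintype.card G = 2 * n) (hx : orderOf x = n) :
    (Subgroup.zpowers x).index = 2 := by
  have := Subgroup.index_mul_card (Subgroup.zpowers x)
  rw [Nat.card_zpowers, hx, Nat.card_eq_fintype_card, hG] at this
  exact Nat.eq_of_mul_eq_mul_right (by omega) this

lemma zpow_even {n : ℕ} (hx : orderOf x = n) (he : Even n) {i j : ℤ} (hij : x ^ i = x ^ j) (hj : Even j) :
    Even i := by
  have : x ^ (i - j) = 1 := by rw [zpow_sub, hij, mul_inv_cancel]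
  rw [← orderOf_dvd_iff_zpow_eq_one, hx] at this
  have h2 : (2 : ℤ) ∣ n := by exact_mod_cast he.two_dvd
  have := h2.trans this
  have := hj.two_dvd
  apply even_iff_two_dvd.mpr
  omega

lemma zpow_mem_even [Fintype G] {n : ℕ} {m : ℤ} (hn : 2 ≤ n) (hG : Fintype.card G = 2 * n) (hx : orderOf x = n)
    (he : Even n) (hm : Even m)
    (h2 : y ^ 2 = x ^ m) (h : y * x = x⁻¹ * y)
    (hc : Subgroup.closure {x, y} = ⊤) (i : ℤ) :
    (x ^ i ∈ evenSub h2 h hm ↔ Even i) ∧ (x ^ i * y ∈ evenSub h2 h hm ↔ Even i) := by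
  have hy := y_notMem hn hG hx h2 h hc
  refine ⟨⟨?_, fun hi => ⟨i, hi, Or.inl rfl⟩⟩, ⟨?_, fun hi => ⟨i, hi, Or.inr rfl⟩⟩⟩
  · rintro ⟨j, hj, hh | hh⟩
    · exact zpow_even hx he hh hj
    · exact absurd ⟨-j + i, by simp only []; rw [zpow_add, hh]; simp⟩ hy
  · rintro ⟨j, hj, hh | hh⟩
    · exact absurd ⟨-i + j, by simp only []; rw [zpow_add, ← hh]; simp⟩ hy
    · exact zpow_even hx he (mul_right_cancel hh) hj

lemma evenSub_index [Fintype G] {n : ℕ} {m : ℤ} (hn : 2 ≤ n) (hG : Fintype.card G = 2 * n) (hx : orderOf x = n)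
    (he : Even n) (hm : Even m)
    (h2 : y ^ 2 = x ^ m) (h : y * x = x⁻¹ * y)
    (hc : Subgroup.closure {x, y} = ⊤) : (evenSub h2 h hm).index = 2 := by
  have key := zpow_mem_even hn hG hx he hm h2 h hc
  rw [Subgroup.index_eq_two_iff]
  refine ⟨x, fun b => ?_⟩
  obtain ⟨i, rfl | rfl⟩ := normal_form h2 h hc b
  · rw [(key i).1, ← zpow_add_one, (key _).1, Int.even_add_one]
    by_cases hi : Even i <;> simp [Xor, hi]
  · rw [(key i).2, mul_assoc, h, ← mul_assoc, ← zpow_sub_one, (key _).2, Int.even_sub_one]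
    by_cases hi : Even i <;> simp [Xor, hi]

end grp

lemma pos_inj {T a a' c c' : ℕ} (hc : c < T) (hc' : c' < T) (h : T * a + c = T * a' + c') :
    a = a' ∧ c = c' := by
  have hT : 0 < T := by omega
  have h1 : (T * a + c) / T = a := by rw [Nat.mul_add_div hT, Nat.div_eq_of_lt hc, add_zero]
  have h2 : (T * a' + c') / T = a' := by rw [Nat.mul_add_div hT, Nat.div_eq_of_lt hc', add_zero]
  have : a = a' := by rw [← h1, ← h2, h]
  subst this
  exact ⟨rfl, by omega⟩

lemma el_inj {G : Type} [Group G] {x y : G} {n P Q : ℕ} (hx : orderOf x = n) (hP : P < n) (hQ : Q < n)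
    (h : x ^ P * y = x ^ Q * y) : P = Q := by
  have := mul_right_cancel h
  exact pow_injOn_Iio_orderOf (by simpa [hx] using hP) (by simpa [hx] using hQ) this

lemma el_inj2 {G : Type} [Group G] {x y : G} {n T a a' c c' K : ℕ} (hx : orderOf x = n)
    (hK : T * K ≤ n) (ha : a < K) (ha' : a' < K) (hc : c < T) (hc' : c' < T)
    (h : x ^ (T * a + c) * y = x ^ (T * a' + c') * y) : a = a' ∧ c = c' := by
  have e1 : T * (a + 1) ≤ T * K := Nat.mul_le_mul_left _ ha
  have e2 : T * (a' + 1) ≤ T * K := Nat.mul_le_mul_left _ ha'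
  exact pos_inj hc hc' (el_inj hx (by nlinarith) (by nlinarith) h)

lemma el_mul {G : Type} [Group G] {x y : G} {m : ℤ} (h2 : y ^ 2 = x ^ m) (h : y * x = x⁻¹ * y)
    (i j : ℕ) : (x ^ i * y) * (x ^ j * y) = x ^ ((i : ℤ) - j + m) := by
  have hyy : y * y = x ^ m := by rw [← h2, sq]
  rw [← zpow_natCast, ← zpow_natCast, mul_assoc, ← mul_assoc y, y_mul_zpow h, mul_assoc, hyy,
    ← zpow_add, ← zpow_add]; ring_nf

lemma good_one {G : Type} [Group G] [Fintype G] [DecidableEq G] {x y : G} {n : ℕ} {m : ℤ}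
    (hn : 2 ≤ n) (hG : Fintype.card G = 2 * n) (hx : orderOf x = n)
    (he : Even n) (hm : Even m)
    (h2 : y ^ 2 = x ^ m) (h : y * x = x⁻¹ * y)
    (hc : Subgroup.closure {x, y} = ⊤) (t r : ℕ) (ht : 0 < t) (htr : 2 * t * (2 * r) ≤ n)
    (hh : n ≤ 2 * (t * t)) (S : Finset G)
    (hS : ∀ g, IsOrdProd S g → g ∈ Subgroup.zpowers x ∧ g ∈ evenSub h2 h hm)
    (hA : ∀ v < t, ∃ u < r, x ^ (2 * t * u + (2 * v + 1)) * y ∈ S ∧ x ^ (2 * t * u + 2 * v) * y ∈ S)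
    (hB : ∀ v < t, ∃ u < r, x ^ (2 * t * (r + u) + (v + t)) * y ∈ S ∧ x ^ (2 * t * (r + u) + v) * y ∈ S) :
    IsOrdProd S 1 := by
  choose! u hu hu1 hu2 using hA
  choose! w hw hw1 hw2 using hB
  set p : ℕ → G := fun v => x ^ (2 * t * u v + (2 * v + 1)) * y with hp
  set q : ℕ → G := fun v => x ^ (2 * t * u v + 2 * v) * y with hq
  set p' : ℕ → G := fun v => x ^ (2 * t * (r + w v) + (v + t)) * y with hp'
  set q' : ℕ → G := fun v => x ^ (2 * t * (r + w v) + v) * y with hq'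
  have I : ∀ {a a' c c' : ℕ}, a < 2 * r → a' < 2 * r → c < 2 * t → c' < 2 * t →
      x ^ (2 * t * a + c) * y = x ^ (2 * t * a' + c') * y → a = a' ∧ c = c' :=
    fun ha ha' hc hc' h => el_inj2 hx htr ha ha' hc hc' h
  have J1 := isOrdProd_pairs p q (x ^ (m - 1)) (x ^ (2 : ℤ)) t
    ((Commute.refl x).zpow_zpow _ _)
    (fun i hi hh => by
      have := hu i hi
      have := (I (by omega) (by omega) (by omega) (by omega) hh).2; omega)
    (fun i j hij hj => by
      have := hu i (by omega)
      have := hu j (by omega)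
      refine ⟨?_, ?_, ?_, ?_⟩ <;> intro hh <;>
        have := (I (by omega) (by omega) (by omega) (by omega) hh).2 <;> omega)
    (fun i hi => by
      simp only [hp, hq]; rw [el_mul h2 h, ← zpow_add]; push_cast; ring_nf)
    (fun i hi => by
      simp only [hp, hq]; rw [el_mul h2 h]; push_cast; ring_nf)
  have J2 := isOrdProd_pairs p' q' (x ^ (m - t)) (x ^ (2 * t : ℤ)) t
    ((Commute.refl x).zpow_zpow _ _)
    (fun i hi hh => by
      have := hw i hi
      have := (I (by omega) (by omega) (by omega) (by omega) hh).2; omega)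
    (fun i j hij hj => by
      have := hw i (by omega)
      have := hw j (by omega)
      refine ⟨?_, ?_, ?_, ?_⟩ <;> intro hh <;>
        have := (I (by omega) (by omega) (by omega) (by omega) hh).2 <;> omega)
    (fun i hi => by
      simp only [hp', hq']; rw [el_mul h2 h, ← zpow_add]; push_cast; ring_nf)
    (fun i hi => by
      simp only [hp', hq']; rw [el_mul h2 h]; push_cast; ring_nf)
  set U := (Finset.range t).biUnion (fun i => ({p i, q i} : Finset G)) with hU
  set U' := (Finset.range t).biUnion (fun i => ({p' i, q' i} : Finset G)) with hU'
  have hd : Disjoint U U' := by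
    rw [Finset.disjoint_left]
    intro a ha hb
    simp only [hU, hU', Finset.mem_biUnion, Finset.mem_range, Finset.mem_insert, Finset.mem_singleton] at ha hb
    obtain ⟨i, hi, ha⟩ := ha
    obtain ⟨j, hj, hb⟩ := hb
    have := hu i (by omega)
    have := hw j (by omega)
    rcases ha with rfl | rfl <;> rcases hb with hh | hh <;>
      have := (I (by omega) (by omega) (by omega) (by omega) hh).1 <;> omega
  have hsub : U ∪ U' ⊆ S := by
    intro a ha
    simp only [hU, hU', Finset.mem_union, Finset.mem_biUnion, Finset.mem_range, Finset.mem_insert, Finset.mem_singleton] at ha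
    rcases ha with ⟨i, hi, rfl | rfl⟩ | ⟨i, hi, rfl | rfl⟩
    · exact hu1 i hi
    · exact hu2 i hi
    · exact hw1 i hi
    · exact hw2 i hi
  obtain ⟨g, hg⟩ := IsOrdProd.exists' (S \ (U ∪ U'))
  have K : ∀ j l, j ≤ t → l ≤ t → IsOrdProd S (g * ((x ^ (m - 1)) ^ t * (x ^ (2 : ℤ)) ^ j *
      ((x ^ (m - t)) ^ t * (x ^ (2 * t : ℤ)) ^ l))) := by
    intro j l hj hl
    have := hg.mul ((J1 j hj).mul (J2 l hl) hd) Finset.sdiff_disjoint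
    rwa [Finset.sdiff_union_of_subset hsub] at this
  obtain ⟨k1, k2⟩ := hS _ (K 0 0 (by omega) (by omega))
  obtain ⟨i, hi⟩ := k1
  simp only at hi
  rw [← hi, (zpow_mem_even hn hG hx he hm h2 h hc i).1] at k2
  obtain ⟨c, hc2⟩ := k2
  obtain ⟨e, he2⟩ := he
  have e0 : (0 : ℤ) < e := by omega
  obtain ⟨ρ, hρ⟩ := Int.eq_ofNat_of_zero_le (Int.emod_nonneg (-c) e0.ne')
  have hρ2 : ρ < e := by have := Int.emod_lt_of_pos (-c) e0; omega
  have hl : ρ / t ≤ t := by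
    apply Nat.div_le_of_le_mul
    omega
  have := K (ρ % t) (ρ / t) (Nat.mod_lt _ ht).le hl
  convert this using 1
  have hcomm : g = x ^ i * ((x ^ (m - 1)) ^ t * (x ^ (m - t)) ^ t)⁻¹ := by
    rw [eq_mul_inv_iff_mul_eq, hi]; simp
  have hρ3 : ((ρ % t : ℕ) : ℤ) + t * ((ρ / t : ℕ) : ℤ) = ρ := by exact_mod_cast Nat.mod_add_div ρ t
  rw [hcomm]
  simp only [← zpow_natCast, ← zpow_mul, ← zpow_add, ← zpow_neg]
  symm
  rw [← orderOf_dvd_iff_zpow_eq_one, hx]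
  have hdv : (e : ℤ) ∣ c + ρ := by
    rw [← hρ]
    have := Int.emod_add_mul_ediv (-c) e
    exact ⟨-(-c / e), by linarith⟩
  obtain ⟨f, hf⟩ := hdv
  refine ⟨f, ?_⟩
  rw [hc2, he2]
  push_cast at hρ3 ⊢
  linear_combination 2 * hf + 2 * hρ3

open Finset in
lemma badCount {G : Type} [Fintype G] [DecidableEq G] (f g : ℕ → ℕ → G) (t r : ℕ)
    (h0 : ∀ v < t, ∀ i < r, f v i ≠ g v i)
    (h1 : ∀ v < t, ∀ i j, i < j → j < r → f v i ≠ f v j ∧ f v i ≠ g v j ∧ g v i ≠ f v j ∧ g v i ≠ g v j) :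
    (univ.filter (fun S : Finset G => ∃ v < t, ∀ i < r, ¬ (f v i ∈ S ∧ g v i ∈ S))).card * 4 ^ r
      ≤ t * (3 ^ r * 2 ^ (Fintype.card G)) := by
  have e : univ.filter (fun S : Finset G => ∃ v < t, ∀ i < r, ¬ (f v i ∈ S ∧ g v i ∈ S)) =
      (range t).biUnion (fun v => univ.filter (fun S : Finset G => ∀ i < r, ¬ (f v i ∈ S ∧ g v i ∈ S))) := by
    ext S; simp only [mem_filter, mem_univ, true_and, mem_biUnion, mem_range]
  rw [e]
  calc _ ≤ (∑ v ∈ range t, (univ.filter (fun S : Finset G => ∀ i < r, ¬ (f v i ∈ S ∧ g v i ∈ S))).card) * 4 ^ r :=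
        Nat.mul_le_mul_right _ card_biUnion_le
    _ = ∑ v ∈ range t, (univ.filter (fun S : Finset G => ∀ i < r, ¬ (f v i ∈ S ∧ g v i ∈ S))).card * 4 ^ r := by
        rw [sum_mul]
    _ ≤ ∑ v ∈ range t, (3 ^ r * 2 ^ (Fintype.card G)) := by
        refine sum_le_sum fun v hv => ?_
        rw [mem_range] at hv
        exact cntAux _ _ _ (h0 v hv) (h1 v hv)
    _ = _ := by simp

lemma prod_pm {G : Type} (χ : G → ℤ) (hχ : ∀ g, χ g = 1 ∨ χ g = -1) (S : Finset G) :
    ∏ g ∈ S, χ g = 1 ∨ ∏ g ∈ S, χ g = -1 := by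
  classical
  induction S using Finset.induction_on with
  | empty => simp
  | insert a S ha ih =>
    rw [Finset.prod_insert ha]
    rcases ih with h | h <;> rcases hχ a with h' | h' <;> simp [h, h']

lemma trivCount {G : Type} [Group G] [Fintype G] [DecidableEq G] (n : ℕ) (hc : Fintype.card G = 2 * n)
    (χ ψ : G →* ℤ) (hχ : ∀ g, χ g = 1 ∨ χ g = -1) (hψ : ∀ g, ψ g = 1 ∨ ψ g = -1)
    (hne : χ ≠ 1) (hne' : ψ ≠ 1) (hne2 : χ * ψ ≠ 1) :
    |4 * (((Finset.powersetCard n (Finset.univ : Finset G)).filter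
      (fun S => ∏ g ∈ S, χ g = 1 ∧ ∏ g ∈ S, ψ g = 1)).card : ℤ) - (2 * n).choose n| ≤ 3 * 2 ^ n := by
  have a1 := charBound n hc χ hχ hne
  have a2 := charBound n hc ψ hψ hne'
  have a3 := charBound n hc (χ * ψ) (fun g => by
    rw [MonoidHom.mul_apply]
    rcases hχ g with h | h <;> rcases hψ g with h' | h' <;> simp [h, h']) hne2
  have key : 4 * (((Finset.powersetCard n (Finset.univ : Finset G)).filter
      (fun S => ∏ g ∈ S, χ g = 1 ∧ ∏ g ∈ S, ψ g = 1)).card : ℤ) - (2 * n).choose n =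
      ∑ S ∈ Finset.powersetCard n (Finset.univ : Finset G), ∏ g ∈ S, χ g
      + ∑ S ∈ Finset.powersetCard n (Finset.univ : Finset G), ∏ g ∈ S, ψ g
      + ∑ S ∈ Finset.powersetCard n (Finset.univ : Finset G), ∏ g ∈ S, (χ * ψ) g := by
    have hC : ((2 * n).choose n : ℤ) = ∑ S ∈ Finset.powersetCard n (Finset.univ : Finset G), 1 := by
      rw [Finset.sum_const, Finset.card_powersetCard, Finset.card_univ, hc]; simp
    rw [hC, Finset.card_filter]
    push_cast
    rw [Finset.mul_sum, ← Finset.sum_sub_distrib, ← Finset.sum_add_distrib, ← Finset.sum_add_distrib]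
    refine Finset.sum_congr rfl fun S _ => ?_
    simp only [MonoidHom.mul_apply, Finset.prod_mul_distrib]
    rcases prod_pm χ hχ S with h | h <;> rcases prod_pm ψ hψ S with h' | h' <;> simp [h, h']
  rw [key]
  refine (abs_add_three _ _ _).trans ?_
  linarith

lemma mainBound {G : Type} [Group G] [Fintype G] {x y : G} {n : ℕ} {m : ℤ}
    (hn : 2 ≤ n) (hG : Fintype.card G = 2 * n) (hx : orderOf x = n)
    (he : Even n) (hm : Even m)
    (h2 : y ^ 2 = x ^ m) (h : y * x = x⁻¹ * y)
    (hc : Subgroup.closure {x, y} = ⊤) (t r : ℕ) (ht : 0 < t) (htr : 2 * t * (2 * r) ≤ n)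
    (hh : n ≤ 2 * (t * t)) :
    |(Set.ncard {S : Finset G | S.card = n ∧ (1 : G) ∉ prodTuples n (S : Set G)} : ℝ) /
            (Nat.choose (2 * n) n) - 3 / 4| ≤ 2 * n * (1 / 2) ^ n + 4 * n * t * (3 / 4) ^ r := by
  classical
  have i1 := zp_index hn hG hx
  have i2 := evenSub_index hn hG hx he hm h2 h hc
  set χ := sgnChar _ i1 with hχ
  set ψ := sgnChar _ i2 with hψ
  have key := zpow_mem_even hn hG hx he hm h2 h hc
  have hy := y_notMem hn hG hx h2 h hc
  have χy : χ y = -1 := (sgnChar_or _ i1 y).resolve_left (by rwa [sgnChar_eq_one])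
  have ψy : ψ y = 1 := by rw [hψ, sgnChar_eq_one]; simpa using (key 0).2
  have ψx : ψ x = -1 := (sgnChar_or _ i2 x).resolve_left (by
    rw [sgnChar_eq_one]; have := (key 1).1; simp at this; exact this)
  have T := trivCount n hG χ ψ (sgnChar_or _ i1) (sgnChar_or _ i2)
    (fun hh => by rw [hh] at χy; simp at χy) (fun hh => by rw [hh] at ψx; simp at ψx)
    (fun hh => by
      have : (χ * ψ) y = 1 := by rw [hh]; rfl
      rw [MonoidHom.mul_apply, χy, ψy] at this; simp at this)
  set P := Finset.powersetCard n (Finset.univ : Finset G) with hP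
  set Tr := P.filter (fun S => ∏ g ∈ S, χ g = 1 ∧ ∏ g ∈ S, ψ g = 1) with hTr
  set NT := P.filter (fun S => ¬ (∏ g ∈ S, χ g = 1 ∧ ∏ g ∈ S, ψ g = 1)) with hNT
  have hsum : Tr.card + NT.card = (2 * n).choose n := by
    rw [← hG, ← Finset.card_univ, ← Finset.card_powersetCard]
    exact Finset.card_filter_add_card_filter_not _
  set F := P.filter (fun S => ¬ IsOrdProd S 1) with hF
  have hset : {S : Finset G | S.card = n ∧ (1 : G) ∉ prodTuples n (S : Set G)} = (F : Set (Finset G)) := by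
    ext S
    simp only [hF, hP, Set.mem_setOf_eq, Finset.coe_filter, Finset.mem_powersetCard_univ]
    constructor
    · rintro ⟨rfl, hb⟩; exact ⟨rfl, by rwa [← isOrdProd_iff]⟩
    · rintro ⟨rfl, hb⟩; exact ⟨rfl, by rwa [isOrdProd_iff]⟩
  rw [hset, Set.ncard_coe_finset]
  have I : ∀ {a a' c c' : ℕ}, a < 2 * r → a' < 2 * r → c < 2 * t → c' < 2 * t →
      x ^ (2 * t * a + c) * y = x ^ (2 * t * a' + c') * y → a = a' ∧ c = c' :=
    fun ha ha' hc hc' h => el_inj2 hx htr ha ha' hc hc' h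
  have B1 := badCount (fun v u => x ^ (2 * t * u + (2 * v + 1)) * y)
    (fun v u => x ^ (2 * t * u + 2 * v) * y) t r
    (fun v hv i hi hh => by
      have := (I (by omega) (by omega) (by omega) (by omega) hh).2; omega)
    (fun v hv i j hij hj => by
      refine ⟨?_, ?_, ?_, ?_⟩ <;> intro hh <;>
        have := (I (by omega) (by omega) (by omega) (by omega) hh).1 <;> omega)
  have B2 := badCount (fun v u => x ^ (2 * t * (r + u) + (v + t)) * y)
    (fun v u => x ^ (2 * t * (r + u) + v) * y) t r
    (fun v hv i hi hh => by
      have := (I (by omega) (by omega) (by omega) (by omega) hh).2; omega)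
    (fun v hv i j hij hj => by
      refine ⟨?_, ?_, ?_, ?_⟩ <;> intro hh <;>
        have := (I (by omega) (by omega) (by omega) (by omega) hh).1 <;> omega)
  set D1 := Finset.univ.filter (fun S : Finset G => ∃ v < t, ∀ i < r,
    ¬ ((fun v u => x ^ (2 * t * u + (2 * v + 1)) * y) v i ∈ S ∧ (fun v u => x ^ (2 * t * u + 2 * v) * y) v i ∈ S)) with hD1
  set D2 := Finset.univ.filter (fun S : Finset G => ∃ v < t, ∀ i < r,
    ¬ ((fun v u => x ^ (2 * t * (r + u) + (v + t)) * y) v i ∈ S ∧ (fun v u => x ^ (2 * t * (r + u) + v) * y) v i ∈ S)) with hD2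
  have c1 : NT.card ≤ F.card := by
    apply Finset.card_le_card
    intro S hS
    simp only [hNT, hF, Finset.mem_filter] at hS ⊢
    refine ⟨hS.1, fun ho => hS.2 ?_⟩
    rw [← ho.map χ, ← ho.map ψ]; simp
  have c2 : F.card ≤ NT.card + (D1.card + D2.card) := by
    refine le_trans (Finset.card_le_card (t := NT ∪ (D1 ∪ D2)) ?_)
      ((Finset.card_union_le _ _).trans (Nat.add_le_add_left (Finset.card_union_le _ _) _))
    intro S hS
    by_contra hcon
    simp only [hNT, hF, hD1, hD2, Finset.mem_filter, Finset.mem_union, Finset.mem_univ, true_and, not_or] at hS hcon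
    obtain ⟨hS1, hS2⟩ := hS
    obtain ⟨k1, k2, k3⟩ := hcon
    push Not at k2 k3
    have k4 : ∏ g ∈ S, χ g = 1 ∧ ∏ g ∈ S, ψ g = 1 := by tauto
    apply hS2
    refine good_one hn hG hx he hm h2 h hc t r ht htr hh S ?_ k2 k3
    intro g hg
    rw [← sgnChar_eq_one _ i1, ← sgnChar_eq_one _ i2]
    exact ⟨(hg.map χ).trans k4.1, (hg.map ψ).trans k4.2⟩
  have c3 := Nat.four_pow_le_two_mul_self_mul_centralBinom n (by omega)
  rw [Nat.centralBinom_eq_two_mul_choose] at c3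
  rw [hG, pow_mul] at B1 B2
  norm_num at B1 B2
  have hCpos : 0 < (2 * n).choose n := Nat.choose_pos (by omega)
  generalize (2 * n).choose n = C at *
  generalize hd1 : D1.card = d1 at *
  generalize hd2 : D2.card = d2 at *
  generalize Tr.card = tr at *
  generalize NT.card = nt at *
  generalize F.card = f at *
  have hn0 : (0 : ℝ) < n := by exact_mod_cast (by omega : 0 < n)
  have T' : |4 * (tr : ℝ) - C| ≤ 3 * 2 ^ n := by exact_mod_cast T
  have B1' : (d1 : ℝ) ≤ t * (3 / 4) ^ r * 4 ^ n := by
    have : (d1 : ℝ) * 4 ^ r ≤ t * (3 ^ r * 4 ^ n) := by exact_mod_cast B1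
    rw [div_pow]
    rw [← le_div_iff₀ (by positivity)] at this
    refine this.trans (le_of_eq ?_)
    ring
  have B2' : (d2 : ℝ) ≤ t * (3 / 4) ^ r * 4 ^ n := by
    have : (d2 : ℝ) * 4 ^ r ≤ t * (3 ^ r * 4 ^ n) := by exact_mod_cast B2
    rw [div_pow]
    rw [← le_div_iff₀ (by positivity)] at this
    refine this.trans (le_of_eq ?_)
    ring
  have c3' : (4 : ℝ) ^ n ≤ 2 * n * C := by exact_mod_cast c3
  have c1' : (nt : ℝ) ≤ f := by exact_mod_cast c1
  have c2' : (f : ℝ) ≤ nt + (d1 + d2) := by exact_mod_cast c2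
  have hs' : (tr : ℝ) + nt = C := by exact_mod_cast hsum
  have hC0 : (0 : ℝ) < C := by exact_mod_cast hCpos
  have e24 : (2 : ℝ) ^ n = (1 / 2) ^ n * 4 ^ n := by rw [← mul_pow]; norm_num
  have g1 : (2 : ℝ) ^ n ≤ 2 * n * (1 / 2) ^ n * C := by
    rw [e24]
    have := mul_le_mul_of_nonneg_left c3' (by positivity : (0 : ℝ) ≤ (1 / 2) ^ n)
    linarith
  have g2 : t * (3 / 4) ^ r * (4 : ℝ) ^ n ≤ 2 * n * t * (3 / 4) ^ r * C := by
    have := mul_le_mul_of_nonneg_left c3' (by positivity : (0 : ℝ) ≤ t * (3 / 4) ^ r)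
    linarith
  have e5 : (f : ℝ) / C - 3 / 4 = (f - 3 / 4 * C) / C := by field_simp
  rw [e5, abs_div, abs_of_pos hC0, div_le_iff₀ hC0]
  rw [abs_le] at T' ⊢
  have : (0 : ℝ) ≤ 2 ^ n := by positivity
  have : (0 : ℝ) ≤ n * t * (3 / 4) ^ r * C := by positivity
  constructor <;> linarith

lemma limAux (ε : ℝ) (hε : 0 < ε) : ∃ R : ℕ, ∀ r ≥ R, (8 * (2 * r + 3) ^ 3 : ℝ) * (3 / 4) ^ r < ε := by
  have h3 := tendsto_pow_const_mul_const_pow_of_abs_lt_one 3 (r := (3 / 4 : ℝ)) (by norm_num [abs_lt])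
  have h4 := (h3.const_mul 1000)
  rw [mul_zero] at h4
  obtain ⟨R, hR⟩ := Filter.eventually_atTop.mp (h4.eventually_lt_const hε)
  refine ⟨max R 1, fun r hr => lt_of_le_of_lt ?_ (hR r (le_trans (le_max_left _ _) hr))⟩
  have h1 : (1 : ℝ) ≤ r := by exact_mod_cast (le_trans (le_max_right _ _) hr)
  rw [← mul_assoc]
  apply mul_le_mul_of_nonneg_right _ (by positivity)
  have : (2 * r + 3 : ℝ) ^ 3 ≤ (5 * r) ^ 3 := by gcongr; linarith
  rw [mul_pow] at this
  linarith

lemma limAux2 (ε : ℝ) (hε : 0 < ε) : ∃ R : ℕ, ∀ n ≥ R, (2 * n : ℝ) * (1 / 2) ^ n < ε := by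
  have h3 := tendsto_pow_const_mul_const_pow_of_abs_lt_one 1 (r := (1 / 2 : ℝ)) (by norm_num [abs_lt])
  have h4 := (h3.const_mul 2)
  rw [mul_zero] at h4
  obtain ⟨R, hR⟩ := Filter.eventually_atTop.mp (h4.eventually_lt_const hε)
  refine ⟨R, fun r hr => ?_⟩
  have := hR r hr
  simpa [mul_assoc] using this


/-- As `n → ∞` (over even `n`, with `m` even), the proportion of `n`-element subsets of
`H_{n,m}` that contain no `n` distinct elements with product `1` tends to `3/4`. -/
theorem prob_failing_tendsto (ε : ℝ) (hε : 0 < ε) :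
    ∃ N : ℕ, ∀ (n : ℕ) (m : ℤ), N ≤ n → 2 ≤ n → Even n → Even m →
      ∀ (G : Type) [Group G] [Fintype G], ∀ x y : G,
        Fintype.card G = 2 * n → orderOf x = n → y ^ 2 = x ^ m → y * x = x⁻¹ * y →
        Subgroup.closure {x, y} = ⊤ →
        |(Set.ncard {S : Finset G | S.card = n ∧ (1 : G) ∉ prodTuples n (S : Set G)} : ℝ) /
            (Nat.choose (2 * n) n) - 3 / 4| < ε := by

  obtain ⟨R1, hR1⟩ := limAux (ε / 2) (by positivity)
  obtain ⟨R2, hR2⟩ := limAux2 (ε / 2) (by positivity)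
  refine ⟨max R2 (2 * (2 * R1 + 3) ^ 2), ?_⟩
  intro n m hN hn he hm G _ _ x y hG hx h2 h hc
  have hN1 : R2 ≤ n := le_trans (le_max_left _ _) hN
  have hN2 : 2 * (2 * R1 + 3) ^ 2 ≤ n := le_trans (le_max_right _ _) hN
  obtain ⟨e, he2⟩ := id he
  set s := Nat.sqrt e with hs
  have s1 : s * s ≤ e := Nat.sqrt_le e
  have s2 : e < (s + 1) * (s + 1) := Nat.lt_succ_sqrt e
  have s3 : 2 * R1 + 3 ≤ s := by
    rw [hs, Nat.le_sqrt']; omega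
  set r := (s - 1) / 2 with hr
  have r1 : 2 * r + 1 ≤ s := by omega
  have r2 : s + 1 ≤ 2 * r + 3 := by omega
  have r3 : R1 ≤ r := by omega
  have key := mainBound hn hG hx he hm h2 h hc (s + 1) r (by omega)
    (by obtain ⟨d, hd⟩ := Nat.exists_eq_add_of_le r1; nlinarith) (by omega)
  refine lt_of_le_of_lt key ?_
  have a1 := hR1 r r3
  have a2 := hR2 n hN1
  have b1 : (4 * n * (s + 1 : ℕ) : ℝ) ≤ 8 * (2 * r + 3) ^ 3 := by
    have hq : (s + 1) * (s + 1) ≤ (2 * r + 3) * (2 * r + 3) := Nat.mul_le_mul r2 r2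
    have hq1 : n ≤ 2 * ((2 * r + 3) * (2 * r + 3)) := by omega
    have := Nat.mul_le_mul hq1 r2
    have h8 : 4 * n * (s + 1) ≤ 8 * (2 * r + 3) ^ 3 := by
      calc 4 * n * (s + 1) = 4 * (n * (s + 1)) := by ring
        _ ≤ 4 * (2 * ((2 * r + 3) * (2 * r + 3)) * (2 * r + 3)) := Nat.mul_le_mul_left _ this
        _ = _ := by ring
    exact_mod_cast h8
  have b2 := mul_le_mul_of_nonneg_right b1 (by positivity : (0 : ℝ) ≤ (3 / 4) ^ r)
  linarith
end
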